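/- Let (R, m, k) be a d-dimensional local hypersurface with d ≥ 1 whose completion is a hypersurface in an unramified regular local ring, and let M be a finitely generated R-module with pd_{R_p}(M_p) < ∞ for all primes p ≠ m and θ^R(M, -) = 0. If the n-fold tensor power ⊗_R^n M is torsion-free for some n ≥ 2, then pd_R(M) ≤ (d-1)/n. Consequently, if M is not free, then ⊗_R^n M has torsion for each n ≥ max{2, d}. -/

import Mathlib

open RingTheory.Sequence CategoryTheory

universe u

noncomputable section

/-- Depth of a module: supremum of lengths of weakly regular sequences consisting of nonunits.
For a f.g. module over a noetherian local ring this is the usual depth, and the zero module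
has depth `⊤`. -/
def rdepth (A : Type u) [CommRing A] (M : Type u) [AddCommGroup M] [Module A M] : ℕ∞ :=
  sSup {n : ℕ∞ | ∃ rs : List A, (rs.length : ℕ∞) = n ∧ (∀ r ∈ rs, r ∈ nonunits A) ∧
    RingTheory.Sequence.IsWeaklyRegular M rs}

/-- Serre's condition `(S_n)`. -/
def SerreCond (R : Type u) [CommRing R] (M : Type u) [AddCommGroup M] [Module R M] (n : ℕ) :
    Prop :=
  ∀ (p : Ideal R) (hp : p.IsPrime), Nontrivial (LocalizedModule p.primeCompl M) →
    min (n : ℕ∞) (Order.height (⟨p, hp⟩ : PrimeSpectrum R)) ≤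
      rdepth (Localization.AtPrime p) (LocalizedModule p.primeCompl M)

/-- `Tor_i^R(M, N)` as an object of `ModuleCat R`. -/
def TorModCat (R : Type u) [CommRing R] (i : ℕ) (M N : Type u) [AddCommGroup M] [Module R M]
    [AddCommGroup N] [Module R N] : ModuleCat.{u} R :=
  ((Tor (ModuleCat.{u} R) i).obj (ModuleCat.of R M)).obj (ModuleCat.of R N)

/-- `Tor_i^R(M, N)` as a type (with its `R`-module structure given by instances below). -/
def TorM (R : Type u) [CommRing R] (i : ℕ) (M N : Type u) [AddCommGroup M] [Module R M]
    [AddCommGroup N] [Module R N] : Type u :=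
  TorModCat R i M N

instance (R : Type u) [CommRing R] (i : ℕ) (M N : Type u) [AddCommGroup M] [Module R M]
    [AddCommGroup N] [Module R N] : AddCommGroup (TorM R i M N) :=
  inferInstanceAs (AddCommGroup (TorModCat R i M N))

instance (R : Type u) [CommRing R] (i : ℕ) (M N : Type u) [AddCommGroup M] [Module R M]
    [AddCommGroup N] [Module R N] : Module R (TorM R i M N) :=
  inferInstanceAs (Module R (TorModCat R i M N))

/-- A regular local ring: noetherian local, whose maximal ideal is generated by a
(weakly) regular sequence. -/
def IsRegLocal (Q : Type u) [CommRing Q] : Prop :=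
  IsNoetherianRing Q ∧ IsLocalRing Q ∧
    ∃ rs : List Q, RingTheory.Sequence.IsWeaklyRegular Q rs ∧ (∀ r ∈ rs, r ∈ nonunits Q) ∧
      Ideal.span {x | x ∈ rs} = Ideal.span (nonunits Q)

/-- A (local) complete intersection: noetherian local ring whose completion is a regular
local ring modulo a regular sequence (of nonunits). -/
def IsCIRing (R : Type u) [CommRing R] : Prop :=
  IsNoetherianRing R ∧ IsLocalRing R ∧
    ∃ (Q : Type u) (_ : CommRing Q), IsRegLocal Q ∧
      ∃ rs : List Q, (∀ r ∈ rs, r ∈ nonunits Q) ∧ RingTheory.Sequence.IsWeaklyRegular Q rs ∧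
        Nonempty ((Q ⧸ Ideal.span {x | x ∈ rs}) ≃+* AdicCompletion (Ideal.span (nonunits R)) R)

/-- A hypersurface: noetherian local ring whose completion is a regular local ring modulo
a single non-zerodivisor in the maximal ideal. -/
def IsHypersurfaceRing (R : Type u) [CommRing R] : Prop :=
  IsNoetherianRing R ∧ IsLocalRing R ∧
    ∃ (Q : Type u) (_ : CommRing Q), IsRegLocal Q ∧
      ∃ f : Q, f ∈ nonunits Q ∧ f ∈ nonZeroDivisors Q ∧
        Nonempty ((Q ⧸ Ideal.span {f}) ≃+* AdicCompletion (Ideal.span (nonunits R)) R)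

/-- Maximal Cohen-Macaulay module over a local ring: depth equals the Krull dimension. -/
def IsMCM (R : Type u) [CommRing R] (M : Type u) [AddCommGroup M] [Module R M] : Prop :=
  (rdepth R M : WithBot ℕ∞) = ringKrullDim R

/-- Cohen-Macaulay local ring. -/
def IsCMLocalRing (A : Type u) [CommRing A] : Prop :=
  IsNoetherianRing A ∧ IsLocalRing A ∧ (rdepth A A : WithBot ℕ∞) = ringKrullDim A

/-- `M` has (constant) rank: free of the same rank at every minimal prime. -/
def HasRank (R : Type u) [CommRing R] (M : Type u) [AddCommGroup M] [Module R M] : Prop :=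
  ∃ r : ℕ, ∀ (p : Ideal R) (hp : p.IsPrime), p ∈ minimalPrimes R →
    Nonempty ((LocalizedModule (@Ideal.primeCompl R _ p hp) M)
      ≃ₗ[Localization (@Ideal.primeCompl R _ p hp)]
      (Fin r → Localization (@Ideal.primeCompl R _ p hp)))

/-- Projective dimension at most `n`. -/
def pdLE (R : Type u) [CommRing R] : ℕ → ∀ (M : Type u) [AddCommGroup M] [Module R M], Prop
  | 0, M, _, _ => Module.Projective R M
  | n+1, M, _, _ => ∃ (P : Type u) (_ : AddCommGroup P) (_ : Module R P),
      Module.Projective R P ∧ ∃ f : P →ₗ[R] M, Function.Surjective f ∧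
        pdLE R n (LinearMap.ker f)

/-- Injective dimension at most `n`. -/
def idLE (R : Type u) [CommRing R] : ℕ → ∀ (M : Type u) [AddCommGroup M] [Module R M], Prop
  | 0, M, _, _ => Module.Injective R M
  | n+1, M, _, _ => ∃ (I : Type u) (_ : AddCommGroup I) (_ : Module R I),
      Module.Injective R I ∧ ∃ f : M →ₗ[R] I, Function.Injective f ∧
        idLE R n (I ⧸ LinearMap.range f)

/-- Gorenstein local ring: noetherian local with finite self-injective dimension. -/
def IsGorensteinLocalRing (R : Type u) [CommRing R] : Prop :=
  IsNoetherianRing R ∧ IsLocalRing R ∧ ∃ n : ℕ, idLE R n R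

/-- The map `M → R^ν` obtained from a free cover `ε : R^ν ↠ M^*` by dualizing and composing
with the biduality map; its cokernel is the pushforward `M₁`. -/
def pushMap (R M : Type u) [CommRing R] [AddCommGroup M] [Module R M] {ν : ℕ}
    (ε : (Fin ν → R) →ₗ[R] Module.Dual R M) : M →ₗ[R] (Fin ν → R) where
  toFun m := fun i => ε (Pi.single i 1) m
  map_add' x y := by funext i; simp
  map_smul' r x := by funext i; simp

/-- Length of a module, as the Krull dimension of its lattice of submodules. -/
def mlen (R : Type u) [CommRing R] (M : Type u) [AddCommGroup M] [Module R M] :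
    WithBot ℕ∞ :=
  Order.krullDim (Submodule R M)

/-- An unramified regular local ring: equicharacteristic (contains a field), or of mixed
characteristic `(0, p)` with `p` not in the square of the maximal ideal. -/
def IsUnramifiedRegLocal (Q : Type u) [CommRing Q] : Prop :=
  IsRegLocal Q ∧
    ((∃ (K : Type u) (_ : Field K), Nonempty (K →+* Q)) ∨
     (CharZero Q ∧ ∃ p : ℕ, p.Prime ∧ (p : Q) ∈ nonunits Q ∧
        (p : Q) ∉ (Ideal.span (nonunits Q)) ^ 2))

section
set_option linter.unusedSectionVars false

/-! ## Part A: additive functions and abstract positivity -/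

/-- additive `ℕ∞`-valued functions on finite modules -/
structure AddFn (B : Type u) [CommRing B] where
  f : ∀ (H : Type u) [AddCommGroup H] [Module B H], ℕ∞
  zero : ∀ (H : Type u) [AddCommGroup H] [Module B H], Subsingleton H → f H = 0
  add : ∀ (H1 H2 H3 : Type u) [AddCommGroup H1] [Module B H1] [AddCommGroup H2] [Module B H2]
    [AddCommGroup H3] [Module B H3] (a : H1 →ₗ[B] H2) (b : H2 →ₗ[B] H3), Module.Finite B H2 →
    Function.Injective a → Function.Exact a b → Function.Surjective b → f H2 = f H1 + f H3

section AddFnBasic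
variable {B : Type u} [CommRing B] [IsNoetherianRing B] (l : AddFn B)
variable {H1 H2 H3 : Type u} [AddCommGroup H1] [Module B H1] [AddCommGroup H2] [Module B H2]
    [AddCommGroup H3] [Module B H3]

lemma AddFn.iso [Module.Finite B H2] (e : H1 ≃ₗ[B] H2) : l.f H1 = l.f H2 := by
  have := l.add H1 H2 PUnit.{u+1} e.toLinearMap 0 inferInstance e.injective
    (by
      intro y
      simp) (fun x => ⟨0, Subsingleton.elim _ _⟩)
  rw [l.zero PUnit.{u+1} inferInstance] at this
  simpa using this.symm

lemma AddFn.add_sub [Module.Finite B H2] (N : Submodule B H2) :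
    l.f H2 = l.f N + l.f (H2 ⧸ N) :=
  l.add N H2 (H2 ⧸ N) N.subtype N.mkQ inferInstance N.injective_subtype
    (LinearMap.exact_subtype_mkQ N) N.mkQ_surjective

lemma AddFn.add_ker_range [Module.Finite B H2] (g : H2 →ₗ[B] H3) :
    l.f H2 = l.f (LinearMap.ker g) + l.f (LinearMap.range g) :=
  l.add _ H2 _ (LinearMap.ker g).subtype g.rangeRestrict inferInstance
    (Submodule.injective_subtype _) (by
      intro y
      simp [Subtype.ext_iff]) g.surjective_rangeRestrict

lemma AddFn.le_of_inj [Module.Finite B H2] (g : H1 →ₗ[B] H2) (h : Function.Injective g) :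
    l.f H1 ≤ l.f H2 := by
  rw [l.iso (LinearEquiv.ofInjective g h), l.add_sub (LinearMap.range g)]
  exact le_self_add

lemma AddFn.le_of_surj [Module.Finite B H1] (g : H1 →ₗ[B] H2) (h : Function.Surjective g) :
    l.f H2 ≤ l.f H1 := by
  have : Module.Finite B H2 := Module.Finite.of_surjective g h
  rw [l.add_ker_range g, ← l.iso (H1 := LinearMap.range g) (H2 := H2)
    (LinearEquiv.ofTop _ (LinearMap.range_eq_top.2 h))]
  exact le_add_self

lemma AddFn.add_exact [Module.Finite B H2] (a : H1 →ₗ[B] H2) (b : H2 →ₗ[B] H3)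
    (h : Function.Exact a b) :
    l.f H2 = l.f (LinearMap.range a) + l.f (LinearMap.range b) := by
  rw [l.add_ker_range b, LinearMap.exact_iff.1 h]

lemma AddFn.le_exact [Module.Finite B H1] [Module.Finite B H2] [Module.Finite B H3]
    (a : H1 →ₗ[B] H2) (b : H2 →ₗ[B] H3) (h : Function.Exact a b) :
    l.f H2 ≤ l.f H1 + l.f H3 := by
  rw [l.add_exact a b h]
  exact add_le_add (l.le_of_surj a.rangeRestrict a.surjective_rangeRestrict)
    (l.le_of_inj (LinearMap.range b).subtype (Submodule.injective_subtype _))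

end AddFnBasic

section zthings
variable {B : Type u} [CommRing B] (z : B)
variable (H H1 H2 H3 : Type u) [AddCommGroup H] [Module B H] [AddCommGroup H1] [Module B H1]
  [AddCommGroup H2] [Module B H2]
    [AddCommGroup H3] [Module B H3]

/-- cokernel of multiplication by `z` -/
abbrev cz : Type u := H ⧸ LinearMap.range (LinearMap.lsmul B H z)
/-- kernel of multiplication by `z` -/
abbrev kz : Submodule B H := LinearMap.ker (LinearMap.lsmul B H z)

variable {H1 H2 H3}
/-- functoriality -/
def czMap (a : H1 →ₗ[B] H2) : cz z H1 →ₗ[B] cz z H2 :=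
  Submodule.mapQ _ _ a (by
    rintro _ ⟨x, rfl⟩
    exact ⟨a x, by simp⟩)
/-- functoriality -/
def kzMap (a : H1 →ₗ[B] H2) : kz z H1 →ₗ[B] kz z H2 :=
  a.restrict (by
    intro x hx
    have : z • x = 0 := hx
    change z • a x = 0
    rw [← map_smul, this, map_zero])

lemma cz_snake (a : H1 →ₗ[B] H2) (b : H2 →ₗ[B] H3) (ha : Function.Injective a)
    (hab : Function.Exact a b) (hb : Function.Surjective b) :
    ∃ δ : kz z H3 →ₗ[B] cz z H1, Function.Exact (kzMap z a) (kzMap z b) ∧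
      Function.Exact (kzMap z b) δ ∧ Function.Exact δ (czMap z a) ∧
      Function.Exact (czMap z a) (czMap z b) ∧ Function.Surjective (czMap z b) ∧
      Function.Injective (kzMap z a) := by
  have hz1 : (LinearMap.lsmul B H1 z) = LinearMap.lsmul B H1 z := rfl
  have c1 : a ∘ₗ (LinearMap.lsmul B H1 z) = (LinearMap.lsmul B H2 z) ∘ₗ a := by ext; simp
  have c2 : b ∘ₗ (LinearMap.lsmul B H2 z) = (LinearMap.lsmul B H3 z) ∘ₗ b := by ext; simp
  refine ⟨SnakeLemma.δ' (LinearMap.lsmul B H1 z) (LinearMap.lsmul B H2 z)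
      (LinearMap.lsmul B H3 z) a b hab a b hab c1 c2 (kz z H3).subtype
      (LinearMap.exact_subtype_ker_map _) (Submodule.mkQ _)
      (LinearMap.exact_map_mkQ_range _) hb ha, ?_, ?_, ?_, ?_, ?_, ?_⟩
  · intro y
    constructor
    · intro hy
      have hy' : b y.1 = 0 := congrArg Subtype.val hy
      obtain ⟨x, hx⟩ := (hab _).1 hy'
      refine ⟨⟨x, ?_⟩, Subtype.ext hx⟩
      change z • x = 0
      apply ha
      rw [map_smul, hx, map_zero]; exact y.2
    · rintro ⟨x, rfl⟩
      exact Subtype.ext (hab.apply_apply_eq_zero x.1)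
  · apply SnakeLemma.exact_δ'_right (ι₂ := (kz z H2).subtype)
    · exact LinearMap.exact_subtype_ker_map _
    · rfl
    · exact Submodule.injective_subtype _
  · apply SnakeLemma.exact_δ'_left (π₂ := Submodule.mkQ _)
    · exact LinearMap.exact_map_mkQ_range _
    · rfl
    · exact Submodule.mkQ_surjective _
  · intro y
    obtain ⟨y, rfl⟩ := Submodule.mkQ_surjective _ y
    constructor
    · intro hy
      have hy' : (Submodule.Quotient.mk (b y) : cz z H3) = 0 := hy
      rw [Submodule.Quotient.mk_eq_zero] at hy'
      obtain ⟨w, hw⟩ := hy'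
      obtain ⟨w, rfl⟩ := hb w
      have : b (y - z • w) = 0 := by
        rw [map_sub, ← hw]; simp
      obtain ⟨x, hx⟩ := (hab _).1 this
      refine ⟨Submodule.Quotient.mk x, ?_⟩
      change Submodule.Quotient.mk (a x) = _
      rw [hx]
      simp only [Submodule.mkQ_apply]
      rw [Submodule.Quotient.eq]
      exact ⟨-w, by simp⟩
    · rintro ⟨x, hx⟩
      obtain ⟨x, rfl⟩ := Submodule.mkQ_surjective _ x
      rw [← hx]
      change (Submodule.Quotient.mk (b (a x)) : cz z H3) = 0
      rw [hab.apply_apply_eq_zero]; rfl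
  · intro y
    obtain ⟨y, rfl⟩ := Submodule.mkQ_surjective _ y
    obtain ⟨x, rfl⟩ := hb y
    exact ⟨Submodule.Quotient.mk x, rfl⟩
  · intro x y h
    exact Subtype.ext (ha (congrArg Subtype.val h))

end zthings

section lamprime
variable {B : Type u} [CommRing B] [IsNoetherianRing B] (l : AddFn B) (z : B)
variable {H H1 H2 H3 : Type u} [AddCommGroup H] [Module B H] [AddCommGroup H1] [Module B H1]
  [AddCommGroup H2] [Module B H2]
    [AddCommGroup H3] [Module B H3]

lemma cz_pow_fin [Module.Finite B H] (h : l.f (cz z H) ≠ ⊤) (n : ℕ) : l.f (cz (z^n) H) ≠ ⊤ := by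
  induction n with
  | zero =>
    rw [l.zero]
    · simp
    · refine ⟨fun x y => ?_⟩
      obtain ⟨x, rfl⟩ := Submodule.mkQ_surjective _ x
      obtain ⟨y, rfl⟩ := Submodule.mkQ_surjective _ y
      simp only [Submodule.mkQ_apply]
      rw [Submodule.Quotient.eq]
      exact ⟨x - y, by simp⟩
  | succ n ih =>
    -- H/z -> H/z^{n+1} -> H/z^n
    let a : cz z H →ₗ[B] cz (z^(n+1)) H := Submodule.mapQ _ _ (LinearMap.lsmul B H (z^n)) (by
      rintro _ ⟨x, rfl⟩
      exact ⟨x, by simp [pow_succ, mul_smul, smul_comm z]⟩)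
    let b : cz (z^(n+1)) H →ₗ[B] cz (z^n) H := Submodule.mapQ _ _ LinearMap.id (by
      rintro _ ⟨x, rfl⟩
      exact ⟨z • x, by simp [pow_succ, mul_smul, smul_comm z]⟩)
    have hab : Function.Exact a b := by
      intro y
      obtain ⟨y, rfl⟩ := Submodule.mkQ_surjective _ y
      constructor
      · intro hy
        have hy' : (Submodule.Quotient.mk y : cz (z^n) H) = 0 := hy
        rw [Submodule.Quotient.mk_eq_zero] at hy'
        obtain ⟨x, rfl⟩ := hy'
        exact ⟨Submodule.Quotient.mk x, rfl⟩
      · rintro ⟨x, hx⟩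
        obtain ⟨x, rfl⟩ := Submodule.mkQ_surjective _ x
        rw [← hx]
        change (Submodule.Quotient.mk (z^n • x) : cz (z^n) H) = 0
        rw [Submodule.Quotient.mk_eq_zero]
        exact ⟨x, rfl⟩
    exact ne_top_of_le_ne_top (WithTop.add_ne_top.2 ⟨h, ih⟩) (l.le_exact a b hab)

lemma cz_sub_fin [Module.Finite B H2] (a : H1 →ₗ[B] H2) (ha : Function.Injective a)
    (h : l.f (cz z H2) ≠ ⊤) : l.f (cz z H1) ≠ ⊤ := by
  have : Module.Finite B H1 := Module.Finite.of_injective a ha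
  obtain ⟨k, hk⟩ := Ideal.exists_pow_inf_eq_pow_smul (Ideal.span {z}) (LinearMap.range a)
  have hk1 := hk (k+1) (by omega)
  let N : Submodule B H1 := Submodule.comap a (LinearMap.range (LinearMap.lsmul B H2 (z^(k+1))))
  have hN : N ≤ LinearMap.range (LinearMap.lsmul B H1 z) := by
    rintro x ⟨y, hy⟩
    have h1 : a x ∈ Ideal.span {z} ^ (k+1) • (⊤ : Submodule B H2) ⊓ LinearMap.range a := by
      refine ⟨?_, ⟨x, rfl⟩⟩
      rw [Ideal.span_singleton_pow, ← hy]
      exact Submodule.smul_mem_smul (Ideal.mem_span_singleton_self _) trivial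
    rw [hk1] at h1
    have h2 : a x ∈ Ideal.span {z} • LinearMap.range a := by
      have e : k + 1 - k = 1 := by omega
      rw [e, pow_one] at h1
      exact Submodule.smul_mono le_rfl inf_le_right h1
    rw [Submodule.ideal_span_singleton_smul] at h2
    obtain ⟨_, ⟨w, rfl⟩, hw⟩ := h2
    refine ⟨w, ha ?_⟩
    simpa using hw
  let f1 : H1 ⧸ N →ₗ[B] cz (z^(k+1)) H2 := Submodule.mapQ _ _ a le_rfl
  have hf1 : Function.Injective f1 := by
    rw [← LinearMap.ker_eq_bot, Submodule.eq_bot_iff]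
    intro y hy
    obtain ⟨y, rfl⟩ := Submodule.mkQ_surjective _ y
    have hy' : (Submodule.Quotient.mk (a y) : cz (z^(k+1)) H2) = 0 := hy
    rw [Submodule.Quotient.mk_eq_zero] at hy'
    rw [Submodule.mkQ_apply, Submodule.Quotient.mk_eq_zero]
    exact hy'
  have h3 : l.f (H1 ⧸ N) ≠ ⊤ := ne_top_of_le_ne_top (cz_pow_fin l z h (k+1)) (l.le_of_inj f1 hf1)
  exact ne_top_of_le_ne_top h3 (l.le_of_surj (Submodule.factor hN) (Submodule.factor_surjective hN))

lemma kz_fin [Module.Finite B H] (h : l.f (cz z H) ≠ ⊤) : l.f (kz z H) ≠ ⊤ := by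
  have h1 := cz_sub_fin l z (kz z H).subtype (Submodule.injective_subtype _) h
  refine ne_top_of_le_ne_top h1 (l.le_of_inj (Submodule.mkQ _) ?_)
  rw [← LinearMap.ker_eq_bot, Submodule.ker_mkQ]
  rw [Submodule.eq_bot_iff]
  rintro _ ⟨x, rfl⟩
  exact Subtype.ext x.2

/-- endomorphism with both finite -/
lemma AddFn.endo [Module.Finite B H] (h : l.f H ≠ ⊤) (g : H →ₗ[B] H) :
    l.f (LinearMap.ker g) = l.f (H ⧸ LinearMap.range g) := by
  have h1 := l.add_ker_range g
  have h2 := l.add_sub (LinearMap.range g)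
  have hr : l.f (LinearMap.range g) ≠ ⊤ := ne_top_of_le_ne_top h (h2 ▸ le_self_add)
  rw [h2, add_comm] at h1
  exact ((WithTop.add_right_inj hr).1 h1).symm

lemma kz_le_cz [Module.Finite B H] (h : l.f (cz z H) ≠ ⊤) : l.f (kz z H) ≤ l.f (cz z H) := by
  -- the z-power torsion stabilizes
  obtain ⟨n, hn⟩ := monotone_stabilizes_iff_noetherian.2 (inferInstance : IsNoetherian B H)
    ⟨fun n => kz (z^n) H, by
      apply monotone_nat_of_le_succ
      intro n x hx
      have : z^n • x = 0 := hx
      change z^(n+1) • x = 0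
      rw [pow_succ', mul_smul, this, smul_zero]⟩
  let G : Submodule B H := kz (z^n) H
  have hG : ∀ x : H, z • x ∈ G → x ∈ G := by
    intro x hx
    have h1 := hn (n+1) (by omega)
    simp only [OrderHom.coe_mk] at h1
    change x ∈ kz (z^n) H
    rw [h1]
    change z^(n+1) • x = 0
    rw [pow_succ, mul_smul]; exact hx
  have hfin : l.f (cz z G) ≠ ⊤ := cz_sub_fin l z G.subtype (Submodule.injective_subtype _) h
  have hGf : l.f G ≠ ⊤ := by
    have := cz_pow_fin l z hfin n
    refine ne_top_of_le_ne_top this (l.le_of_inj (Submodule.mkQ _) ?_)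
    rw [← LinearMap.ker_eq_bot, Submodule.ker_mkQ, Submodule.eq_bot_iff]
    rintro _ ⟨x, rfl⟩
    exact Subtype.ext x.2
  have e1 : l.f (kz z G) = l.f (cz z G) := l.endo hGf _
  have e2 : l.f (kz z H) ≤ l.f (kz z G) := by
    let φ : kz z H →ₗ[B] kz z G :=
      { toFun := fun x => ⟨⟨x.1, hG _ (by
          have : z • x.1 = 0 := x.2
          rw [this]; exact G.zero_mem)⟩, Subtype.ext x.2⟩
        map_add' := fun _ _ => rfl
        map_smul' := fun _ _ => rfl }
    exact l.le_of_inj φ (fun x y hxy => Subtype.ext (congrArg (fun w => w.1.1) hxy))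
  refine e2.trans (e1.le.trans (l.le_of_inj (czMap z G.subtype) ?_))
  rw [← LinearMap.ker_eq_bot, Submodule.eq_bot_iff]
  intro y hy
  obtain ⟨y, rfl⟩ := Submodule.mkQ_surjective _ y
  have hy' : (Submodule.Quotient.mk y.1 : cz z H) = 0 := hy
  rw [Submodule.Quotient.mk_eq_zero] at hy'
  obtain ⟨x, hx⟩ := hy'
  have hx' : z • x = y.1 := hx
  rw [Submodule.mkQ_apply, Submodule.Quotient.mk_eq_zero]
  exact ⟨⟨x, hG x (hx' ▸ y.2)⟩, Subtype.ext hx⟩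

lemma cz_add [Module.Finite B H2] (a : H1 →ₗ[B] H2) (b : H2 →ₗ[B] H3)
    (ha : Function.Injective a)
    (hab : Function.Exact a b) (hb : Function.Surjective b) :
    (l.f (cz z H2) ≠ ⊤ ↔ l.f (cz z H1) ≠ ⊤ ∧ l.f (cz z H3) ≠ ⊤) ∧
    l.f (kz z H1) + l.f (kz z H3) + l.f (cz z H2) = l.f (kz z H2) + l.f (cz z H1) + l.f (cz z H3)
     := by
  have : Module.Finite B H1 := Module.Finite.of_injective a ha
  have : Module.Finite B H3 := Module.Finite.of_surjective b hb
  obtain ⟨δ, h1, h2, h3, h4, h5, h6⟩ := cz_snake z a b ha hab hb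
  refine ⟨⟨fun h => ⟨cz_sub_fin l z a ha h, ne_top_of_le_ne_top h (l.le_of_surj _ h5)⟩,
    fun h => ne_top_of_le_ne_top (WithTop.add_ne_top.2 h) (l.le_exact _ _ h4)⟩, ?_⟩
  rw [l.iso (LinearEquiv.ofInjective _ h6), l.add_exact _ _ h1, l.add_exact _ _ h2,
    l.add_exact _ _ h3, l.add_exact _ _ h4, ← l.iso (H1 := LinearMap.range (czMap z b))
    (LinearEquiv.ofTop _ (LinearMap.range_eq_top.2 h5))]
  ring

open Classical in
/-- the derived additive function -/
def AddFn.der : AddFn B where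
  f H _ _ := if l.f (cz z H) = ⊤ then ⊤ else l.f (cz z H) - l.f (kz z H)
  zero H _ _ hH := by
    have : l.f (cz z H) = 0 := l.zero _ ⟨fun x y => by
      obtain ⟨x, rfl⟩ := Submodule.mkQ_surjective _ x
      obtain ⟨y, rfl⟩ := Submodule.mkQ_surjective _ y
      rw [Subsingleton.elim x y]⟩
    simp [this]
  add H1 H2 H3 _ _ _ _ _ _ a b hf ha hab hb := by
    have : Module.Finite B H1 := Module.Finite.of_injective a ha
    have : Module.Finite B H3 := Module.Finite.of_surjective b hb
    obtain ⟨h1, h2⟩ := cz_add l z a b ha hab hb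
    by_cases h : l.f (cz z H2) = ⊤
    · rw [if_pos h]
      by_cases h' : l.f (cz z H1) = ⊤
      · simp [h']
      · have : l.f (cz z H3) = ⊤ := by
          by_contra h''
          exact (h1.2 ⟨h', h''⟩) h
        simp [this]
    · obtain ⟨h', h''⟩ := h1.1 h
      rw [if_neg h, if_neg h', if_neg h'']
      have k1 := kz_le_cz l z h'
      have k2 := kz_le_cz l z h
      have k3 := kz_le_cz l z h''
      have f1 := kz_fin l z h'
      have f2 := kz_fin l z h
      have f3 := kz_fin l z h''
      obtain ⟨c1, e1⟩ := ENat.ne_top_iff_exists.1 h'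
      obtain ⟨c2, e2⟩ := ENat.ne_top_iff_exists.1 h
      obtain ⟨c3, e3⟩ := ENat.ne_top_iff_exists.1 h''
      obtain ⟨d1, e4⟩ := ENat.ne_top_iff_exists.1 f1
      obtain ⟨d2, e5⟩ := ENat.ne_top_iff_exists.1 f2
      obtain ⟨d3, e6⟩ := ENat.ne_top_iff_exists.1 f3
      rw [← e1, ← e2, ← e3, ← e4, ← e5, ← e6] at h2
      rw [← e1, ← e4] at k1
      rw [← e2, ← e5] at k2
      rw [← e3, ← e6] at k3
      rw [← e1, ← e2, ← e3, ← e4, ← e5, ← e6]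
      norm_cast at h2 k1 k2 k3 ⊢
      omega

lemma AddFn.der_of_fin [Module.Finite B H] (h : l.f (cz z H) ≠ ⊤) :
    (l.der z).f H + l.f (kz z H) = l.f (cz z H) := by
  have : (l.der z).f H = l.f (cz z H) - l.f (kz z H) := if_neg h
  rw [this]
  exact tsub_add_cancel_of_le (kz_le_cz l z h)

lemma AddFn.der_ne_top [Module.Finite B H] (h : l.f (cz z H) ≠ ⊤) :
    (l.der z).f H ≠ ⊤ :=
  ne_top_of_le_ne_top h ((l.der_of_fin z h) ▸ le_self_add)

lemma AddFn.cz_le_of_inj (h : Function.Injective (LinearMap.lsmul B H z)) :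
    l.f (cz z H) ≤ (l.der z).f H := by
  have e : l.f (kz z H) = 0 := l.zero _ (by
    rw [kz, LinearMap.ker_eq_bot.2 h]; infer_instance)
  change _ ≤ (if l.f (cz z H) = ⊤ then ⊤ else l.f (cz z H) - l.f (kz z H))
  split_ifs
  · exact le_top
  · rw [e]; simp

end lamprime
end

section
set_option linter.unusedSectionVars false

lemma wf_prime (B : Type u) [CommRing B] [IsNoetherianRing B] :
    WellFounded (fun a b : PrimeSpectrum B => a < b) := by
  apply Subrelation.wf (r := InvImage (· < ·) (fun p : PrimeSpectrum B => p.asIdeal.height))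
  · intro a b hab
    exact Ideal.height_strict_mono_of_isPrime hab
  · exact InvImage.wf _ wellFounded_lt

section supp
variable {B : Type u} [CommRing B]
variable {H H1 H2 H3 : Type u} [AddCommGroup H] [Module B H] [AddCommGroup H1] [Module B H1]
  [AddCommGroup H2] [Module B H2] [AddCommGroup H3] [Module B H3]

lemma supp_exact (a : H1 →ₗ[B] H2) (b : H2 →ₗ[B] H3) (h : Function.Exact a b)
    (q : PrimeSpectrum B) (h1 : q ∉ Module.support B H1) (h3 : q ∉ Module.support B H3) :
    q ∉ Module.support B H2 := by
  rw [Module.notMem_support_iff'] at *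
  intro y
  obtain ⟨r, hr, e⟩ := h3 (b y)
  rw [← map_smul] at e
  obtain ⟨x, hx⟩ := (h _).1 e
  obtain ⟨s, hs, e'⟩ := h1 x
  refine ⟨s * r, q.2.mul_notMem hs hr, ?_⟩
  rw [mul_smul, ← hx, ← map_smul, e', map_zero]

lemma supp_of_smul (z : B) (q : PrimeSpectrum B) (hz : z ∉ q.asIdeal) (h : ∀ x : H, z • x = 0) :
    q ∉ Module.support B H := by
  rw [Module.notMem_support_iff']
  exact fun x => ⟨z, hz, h x⟩

lemma exists_ann [Module.Finite B H] (q : PrimeSpectrum B) (h : q ∉ Module.support B H) :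
    ∃ s ∉ q.asIdeal, ∀ x : H, s • x = 0 := by
  rw [Module.mem_support_iff_of_finite] at h
  obtain ⟨s, hs, hs'⟩ := SetLike.not_le_iff_exists.1 h
  exact ⟨s, hs', Module.mem_annihilator.1 hs⟩

lemma supp_cz [Module.Finite B H] (z : B) (q : PrimeSpectrum B) (hz : z ∈ q.asIdeal)
    (h : q ∈ Module.support B H) : q ∈ Module.support B (cz z H) := by
  by_contra hc
  obtain ⟨s, hs, hs'⟩ := exists_ann q hc
  -- s H ≤ z H ; determinant trick
  have hle : LinearMap.range (LinearMap.lsmul B H s) ≤ Ideal.span {z} • (⊤ : Submodule B H) := by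
    rintro _ ⟨x, rfl⟩
    have := hs' (Submodule.Quotient.mk x)
    rw [← Submodule.Quotient.mk_smul, Submodule.Quotient.mk_eq_zero] at this
    obtain ⟨y, hy⟩ := this
    simp only [LinearMap.lsmul_apply] at hy ⊢
    rw [← hy]
    exact Submodule.smul_mem_smul (Ideal.mem_span_singleton_self _) trivial
  obtain ⟨p, hp1, -, hp2, hp3⟩ := LinearMap.exists_monic_and_natDegree_eq_and_coeff_mem_pow_and_aeval_eq_zero B
    (LinearMap.lsmul B H s) (Ideal.span {z}) hle
  rw [Module.mem_support_iff_of_finite] at h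
  have h1 : p.eval s ∈ Module.annihilator B H := by
    rw [Module.mem_annihilator]
    intro x
    have h2 := congrArg (fun f => f x) hp3
    have e : Polynomial.aeval (LinearMap.lsmul B H s) p x = p.eval s • x := by
      have : (LinearMap.lsmul B H s) = algebraMap B (Module.End B H) s := rfl
      rw [this, Polynomial.aeval_algebraMap_apply]
      rfl
    rw [← e]; exact h2
  have h2 := h h1
  rw [Polynomial.eval_eq_sum_range, Finset.sum_range_succ, hp1.coeff_natDegree, one_mul] at h2
  have h3 : ∑ x ∈ Finset.range p.natDegree, p.coeff x * s ^ x ∈ q.asIdeal := by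
    refine Ideal.sum_mem _ fun i hi => Ideal.mul_mem_right _ _ ?_
    have := hp2 i
    have hlt := Finset.mem_range.1 hi
    have h4 : Ideal.span {z} ^ (p.natDegree - i) ≤ Ideal.span {z} :=
      Ideal.pow_le_self (by omega)
    exact ((Ideal.span_singleton_le_iff_mem _).2 hz) (h4 this)
  have h5 := (Ideal.add_mem_iff_right _ h3).1 h2
  exact hs (q.2.mem_of_pow_mem _ h5)

lemma supp_quot (p q : PrimeSpectrum B) (h : p ≤ q) :
    q ∈ Module.support B (B ⧸ p.asIdeal) := by
  rw [Module.mem_support_iff_of_finite, Ideal.annihilator_quotient]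
  exact h

lemma ass_of_min [IsNoetherianRing B] [Module.Finite B H] (q : PrimeSpectrum B)
    (h : q ∈ Module.support B H)
    (hm : ∀ q' : PrimeSpectrum B, q' ≤ q → q' ∈ Module.support B H → q' = q) :
    q.asIdeal ∈ associatedPrimes B H := by
  apply Module.associatedPrimes.minimalPrimes_annihilator_subset_associatedPrimes
  rw [Module.mem_support_iff_of_finite] at h
  refine ⟨⟨q.2, h⟩, ?_⟩
  rintro p ⟨hp, hp'⟩ hle
  have := hm ⟨p, hp⟩ hle ((Module.mem_support_iff_of_finite).2 hp')
  rw [← this]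

lemma ass_elt [IsNoetherianRing B] (q : PrimeSpectrum B) (h : q.asIdeal ∈ associatedPrimes B H) :
    ∃ x : H, ∀ b : B, b • x = 0 ↔ b ∈ q.asIdeal := by
  obtain ⟨-, x, hx⟩ := isAssociatedPrime_iff.1 h
  refine ⟨x, fun b => ?_⟩
  rw [hx, Submodule.mem_colon_singleton, Submodule.mem_bot]

end supp

section tower
variable (B : Type u) [CommRing B]

/-- Koszul-type towers -/
def KTower : ℕ → ∀ (H : ℕ → Type u) [∀ i, AddCommGroup (H i)] [∀ i, Module B (H i)], Prop
  | 0, H, _, _ => (∀ i, Module.Finite B (H i)) ∧ ∀ i, Subsingleton (H (i+1))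
  | n+1, H, _, _ => (∀ i, Module.Finite B (H i)) ∧
      ∃ (H' : ℕ → Type u) (_ : ∀ i, AddCommGroup (H' i)) (_ : ∀ i, Module B (H' i)) (z : B)
        (α : ∀ i, H' i →ₗ[B] H i) (δ : ∀ i, H (i+1) →ₗ[B] H' i),
        KTower n H' ∧ (∀ i, Function.Exact (LinearMap.lsmul B (H' i) z) (α i)) ∧
        (∀ i, Function.Exact (α (i+1)) (δ i)) ∧
        (∀ i, Function.Exact (δ i) (LinearMap.lsmul B (H' i) z))

variable {B}
variable {H : ℕ → Type u} [∀ i, AddCommGroup (H i)] [∀ i, Module B (H i)]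

lemma KTower.finite {n : ℕ} (h : KTower B n H) (i : ℕ) : Module.Finite B (H i) := by
  cases n with
  | zero => exact h.1 i
  | succ n => exact h.1 i

lemma KTower.vanish {n : ℕ} (h : KTower B n H) (i : ℕ) (hi : n < i) : Subsingleton (H i) := by
  induction n generalizing i H with
  | zero => obtain ⟨j, rfl⟩ : ∃ j, i = j + 1 := ⟨i-1, by omega⟩; exact h.2 j
  | succ n ih =>
    obtain ⟨-, H', _, _, z, α, δ, hT, h1, h2, h3⟩ := h
    obtain ⟨j, rfl⟩ : ∃ j, i = j + 1 := ⟨i-1, by omega⟩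
    have s1 := ih hT (j+1) (by omega)
    have s2 := ih hT j (by omega)
    refine subsingleton_of_forall_eq 0 fun x => ?_
    obtain ⟨y, rfl⟩ := (h2 j x).1 (Subsingleton.elim _ _)
    rw [Subsingleton.elim y 0, map_zero]

/-- the exact piece -/
lemma step_ker {H0 H1 X : Type u} [AddCommGroup H0] [Module B H0] [AddCommGroup H1] [Module B H1]
    [AddCommGroup X] [Module B X] (z : B) (δ : H1 →ₗ[B] X)
    (h : Function.Exact δ (LinearMap.lsmul B X z)) : LinearMap.range δ = kz z X :=
  (LinearMap.exact_iff.1 h).symm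

end tower

section positivity
variable {B : Type u} [CommRing B] [IsNoetherianRing B]

lemma step_val (l : AddFn B) {X' Y X : Type u} [AddCommGroup X'] [Module B X'] [AddCommGroup Y]
    [Module B Y] [AddCommGroup X] [Module B X] [Module.Finite B X] [Module.Finite B Y]
    [Module.Finite B X'] (z : B) (α : X' →ₗ[B] Y) (δ : Y →ₗ[B] X)
    (h1 : Function.Exact (LinearMap.lsmul B X' z) α) (h2 : Function.Exact α δ)
    (h3 : Function.Exact δ (LinearMap.lsmul B X z)) :
    l.f Y = l.f (cz z X') + l.f (kz z X) := by
  rw [l.add_exact α δ h2, step_ker (H0 := Y) z δ h3]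
  congr 1
  have e : LinearMap.ker α = LinearMap.range (LinearMap.lsmul B X' z) := LinearMap.exact_iff.1 h1
  exact (l.iso ((Submodule.quotEquivOfEq _ _ e.symm).trans α.quotKerEquivRange)).symm

/-- Euler characteristic from index `1` up to `m` -/
def chi1 (l : AddFn B) (H : ℕ → Type u) [∀ i, AddCommGroup (H i)] [∀ i, Module B (H i)] (m : ℕ) :
    ℤ := ∑ j ∈ Finset.range m, (-1)^j * ((l.f (H (j+1))).toNat : ℤ)

lemma chi_step (l : AddFn B) {H H' : ℕ → Type u} [∀ i, AddCommGroup (H i)] [∀ i, Module B (H i)]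
    [∀ i, AddCommGroup (H' i)] [∀ i, Module B (H' i)] (hf : ∀ i, Module.Finite B (H i))
    (hf' : ∀ i, Module.Finite B (H' i)) (z : B)
    (α : ∀ i, H' i →ₗ[B] H i) (δ : ∀ i, H (i+1) →ₗ[B] H' i)
    (h1 : ∀ i, Function.Exact (LinearMap.lsmul B (H' i) z) (α i))
    (h2 : ∀ i, Function.Exact (α (i+1)) (δ i))
    (h3 : ∀ i, Function.Exact (δ i) (LinearMap.lsmul B (H' i) z))
    (hfin : ∀ i, l.f (H (i+1)) ≠ ⊤) (m : ℕ) :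
    (∀ i, (l.der z).f (H' (i+1)) ≠ ⊤) ∧
    chi1 l H m = (l.f (kz z (H' 0))).toNat + chi1 (l.der z) H' m -
      (-1)^m * (l.f (kz z (H' m))).toNat := by
  have hv := fun i => step_val l z (α (i+1)) (δ i) (h1 (i+1)) (h2 i) (h3 i)
  have hc : ∀ i, l.f (cz z (H' (i+1))) ≠ ⊤ := fun i =>
    ne_top_of_le_ne_top (hfin i) ((hv i) ▸ le_self_add)
  have hk : ∀ i, l.f (kz z (H' i)) ≠ ⊤ := fun i =>
    ne_top_of_le_ne_top (hfin i) ((hv i) ▸ le_add_self)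
  have hd : ∀ i, (l.der z).f (H' (i+1)) ≠ ⊤ := fun i => l.der_ne_top z (hc i)
  refine ⟨hd, ?_⟩
  induction m with
  | zero => simp [chi1]
  | succ m ih =>
    have e : ∀ (l : AddFn B) (H : ℕ → Type u) [∀ i, AddCommGroup (H i)] [∀ i, Module B (H i)],
      chi1 l H (m+1) = chi1 l H m + (-1)^m * ((l.f (H (m+1))).toNat : ℤ) :=
        fun l H _ _ => Finset.sum_range_succ _ _
    rw [e, e, ih, hv m, ENat.toNat_add (hc m) (hk m), ← l.der_of_fin z (hc m),
      ENat.toNat_add (hd m) (hk (m+1))]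
    push_cast
    ring

/-- Positivity -/
theorem chi_nonneg {n : ℕ} (l : AddFn B) {H : ℕ → Type u} [∀ i, AddCommGroup (H i)]
    [∀ i, Module B (H i)] (hT : KTower B n H) (hfin : ∀ i, l.f (H (i+1)) ≠ ⊤) (m : ℕ)
    (hm : n ≤ m) : 0 ≤ chi1 l H m := by
  induction n generalizing l H with
  | zero =>
    refine Finset.sum_nonneg fun j _ => ?_
    rw [l.zero _ (hT.2 j)]; simp
  | succ n ih =>
    obtain ⟨hf, H', _, _, z, α, δ, hT', h1, h2, h3⟩ := hT
    obtain ⟨hd, e⟩ := chi_step l hf hT'.finite z α δ h1 h2 h3 hfin m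
    have s : Subsingleton (H' m) := hT'.vanish m (by omega)
    rw [e, l.zero (kz z (H' m)) inferInstance]
    have := ih (l.der z) hT' hd (by omega)
    simp only [ENat.toNat_zero, Nat.cast_zero, mul_zero, sub_zero]
    positivity

end positivity

section stepS
variable {B : Type u} [CommRing B] [IsNoetherianRing B]
  {X : Type u} [AddCommGroup X] [Module B X] [Module.Finite B X]

/-- step 1: `q` not associated -/
lemma S_step1 (z : B) (q : PrimeSpectrum B) (hz : z ∈ q.asIdeal)
    (h : q.asIdeal ∉ associatedPrimes B (cz z X))
    (hK : ∀ q' : PrimeSpectrum B, q' ≤ q → q' ∈ Module.support B (kz z X) → q' = q) :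
    q.asIdeal ∉ associatedPrimes B X := by
  intro hq
  let G : Submodule B X :=
    { carrier := {x | ∀ q' : PrimeSpectrum B, q' ≤ q → q' ≠ q → ∃ s ∉ q'.asIdeal, s • x = 0}
      zero_mem' := fun q' _ _ => ⟨1, fun h => q'.2.ne_top ((Ideal.eq_top_iff_one _).2 h), by simp⟩
      add_mem' := by
        intro x y hx hy q' h1 h2
        obtain ⟨s, hs, e⟩ := hx q' h1 h2
        obtain ⟨t, ht, e'⟩ := hy q' h1 h2
        refine ⟨s * t, q'.2.mul_notMem hs ht, ?_⟩
        rw [smul_add, mul_smul, mul_smul, e', smul_zero, smul_comm, e, smul_zero, add_zero]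
      smul_mem' := by
        intro b x hx q' h1 h2
        obtain ⟨s, hs, e⟩ := hx q' h1 h2
        exact ⟨s, hs, by rw [smul_comm, e, smul_zero]⟩ }
  have key : q ∉ Module.support B (cz z G) := by
    rw [Module.notMem_support_iff']
    intro g
    obtain ⟨g, rfl⟩ := Submodule.mkQ_surjective _ g
    -- find s
    have h1 : ∃ s ∉ q.asIdeal, s • g.1 ∈ LinearMap.range (LinearMap.lsmul B X z) := by
      by_contra hcon
      push Not at hcon
      let N : Submodule B (cz z X) := Submodule.span B {Submodule.Quotient.mk g.1}
      apply h
      apply associatedPrimes.subset_of_injective (f := N.subtype) (Submodule.injective_subtype _)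
      apply ass_of_min
      · rw [Module.mem_support_iff']
        refine ⟨⟨Submodule.Quotient.mk g.1, Submodule.mem_span_singleton_self _⟩, ?_⟩
        intro r hr he
        apply hcon r hr
        have := congrArg Subtype.val he
        simp only [Submodule.coe_smul, ZeroMemClass.coe_zero] at this
        rwa [← Submodule.Quotient.mk_smul, Submodule.Quotient.mk_eq_zero] at this
      · intro q' hq' hs
        by_contra hne
        obtain ⟨s, hs1, hs2⟩ := g.2 q' hq' hne
        refine supp_of_smul s q' hs1 ?_ hs
        rintro ⟨x, hx⟩
        obtain ⟨b, rfl⟩ := Submodule.mem_span_singleton.1 hx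
        apply Subtype.ext
        simp only [Submodule.coe_smul, ZeroMemClass.coe_zero]
        rw [smul_comm, ← Submodule.Quotient.mk_smul, hs2, Submodule.Quotient.mk_zero, smul_zero]
    obtain ⟨s, hs, x, hx⟩ := h1
    refine ⟨s, hs, ?_⟩
    rw [Submodule.mkQ_apply, ← Submodule.Quotient.mk_smul, Submodule.Quotient.mk_eq_zero]
    refine ⟨⟨x, ?_⟩, Subtype.ext hx⟩
    intro q' h1 h2
    obtain ⟨t, ht, e⟩ := g.2 q' h1 h2
    have hx' : z • x = s • g.1 := hx
    have hk : t • x ∈ kz z X := by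
      change z • t • x = 0
      rw [smul_comm, hx', smul_comm, e, smul_zero]
    have hK' : q' ∉ Module.support B (kz z X) := fun h' => h2 (hK q' h1 h')
    rw [Module.notMem_support_iff'] at hK'
    obtain ⟨w, hw, e2⟩ := hK' ⟨t • x, hk⟩
    refine ⟨w * t, q'.2.mul_notMem hw ht, ?_⟩
    rw [mul_smul]
    exact congrArg Subtype.val e2
  apply key
  apply supp_cz z q hz
  obtain ⟨x, hx⟩ := ass_elt q hq
  rw [Module.mem_support_iff']
  refine ⟨⟨x, ?_⟩, ?_⟩
  · intro q' h1 h2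
    have : ¬ q.asIdeal ≤ q'.asIdeal := fun h' => h2 (le_antisymm h1 h')
    obtain ⟨s, hs, hs'⟩ := SetLike.not_le_iff_exists.1 this
    exact ⟨s, hs', (hx s).2 hs⟩
  · intro r hr he
    exact hr ((hx r).1 (congrArg Subtype.val he))

/-- step 2 -/
lemma S_step2 (z : B) (q q' : PrimeSpectrum B) (hz : z ∈ q.asIdeal) (hqq : q' ≤ q)
    (h : q.asIdeal ∉ associatedPrimes B (cz z X))
    (hK : q ∉ Module.support B (kz z X))
    (hq' : q'.asIdeal ∈ associatedPrimes B X)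
    (hmin : ∀ r : PrimeSpectrum B, q' ≤ r → z ∈ r.asIdeal → r ≤ q → r = q) : False := by
  let U : Submodule B X :=
    { carrier := {x | ∃ s ∉ q.asIdeal, ∀ b ∈ q'.asIdeal, s • b • x = 0}
      zero_mem' := ⟨1, fun h => q.2.ne_top ((Ideal.eq_top_iff_one _).2 h), by simp⟩
      add_mem' := by
        rintro x y ⟨s, hs, e⟩ ⟨t, ht, e'⟩
        refine ⟨s * t, q.2.mul_notMem hs ht, fun b hb => ?_⟩
        rw [smul_add, smul_add, mul_smul, mul_smul, e' b hb, smul_zero, smul_comm, e b hb,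
          smul_zero, add_zero]
      smul_mem' := by
        rintro c x ⟨s, hs, e⟩
        refine ⟨s, hs, fun b hb => ?_⟩
        rw [smul_comm b c, smul_comm s c, e b hb, smul_zero] }
  obtain ⟨t, ht, hKt⟩ := exists_ann q hK
  have hinj : Function.Injective (czMap z U.subtype) := by
    rw [← LinearMap.ker_eq_bot, Submodule.eq_bot_iff]
    intro y hy
    obtain ⟨y, rfl⟩ := Submodule.mkQ_surjective _ y
    have hy' : (Submodule.Quotient.mk y.1 : cz z X) = 0 := hy
    rw [Submodule.Quotient.mk_eq_zero] at hy'
    obtain ⟨x, hx⟩ := hy'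
    have hx' : z • x = y.1 := hx
    rw [Submodule.mkQ_apply, Submodule.Quotient.mk_eq_zero]
    refine ⟨⟨x, ?_⟩, Subtype.ext hx⟩
    obtain ⟨s, hs, e⟩ := y.2
    refine ⟨t * s, q.2.mul_notMem ht hs, fun b hb => ?_⟩
    have hk : s • b • x ∈ kz z X := by
      change z • s • b • x = 0
      rw [smul_comm z s, smul_comm z b, hx', e b hb]
    rw [mul_smul]
    exact congrArg Subtype.val (hKt ⟨_, hk⟩)
  apply h
  apply associatedPrimes.subset_of_injective hinj
  obtain ⟨x, hx⟩ := ass_elt q' hq'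
  have hxU : x ∈ U := ⟨1, fun h => q.2.ne_top ((Ideal.eq_top_iff_one _).2 h),
    fun b hb => by rw [(hx b).2 hb, smul_zero]⟩
  have hs1 : q' ∈ Module.support B U := by
    rw [Module.mem_support_iff']
    exact ⟨⟨x, hxU⟩, fun r hr he => hr ((hx r).1 (congrArg Subtype.val he))⟩
  apply ass_of_min
  · exact supp_cz z q hz (Module.mem_support_mono hqq hs1)
  · intro r hr hrs
    have hzr : z ∈ r.asIdeal := by
      by_contra hc
      refine supp_of_smul z r hc ?_ hrs
      intro y
      obtain ⟨y, rfl⟩ := Submodule.mkQ_surjective _ y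
      rw [Submodule.mkQ_apply, ← Submodule.Quotient.mk_smul, Submodule.Quotient.mk_eq_zero]
      exact ⟨y, rfl⟩
    refine hmin r ?_ hzr hr
    have hrU : r ∈ Module.support B U :=
      Module.support_subset_of_surjective _ (Submodule.mkQ_surjective _) hrs
    rw [Module.mem_support_iff'] at hrU
    obtain ⟨⟨y, s, hs, e⟩, hy⟩ := hrU
    intro b hb
    by_contra hbr
    refine hy (s * b) (r.2.mul_notMem (fun h' => hs (hr h')) hbr) (Subtype.ext ?_)
    change (s * b) • y = 0
    rw [mul_smul, e b hb]

theorem tower_S {n : ℕ} {H : ℕ → Type u} [∀ i, AddCommGroup (H i)]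
    [∀ i, Module B (H i)] (hT : KTower B n H) (q : PrimeSpectrum B)
    (hfl : ∀ i, ∀ q' : PrimeSpectrum B, q' ≤ q → q' ∈ Module.support B (H (i+1)) → q' = q)
    (hass : q.asIdeal ∉ associatedPrimes B (H 0)) (j : ℕ) :
    q ∉ Module.support B (H (j+1)) := by
  induction n generalizing H q j with
  | zero => have := hT.2 j; rw [Module.support_eq_empty]; simp
  | succ n ih =>
    obtain ⟨hf, H', _, _, z, α, δ, hT', h1, h2, h3⟩ := hT
    have hf' := hT'.finite
    have hcz : ∀ i, ∀ q' : PrimeSpectrum B, q' ∈ Module.support B (cz z (H' i)) →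
        q' ∈ Module.support B (H i) := fun i q' => by
      have e : LinearMap.ker (α i) = LinearMap.range (LinearMap.lsmul B (H' i) z) :=
        LinearMap.exact_iff.1 (h1 i)
      rw [((Submodule.quotEquivOfEq _ _ e.symm).trans (α i).quotKerEquivRange).support_eq]
      exact fun h => Module.support_subset_of_injective _ (Submodule.injective_subtype _) h
    have hkz : ∀ i, ∀ q' : PrimeSpectrum B, q' ∈ Module.support B (kz z (H' i)) →
        q' ∈ Module.support B (H (i+1)) := fun i q' => by
      rw [← step_ker (H0 := H 0) z (δ i) (h3 i)]
      exact fun h => Module.support_subset_of_surjective _ (δ i).surjective_rangeRestrict h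
    by_cases hz : z ∈ q.asIdeal
    swap
    · -- trivial
      refine supp_exact ((α (j+1)).rangeRestrict.range.subtype.comp LinearMap.id |> fun _ =>
        (LinearMap.range (α (j+1))).subtype) ((δ j).rangeRestrict) ?_ q ?_ ?_
      · intro y
        rw [← LinearMap.mem_ker, LinearMap.ker_rangeRestrict, LinearMap.mem_ker, h2 j y]
        simp
      · refine supp_of_smul z q hz ?_
        rintro ⟨_, x, rfl⟩
        apply Subtype.ext
        change z • α (j+1) x = 0
        rw [← map_smul]
        exact (h1 (j+1)).apply_apply_eq_zero x
      · refine supp_of_smul z q hz ?_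
        rintro ⟨_, x, rfl⟩
        exact Subtype.ext ((h3 j).apply_apply_eq_zero x)
    have hass' : q.asIdeal ∉ associatedPrimes B (cz z (H' 0)) := by
      intro h
      apply hass
      have e : LinearMap.ker (α 0) = LinearMap.range (LinearMap.lsmul B (H' 0) z) :=
        LinearMap.exact_iff.1 (h1 0)
      refine associatedPrimes.subset_of_injective (f := (LinearMap.range (α 0)).subtype.comp
        ((Submodule.quotEquivOfEq _ _ e.symm).trans (α 0).quotKerEquivRange).toLinearMap) ?_ h
      exact (Submodule.injective_subtype _).comp (LinearEquiv.injective _)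
    have hqX : q.asIdeal ∉ associatedPrimes B (H' 0) :=
      S_step1 z q hz hass' (fun q' hle hs => hfl 0 q' hle (hkz 0 q' hs))
    have hKq : q ∉ Module.support B (kz z (H' 0)) := by
      intro h
      apply hqX
      apply associatedPrimes.subset_of_injective (f := (kz z (H' 0)).subtype)
        (Submodule.injective_subtype _)
      exact ass_of_min q h (fun q' hle hs => hfl 0 q' hle (hkz 0 q' hs))
    by_cases hall : ∀ i, q ∉ Module.support B (H' (i+1))
    · rw [← step_ker (H0 := H 0) z (δ 0) (h3 0)] at hKq
      refine supp_exact (α (j+1)) (δ j).rangeRestrict ?_ q (hall j) ?_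
      · intro y
        rw [← LinearMap.mem_ker, LinearMap.ker_rangeRestrict, LinearMap.mem_ker, h2 j y]
      · cases j with
        | zero => exact hKq
        | succ j =>
          exact fun h => hall j (Module.support_subset_of_injective _
            (Submodule.injective_subtype _) h)
    · exfalso
      push Not at hall
      -- minimal prime
      let T : Set (PrimeSpectrum B) := {p | p ≤ q ∧ ∃ i, p ∈ Module.support B (H' (i+1))}
      have hTne : T.Nonempty := ⟨q, le_rfl, hall⟩
      obtain ⟨q', ⟨hq'q, i, hi⟩, hmin⟩ := WellFounded.has_min (wf_prime B) T hTne
      have hmin' : ∀ p : PrimeSpectrum B, p ≤ q' → (∃ i, p ∈ Module.support B (H' (i+1))) →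
          p = q' := by
        intro p hp hp'
        by_contra hne
        exact hmin p ⟨hp.trans hq'q, hp'⟩ (lt_of_le_of_ne hp hne)
      have hq'ass : q'.asIdeal ∈ associatedPrimes B (H' 0) := by
        by_contra hc
        exact ih hT' q' (fun i p hp hs => hmin' p hp ⟨i, hs⟩) hc i hi
      refine S_step2 z q q' hz hq'q hass' hKq hq'ass ?_
      intro r hr hzr hrq
      exact hfl i r hrq (hcz (i+1) r (supp_cz z r hzr (Module.mem_support_mono hr hi)))

end stepS

section Str
variable {B : Type u} [CommRing B] [IsNoetherianRing B] (l : AddFn B)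
variable {H : Type u} [AddCommGroup H] [Module B H] [Module.Finite B H]

lemma AddFn.F1 (h : l.f H ≠ 0) : ∃ q : PrimeSpectrum B, q ∈ Module.support B H ∧
    l.f (B ⧸ q.asIdeal) ≠ 0 := by
  revert h
  induction ‹Module.Finite B H› using
    IsNoetherianRing.induction_on_isQuotientEquivQuotientPrime B with
  | subsingleton N => intro h; exact (h (l.zero _ inferInstance)).elim
  | quotient N p e =>
    intro h
    refine ⟨p, ?_, by rwa [← l.iso e]⟩
    rw [e.support_eq]
    exact supp_quot p p le_rfl
  | exact N1 N2 N3 f g hf hg hfg h1 h3 =>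
    intro h
    rw [l.add _ _ _ f g inferInstance hf hfg hg] at h
    by_cases h' : l.f N1 = 0
    · have : l.f N3 ≠ 0 := by
        intro h''; exact h (by rw [h', h'', add_zero])
      obtain ⟨q, hq, hq'⟩ := h3 this
      exact ⟨q, Module.support_subset_of_surjective _ hg hq, hq'⟩
    · obtain ⟨q, hq, hq'⟩ := h1 h'
      exact ⟨q, Module.support_subset_of_injective _ hf hq, hq'⟩

lemma AddFn.F2 (q : PrimeSpectrum B) (h : q ∈ Module.support B H) :
    l.f (B ⧸ q.asIdeal) ≤ l.f H := by
  rw [Module.mem_support_iff'] at h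
  obtain ⟨x, hx⟩ := h
  let φ := LinearMap.toSpanSingleton B H x
  have hle : LinearMap.ker φ ≤ q.asIdeal := by
    intro b hb
    by_contra hc
    exact hx b hc hb
  calc l.f (B ⧸ q.asIdeal) ≤ l.f (B ⧸ LinearMap.ker φ) :=
        l.le_of_surj (Submodule.factor hle) (Submodule.factor_surjective hle)
    _ = l.f (LinearMap.range φ) := l.iso φ.quotKerEquivRange
    _ ≤ l.f H := l.le_of_inj _ (Submodule.injective_subtype _)

lemma quot_prime_inj (z : B) (q : PrimeSpectrum B) (hz : z ∉ q.asIdeal) :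
    Function.Injective (LinearMap.lsmul B (B ⧸ q.asIdeal) z) := by
  rw [← LinearMap.ker_eq_bot, Submodule.eq_bot_iff]
  intro y hy
  obtain ⟨y, rfl⟩ := Submodule.mkQ_surjective _ y
  have hy' : (Submodule.Quotient.mk (z • y) : B ⧸ q.asIdeal) = 0 := hy
  rw [Submodule.Quotient.mk_eq_zero] at hy'
  rw [Submodule.mkQ_apply, Submodule.Quotient.mk_eq_zero]
  exact (q.2.mem_or_mem hy').resolve_left hz

lemma AddFn.cz_prime (z : B) (q r : PrimeSpectrum B) (hqr : q ≤ r) (hzr : z ∈ r.asIdeal) :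
    l.f (B ⧸ r.asIdeal) ≤ l.f (cz z (B ⧸ q.asIdeal)) := by
  apply l.F2
  apply supp_cz z r hzr
  exact supp_quot q r hqr

lemma AddFn.F3 (q r : PrimeSpectrum B) (hqr : q < r) (hq : l.f (B ⧸ q.asIdeal) ≠ ⊤) :
    l.f (B ⧸ r.asIdeal) = 0 := by
  have : ¬ r.asIdeal ≤ q.asIdeal := not_le_of_gt hqr
  obtain ⟨z, hz, hz'⟩ := SetLike.not_le_iff_exists.1 this
  have h1 := l.endo hq (LinearMap.lsmul B (B ⧸ q.asIdeal) z)
  have e : l.f (kz z (B ⧸ q.asIdeal)) = 0 := l.zero _ (by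
    rw [kz, LinearMap.ker_eq_bot.2 (quot_prime_inj z q hz')]; infer_instance)
  have := l.cz_prime z q r hqr.le hz
  rw [← h1, e] at this
  simpa using this

theorem tower_Str {n : ℕ} (l : AddFn B) {H : ℕ → Type u} [∀ i, AddCommGroup (H i)]
    [∀ i, Module B (H i)] (hT : KTower B n H) (hfin : ∀ i, l.f (H (i+1)) ≠ ⊤) (m : ℕ)
    (hm : n ≤ m) (h0 : chi1 l H m = 0) (j : ℕ) : l.f (H (j+1)) = 0 := by
  induction n generalizing l H j with
  | zero => exact l.zero _ (hT.2 j)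
  | succ n ih =>
    have hTT := hT
    obtain ⟨hf, H', _, _, z, α, δ, hT', h1, h2, h3⟩ := hT
    have hf' := hT'.finite
    obtain ⟨hd, e⟩ := chi_step l hf hT'.finite z α δ h1 h2 h3 hfin m
    have s : Subsingleton (H' m) := hT'.vanish m (by omega)
    rw [h0, l.zero (kz z (H' m)) inferInstance] at e
    have hp := chi_nonneg (l.der z) hT' hd m (by omega)
    simp only [ENat.toNat_zero, Nat.cast_zero, mul_zero, sub_zero] at e
    have hv := fun i => step_val l z (α (i+1)) (δ i) (h1 (i+1)) (h2 i) (h3 i)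
    have hkfin : l.f (kz z (H' 0)) ≠ ⊤ :=
      ne_top_of_le_ne_top (hfin 0) ((hv 0) ▸ le_add_self)
    have hk0 : l.f (kz z (H' 0)) = 0 := by
      have : (l.f (kz z (H' 0))).toNat = 0 := by omega
      rw [ENat.toNat_eq_zero] at this
      exact this.resolve_right hkfin
    have hder := ih (l.der z) hT' hd (by omega) (by omega)
    by_contra hne
    obtain ⟨q, hq, hq0⟩ := l.F1 hne
    have hqK : q ∉ Module.support B (kz z (H' 0)) := by
      intro h
      have := l.F2 q h
      rw [hk0] at this
      exact hq0 (le_antisymm this zero_le)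
    have hlow : ∀ i, ∀ q' : PrimeSpectrum B, q' ≤ q → q' ∈ Module.support B (H (i+1)) → q' = q := by
      intro i q' hle hs
      by_contra hne
      exact hq0 (l.F3 q' q (lt_of_le_of_ne hle hne)
        (ne_top_of_le_ne_top (hfin i) (l.F2 q' hs)))
    have hcz : ∀ i, ∀ q' : PrimeSpectrum B, q' ∈ Module.support B (cz z (H' i)) →
        q' ∈ Module.support B (H i) := fun i q' => by
      have e : LinearMap.ker (α i) = LinearMap.range (LinearMap.lsmul B (H' i) z) :=
        LinearMap.exact_iff.1 (h1 i)
      rw [((Submodule.quotEquivOfEq _ _ e.symm).trans (α i).quotKerEquivRange).support_eq]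
      exact fun h => Module.support_subset_of_injective _ (Submodule.injective_subtype _) h
    have hexact : Function.Exact (LinearMap.range (α (j+1))).subtype (δ j).rangeRestrict := by
      intro y
      rw [← LinearMap.mem_ker, LinearMap.ker_rangeRestrict, LinearMap.mem_ker, h2 j y]
      simp
    by_cases hz : z ∈ q.asIdeal
    swap
    · refine supp_exact _ _ hexact q ?_ ?_ hq
      · refine supp_of_smul z q hz ?_
        rintro ⟨_, x, rfl⟩
        apply Subtype.ext
        change z • α (j+1) x = 0
        rw [← map_smul]
        exact (h1 (j+1)).apply_apply_eq_zero x
      · refine supp_of_smul z q hz ?_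
        rintro ⟨_, x, rfl⟩
        exact Subtype.ext ((h3 j).apply_apply_eq_zero x)
    have hS := tower_S hT' q (by
      intro i q' hle hs
      by_contra hne
      by_cases hzq : z ∈ q'.asIdeal
      · exact hne (hlow i q' hle (hcz _ _ (supp_cz z q' hzq hs)))
      · have a1 := (l.der z).F2 q' hs
        rw [hder i] at a1
        have a2 := l.cz_le_of_inj z (quot_prime_inj z q' hzq)
        have a3 := l.cz_prime z q' q hle hz
        exact hq0 (le_antisymm (a3.trans (a2.trans a1)) zero_le)) (by
      intro h
      apply hqK
      obtain ⟨x, hx⟩ := ass_elt q h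
      rw [Module.mem_support_iff']
      exact ⟨⟨x, (hx z).2 hz⟩, fun r hr he => hr ((hx r).1 (congrArg Subtype.val he))⟩)
    refine supp_exact _ _ hexact q ?_ ?_ hq
    · exact fun h => hS j (Module.support_subset_of_surjective _
        (α (j+1)).surjective_rangeRestrict h)
    · cases j with
      | zero => rwa [step_ker (H0 := H' 0) z (δ 0) (h3 0)]
      | succ j =>
        exact fun h => hS j (Module.support_subset_of_injective _
            (Submodule.injective_subtype _) h)

end Str

/-- length at a prime -/
def lenAt (B : Type u) [CommRing B] (q : PrimeSpectrum B) : AddFn B where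
  f H _ _ := Module.length (Localization q.asIdeal.primeCompl)
    (LocalizedModule q.asIdeal.primeCompl H)
  zero H _ _ hH := by
    rw [Module.length_eq_zero_iff]
    infer_instance
  add H1 H2 H3 _ _ _ _ _ _ a b hf ha hab hb := by
    exact Module.length_eq_add_of_exact
      (LocalizedModule.map q.asIdeal.primeCompl a) (LocalizedModule.map q.asIdeal.primeCompl b)
      (LocalizedModule.map_injective _ _ ha) (LocalizedModule.map_surjective _ _ hb)
      (LocalizedModule.map_exact _ _ _ hab)

end

section
set_option linter.unusedSectionVars false

open TensorProduct

section cover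
variable (A : Type u) [CommRing A] (N : Type u) [AddCommGroup N] [Module A N]

lemma exists_cover : ∃ (ι : Type u) (f : (ι →₀ A) →ₗ[A] N), Function.Surjective f ∧
    (Module.Finite A N → Finite ι ∧ Nat.card ι = (⊤ : Submodule A N).spanFinrank) := by
  by_cases h : Module.Finite A N
  · obtain ⟨s, hs, hs'⟩ := Submodule.FG.exists_span_finset_card_eq_spanFinrank (h.1)
    refine ⟨s, Finsupp.linearCombination A (fun x : s => (x : N)), ?_, fun _ => ⟨inferInstance, ?_⟩⟩
    · rw [← LinearMap.range_eq_top, Finsupp.range_linearCombination]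
      simpa using hs'
    · simpa using hs
  · refine ⟨N, Finsupp.linearCombination A id, ?_, fun h' => absurd h' h⟩
    rw [← LinearMap.range_eq_top, Finsupp.range_linearCombination]
    simp

/-- index set of the canonical cover -/
def covI : Type u := (exists_cover A N).choose
/-- canonical free cover -/
abbrev cov : Type u := covI A N →₀ A
/-- canonical covering map -/
def covMap : cov A N →ₗ[A] N := (exists_cover A N).choose_spec.choose
lemma covMap_surj : Function.Surjective (covMap A N) :=
  (exists_cover A N).choose_spec.choose_spec.1
lemma covI_finite [h : Module.Finite A N] : Finite (covI A N) :=
  ((exists_cover A N).choose_spec.choose_spec.2 h).1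
lemma covI_card [h : Module.Finite A N] :
    Nat.card (covI A N) = (⊤ : Submodule A N).spanFinrank :=
  ((exists_cover A N).choose_spec.choose_spec.2 h).2
instance cov_finite [Module.Finite A N] : Module.Finite A (cov A N) := by
  have := covI_finite A N
  infer_instance
/-- first syzygy -/
def syz : Type u := LinearMap.ker (covMap A N)
instance : AddCommGroup (syz A N) := inferInstanceAs (AddCommGroup (LinearMap.ker (covMap A N)))
instance : Module A (syz A N) := inferInstanceAs (Module A (LinearMap.ker (covMap A N)))
/-- inclusion -/
def syzIn : syz A N →ₗ[A] cov A N := (LinearMap.ker (covMap A N)).subtype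
lemma syzIn_inj : Function.Injective (syzIn A N) := Submodule.injective_subtype _
instance syz_finite [IsNoetherianRing A] [Module.Finite A N] : Module.Finite A (syz A N) :=
  inferInstanceAs (Module.Finite A (LinearMap.ker (covMap A N)))

lemma syz_exact : Function.Exact (syzIn A N) (covMap A N) :=
  LinearMap.exact_subtype_ker_map _

/-- iterated syzygy -/
def Om : ℕ → ModuleCat.{u} A → ModuleCat.{u} A
  | 0, N => N
  | i+1, N => Om i (ModuleCat.of A (syz A N))

lemma Om_finite [IsNoetherianRing A] (i : ℕ) (N : ModuleCat.{u} A) [Module.Finite A N] :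
    Module.Finite A (Om A i N) := by
  induction i generalizing N with
  | zero => assumption
  | succ i ih =>
    have : Module.Finite A (ModuleCat.of A (syz A N)) := syz_finite A N
    exact ih _

end cover

section lr
variable (A B : Type u) [CommRing A] [CommRing B] [Algebra A B]
variable (E : Type u) [AddCommGroup E] [Module A E] [Module B E] [IsScalarTower A B E]
variable {E1 E2 E3 : Type u} [AddCommGroup E1] [Module A E1] [Module B E1] [IsScalarTower A B E1]
  [AddCommGroup E2] [Module A E2] [Module B E2] [IsScalarTower A B E2]
  [AddCommGroup E3] [Module A E3] [Module B E3] [IsScalarTower A B E3]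
variable {K F N : Type u} [AddCommGroup K] [Module A K] [AddCommGroup F] [Module A F]
  [AddCommGroup N] [Module A N]

/-- tensoring on the right variable -/
abbrev lT (g : K →ₗ[A] F) : E ⊗[A] K →ₗ[B] E ⊗[A] F := AlgebraTensorModule.lTensor B E g

lemma lT_coe (g : K →ₗ[A] F) : ⇑(lT A B E g) = g.lTensor E := rfl

variable {B} in
/-- tensoring on the left variable -/
abbrev rT (N : Type u) [AddCommGroup N] [Module A N] (a : E1 →ₗ[B] E2) :
    E1 ⊗[A] N →ₗ[B] E2 ⊗[A] N := AlgebraTensorModule.rTensor A N a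

variable {A B}
lemma rT_coe (a : E1 →ₗ[B] E2) : ⇑(rT A N a) = (a.restrictScalars A).rTensor N := rfl

lemma lr_comm (a : E1 →ₗ[B] E2) (g : K →ₗ[A] F) :
    (rT A F a) ∘ₗ (lT A B E1 g) = (lT A B E2 g) ∘ₗ (rT A K a) := by
  ext; simp

lemma lr_comm' (a : E1 →ₗ[B] E2) (g : K →ₗ[A] F) (x) :
    (rT A F a) (lT A B E1 g x) = (lT A B E2 g) (rT A K a x) := by
  rw [← LinearMap.comp_apply, lr_comm]; rfl

lemma rT_exact {a : E1 →ₗ[B] E2} {b : E2 →ₗ[B] E3} (h : Function.Exact a b)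
    (hb : Function.Surjective b) : Function.Exact (rT A N a) (rT A N b) := by
  rw [rT_coe, rT_coe]
  exact rTensor_exact N (f := a.restrictScalars A) (g := b.restrictScalars A) h hb

lemma rT_surj {b : E2 →ₗ[B] E3} (hb : Function.Surjective b) : Function.Surjective (rT A N b) := by
  rw [rT_coe]
  exact LinearMap.rTensor_surjective N (g := b.restrictScalars A) hb

lemma lT_exact {g : K →ₗ[A] F} {h : F →ₗ[A] N} (e : Function.Exact g h)
    (hb : Function.Surjective h) : Function.Exact (lT A B E g) (lT A B E h) := by
  rw [lT_coe, lT_coe]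
  exact lTensor_exact E e hb

lemma lT_surj {h : F →ₗ[A] N} (hb : Function.Surjective h) : Function.Surjective (lT A B E h) := by
  rw [lT_coe]
  exact LinearMap.lTensor_surjective E hb

lemma rT_inj [Module.Flat A N] {a : E1 →ₗ[B] E2} (ha : Function.Injective a) :
    Function.Injective (rT A N a) := by
  rw [rT_coe]
  exact Module.Flat.rTensor_preserves_injective_linearMap (a.restrictScalars A) ha

lemma lT_inj [Module.Flat A E] {g : K →ₗ[A] F} (ha : Function.Injective g) :
    Function.Injective (lT A B E g) := by
  rw [lT_coe]
  exact Module.Flat.lTensor_preserves_injective_linearMap g ha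

end lr

section T1
variable (A B : Type u) [CommRing A] [CommRing B] [Algebra A B]
variable (E : Type u) [AddCommGroup E] [Module A E] [Module B E] [IsScalarTower A B E]
variable {E1 E2 E3 : Type u} [AddCommGroup E1] [Module A E1] [Module B E1] [IsScalarTower A B E1]
  [AddCommGroup E2] [Module A E2] [Module B E2] [IsScalarTower A B E2]
  [AddCommGroup E3] [Module A E3] [Module B E3] [IsScalarTower A B E3]
variable (N : Type u) [AddCommGroup N] [Module A N]

/-- Tor_1 -/
def T1 : Type u := LinearMap.ker (lT A B E (syzIn A N))
instance : AddCommGroup (T1 A B E N) :=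
  inferInstanceAs (AddCommGroup (LinearMap.ker (lT A B E (syzIn A N))))
instance : Module B (T1 A B E N) :=
  inferInstanceAs (Module B (LinearMap.ker (lT A B E (syzIn A N))))
/-- inclusion -/
def T1in : T1 A B E N →ₗ[B] E ⊗[A] (syz A N) := (LinearMap.ker (lT A B E (syzIn A N))).subtype
lemma T1in_inj : Function.Injective (T1in A B E N) := Submodule.injective_subtype _
lemma T1_exact : Function.Exact (T1in A B E N) (lT A B E (syzIn A N)) :=
  LinearMap.exact_subtype_ker_map _
/-- lifting into T1 -/
def T1mk {X : Type u} [AddCommGroup X] [Module B X] (g : X →ₗ[B] E ⊗[A] (syz A N))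
    (h : ∀ x, lT A B E (syzIn A N) (g x) = 0) : X →ₗ[B] T1 A B E N :=
  LinearMap.codRestrict (LinearMap.ker (lT A B E (syzIn A N))) g h
lemma T1mk_in {X : Type u} [AddCommGroup X] [Module B X] (g : X →ₗ[B] E ⊗[A] (syz A N))
    (h : ∀ x, lT A B E (syzIn A N) (g x) = 0) (x : X) : T1in A B E N (T1mk A B E N g h x) = g x :=
  rfl

/-- Tor_{i+1} -/
abbrev tor (i : ℕ) : Type u := T1 A B E (Om A i (ModuleCat.of A N))

variable {B}
/-- functoriality -/
def T1map (a : E1 →ₗ[B] E2) : T1 A B E1 N →ₗ[B] T1 A B E2 N :=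
  T1mk A B E2 N (rT A (syz A N) a ∘ₗ T1in A B E1 N) (fun x => by
    rw [LinearMap.comp_apply, ← lr_comm', (T1_exact A B E1 N).apply_apply_eq_zero, map_zero])

lemma T1map_in (a : E1 →ₗ[B] E2) (x : T1 A B E1 N) :
    T1in A B E2 N (T1map A N a x) = rT A (syz A N) a (T1in A B E1 N x) := rfl

/-- functoriality -/
abbrev torMap (a : E1 →ₗ[B] E2) (i : ℕ) : tor A B E1 N i →ₗ[B] tor A B E2 N i :=
  T1map A (Om A i (ModuleCat.of A N)) a

variable {A}
lemma T1map_comp (a : E1 →ₗ[B] E2) (b : E2 →ₗ[B] E3) :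
    T1map A N (b ∘ₗ a) = (T1map A N b) ∘ₗ (T1map A N a) := by
  ext x
  apply T1in_inj
  have h : rT A (syz A N) (b ∘ₗ a) = rT A (syz A N) b ∘ₗ rT A (syz A N) a := by ext; simp
  rw [LinearMap.comp_apply, T1map_in, T1map_in, T1map_in, h, LinearMap.comp_apply]

lemma T1map_id : T1map A N (LinearMap.id : E1 →ₗ[B] E1) = LinearMap.id := by
  ext x
  apply T1in_inj
  rw [T1map_in]
  simp

/-- iso invariance -/
def T1congr (e : E1 ≃ₗ[B] E2) : T1 A B E1 N ≃ₗ[B] T1 A B E2 N :=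
  LinearEquiv.ofLinearMap (T1map A N e.toLinearMap) (T1map A N e.symm.toLinearMap)
    (by rw [← T1map_comp]; simp [T1map_id]) (by rw [← T1map_comp]; simp [T1map_id])

lemma T1_flat [Module.Flat A E] : Subsingleton (T1 A B E N) := by
  refine subsingleton_of_forall_eq 0 fun x => T1in_inj _ _ _ _ ?_
  apply lT_inj E (B := B) (syzIn_inj A N)
  rw [(T1_exact A B E N).apply_apply_eq_zero, map_zero, map_zero]

variable {a : E1 →ₗ[B] E2} {b : E2 →ₗ[B] E3}

lemma T1_mid (ha : Function.Injective a) (hab : Function.Exact a b) (hb : Function.Surjective b) :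
    Function.Exact (T1map A N a) (T1map A N b) := by
  intro y
  constructor
  · intro hy
    have hy' : rT A (syz A N) b (T1in _ _ _ _ y) = 0 := by rw [← T1map_in, hy, map_zero]
    obtain ⟨x, hx⟩ := (rT_exact hab hb _).1 hy'
    obtain ⟨w, hw⟩ := (T1_exact A B E1 N x).1 (by
      apply rT_inj (N := cov A N) ha
      rw [lr_comm', hx, (T1_exact A B E2 N).apply_apply_eq_zero, map_zero])
    refine ⟨w, T1in_inj _ _ _ _ ?_⟩
    rw [T1map_in, hw, hx]
  · rintro ⟨x, rfl⟩
    apply T1in_inj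
    rw [T1map_in, T1map_in, (rT_exact hab hb).apply_apply_eq_zero, map_zero]

lemma T1_les0 (ha : Function.Injective a) (hab : Function.Exact a b)
    (hb : Function.Surjective b) :
    ∃ δ : T1 A B E3 N →ₗ[B] E1 ⊗[A] N, Function.Exact (T1map A N b) δ ∧
      Function.Exact δ (rT A N a) := by
  refine ⟨SnakeLemma.δ' (lT A B E1 (syzIn A N)) (lT A B E2 (syzIn A N))
      (lT A B E3 (syzIn A N)) (rT A _ a) (rT A _ b) (rT_exact hab hb) (rT A _ a) (rT A _ b)
      (rT_exact hab hb) (lr_comm _ _) (lr_comm _ _) (T1in A B E3 N)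
      (T1_exact _ _ _ _) (lT A B E1 (covMap A N))
      (lT_exact _ (syz_exact A N) (covMap_surj A N)) (rT_surj hb) (rT_inj ha), ?_, ?_⟩
  · apply SnakeLemma.exact_δ'_right (ι₂ := (T1in A B E2 N))
    · exact T1_exact _ _ _ _
    · rfl
    · exact T1in_inj _ _ _ _
  · apply SnakeLemma.exact_δ'_left (π₂ := lT A B E2 (covMap A N))
    · exact lT_exact _ (syz_exact A N) (covMap_surj A N)
    · exact lr_comm _ _
    · exact lT_surj _ (covMap_surj A N)

lemma T1_les1 (ha : Function.Injective a) (hab : Function.Exact a b)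
    (hb : Function.Surjective b) :
    ∃ δ : T1 A B E3 (syz A N) →ₗ[B] T1 A B E1 N, Function.Exact (T1map A (syz A N) b) δ ∧
      Function.Exact δ (T1map A N a) := by
  obtain ⟨δ, h1, h2⟩ := T1_les0 (A := A) (syz A N) ha hab hb
  have hm : ∀ x, lT A B E1 (syzIn A N) (δ x) = 0 := by
    intro x
    apply rT_inj (N := cov A N) ha
    rw [lr_comm', h2.apply_apply_eq_zero, map_zero, map_zero]
  refine ⟨T1mk A B E1 N δ hm, ?_, ?_⟩
  · intro x
    rw [← h1 x, ← (T1in_inj A B E1 N).eq_iff, T1mk_in, map_zero]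
  · intro x
    rw [← (T1in_inj A B E2 N).eq_iff, T1map_in, map_zero]
    refine (h2 _).trans ?_
    constructor
    · rintro ⟨y, hy⟩; exact ⟨y, T1in_inj _ _ _ _ hy⟩
    · rintro ⟨y, hy⟩; exact ⟨y, hy ▸ rfl⟩

lemma tor_mid (ha : Function.Injective a) (hab : Function.Exact a b) (hb : Function.Surjective b)
    (i : ℕ) : Function.Exact (torMap A N a i) (torMap A N b i) :=
  T1_mid _ ha hab hb

lemma Om_succ (i : ℕ) (N : ModuleCat.{u} A) :
    Om A (i+1) N = ModuleCat.of A (syz A (Om A i N)) := by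
  induction i generalizing N with
  | zero => rfl
  | succ i ih => exact ih _

lemma tor_les (ha : Function.Injective a) (hab : Function.Exact a b)
    (hb : Function.Surjective b) (i : ℕ) :
    ∃ δ : tor A B E3 N (i+1) →ₗ[B] tor A B E1 N i, Function.Exact (torMap A N b (i+1)) δ ∧
      Function.Exact δ (torMap A N a i) := by
  have := T1_les1 (A := A) (Om A i (ModuleCat.of A N)) ha hab hb
  have e := Om_succ i (ModuleCat.of A N)
  unfold tor torMap
  rw [e]
  exact this

end T1

section more
variable {A B : Type u} [CommRing A] [CommRing B] [Algebra A B]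

lemma bij_of_exact {X0 X1 X2 X3 : Type u} [AddCommGroup X0] [Module B X0] [AddCommGroup X1]
    [Module B X1] [AddCommGroup X2] [Module B X2] [AddCommGroup X3] [Module B X3]
    {f : X0 →ₗ[B] X1} {g : X1 →ₗ[B] X2} {h : X2 →ₗ[B] X3} (e1 : Function.Exact f g)
    (e2 : Function.Exact g h) (h0 : Subsingleton X0) (h3 : Subsingleton X3) :
    Function.Bijective g := by
  constructor
  · rw [injective_iff_map_eq_zero]
    intro x hx
    obtain ⟨y, rfl⟩ := (e1 x).1 hx
    rw [Subsingleton.elim y 0, map_zero]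
  · intro x
    exact (e2 x).1 (Subsingleton.elim _ _)

lemma sub_of_exact {X1 X2 X3 : Type u} [AddCommGroup X1]
    [Module B X1] [AddCommGroup X2] [Module B X2] [AddCommGroup X3] [Module B X3]
    {f : X1 →ₗ[B] X2} {g : X2 →ₗ[B] X3} (e1 : Function.Exact f g)
    (h0 : Subsingleton X1) (h3 : Subsingleton X3) : Subsingleton X2 := by
  refine subsingleton_of_forall_eq 0 fun x => ?_
  obtain ⟨y, rfl⟩ := (e1 x).1 (Subsingleton.elim _ _)
  rw [Subsingleton.elim y 0, map_zero]

lemma sub_of_inj {X1 X2 : Type u} [AddCommGroup X1]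
    [Module B X1] [AddCommGroup X2] [Module B X2]
    {f : X1 →ₗ[B] X2} (e1 : Function.Injective f)
    (h0 : Subsingleton X2) : Subsingleton X1 := e1.subsingleton

lemma tens_finite (E : Type u) [AddCommGroup E] [Module A E] [Module B E] [IsScalarTower A B E]
    (K : Type u) [AddCommGroup K] [Module A K] [Module.Finite B E] [Module.Finite A K] :
    Module.Finite B (E ⊗[A] K) :=
  Module.Finite.equiv (TensorProduct.AlgebraTensorModule.cancelBaseChange A B B E K)

lemma T1_finite [IsNoetherianRing A] [IsNoetherianRing B]
    (E : Type u) [AddCommGroup E] [Module A E] [Module B E] [IsScalarTower A B E]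
    (K : Type u) [AddCommGroup K] [Module A K] [Module.Finite B E] [Module.Finite A K] :
    Module.Finite B (T1 A B E K) :=
  have : Module.Finite B (E ⊗[A] syz A K) := tens_finite E _
  Module.Finite.of_injective (T1in A B E K) (T1in_inj _ _ _ _)

lemma tor_finite [IsNoetherianRing A] [IsNoetherianRing B]
    (E : Type u) [AddCommGroup E] [Module A E] [Module B E] [IsScalarTower A B E]
    (K : Type u) [AddCommGroup K] [Module A K] [Module.Finite B E] [Module.Finite A K] (i : ℕ) :
    Module.Finite B (tor A B E K i) := by
  have : Module.Finite A (ModuleCat.of A K) := ‹Module.Finite A K›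
  have := Om_finite A i (ModuleCat.of A K)
  exact T1_finite E _

variable {E1 E2 E3 : Type u} [AddCommGroup E1] [Module A E1] [Module B E1] [IsScalarTower A B E1]
  [AddCommGroup E2] [Module A E2] [Module B E2] [IsScalarTower A B E2]
  [AddCommGroup E3] [Module A E3] [Module B E3] [IsScalarTower A B E3]
variable (N : Type u) [AddCommGroup N] [Module A N]
variable {a : E1 →ₗ[B] E2} {b : E2 →ₗ[B] E3}

/-- iso invariance -/
def torCongr (e : E1 ≃ₗ[B] E2) (i : ℕ) : tor A B E1 N i ≃ₗ[B] tor A B E2 N i := T1congr _ e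

lemma tor_shift (ha : Function.Injective a) (hab : Function.Exact a b)
    (hb : Function.Surjective b) (i : ℕ) (h : Subsingleton (tor A B E2 N i))
    (h' : Subsingleton (tor A B E2 N (i+1))) :
    Nonempty (tor A B E3 N (i+1) ≃ₗ[B] tor A B E1 N i) := by
  obtain ⟨δ, h1, h2⟩ := tor_les (A := A) N ha hab hb i
  exact ⟨LinearEquiv.ofBijective δ (bij_of_exact h1 h2 h' h)⟩

lemma T1_shift (ha : Function.Injective a) (hab : Function.Exact a b)
    (hb : Function.Surjective b) (h : Subsingleton (T1 A B E2 N)) :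
    Nonempty (T1 A B E3 N ≃ₗ[B] LinearMap.ker (rT A N a)) := by
  obtain ⟨δ, h1, h2⟩ := T1_les0 (A := A) N ha hab hb
  rw [h2.linearMap_ker_eq]
  refine ⟨LinearEquiv.ofInjective δ ?_⟩
  rw [injective_iff_map_eq_zero]
  intro x hx
  obtain ⟨y, rfl⟩ := (h1 x).1 hx
  rw [Subsingleton.elim y 0, map_zero]

lemma T1_balance (E N : Type u) [AddCommGroup E] [Module A E] [AddCommGroup N] [Module A N] :
    Nonempty (T1 A A E N ≃ₗ[A] T1 A A N E) := by
  obtain ⟨e⟩ := T1_shift (A := A) (B := A) N (syzIn_inj A E) (syz_exact A E) (covMap_surj A E)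
    (T1_flat _ _)
  refine ⟨e.trans (LinearEquiv.ofSubmodules (TensorProduct.comm A (syz A E) N) _
    (LinearMap.ker (lT A A N (syzIn A E))) ?_)⟩
  ext x
  rw [Submodule.mem_map_equiv, LinearMap.mem_ker, LinearMap.mem_ker,
    ← (TensorProduct.comm A (cov A E) N).map_eq_zero_iff]
  have : (TensorProduct.comm A (cov A E) N).toLinearMap ∘ₗ (rT A N (syzIn A E)) ∘ₗ
    (TensorProduct.comm A (syz A E) N).symm.toLinearMap = lT A A N (syzIn A E) := by
    ext; simp
  exact Eq.congr (congrArg (fun f => f x) this) rfl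

lemma tor_balance (E N : Type u) [AddCommGroup E] [Module A E] [AddCommGroup N] [Module A N]
    (i : ℕ) : Nonempty (tor A A E N i ≃ₗ[A] tor A A N E i) := by
  induction i generalizing E N with
  | zero => exact T1_balance E N
  | succ i ih =>
    obtain ⟨e⟩ := tor_shift (A := A) (B := A) N (syzIn_inj A E) (syz_exact A E) (covMap_surj A E) i
      (T1_flat _ _) (T1_flat _ _)
    obtain ⟨e'⟩ := ih (syz A E) N
    exact ⟨e.trans e'⟩

end more

end

section
set_option linter.unusedSectionVars false

open TensorProduct

section RS
variable {B : Type u} [CommRing B]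

variable (B) in
/-- regular sequences with prescribed final quotient -/
def RS : List B → ∀ (G G' : Type u) [AddCommGroup G] [Module B G] [AddCommGroup G'] [Module B G'],
    Prop
  | [], G, G', _, _, _, _ => Nonempty (G ≃ₗ[B] G')
  | z :: L, G, G', _, _, _, _ => ∃ (G1 : Type u) (_ : AddCommGroup G1) (_ : Module B G1)
      (b : G →ₗ[B] G1), Function.Injective (LinearMap.lsmul B G z) ∧
        Function.Exact (LinearMap.lsmul B G z) b ∧ Function.Surjective b ∧ RS L G1 G'

variable {G G' G'' : Type u} [AddCommGroup G] [Module B G] [AddCommGroup G'] [Module B G']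
  [AddCommGroup G''] [Module B G'']

lemma RS.append {L L' : List B} (h : RS B L G G') (h' : RS B L' G' G'') :
    RS B (L ++ L') G G'' := by
  induction L generalizing G with
  | nil =>
    obtain ⟨e⟩ := h
    cases L' with
    | nil => obtain ⟨e'⟩ := h'; exact ⟨e.trans e'⟩
    | cons z L' =>
      obtain ⟨G1, _, _, b, h1, h2, h3, h4⟩ := h'
      refine ⟨G1, _, _, b ∘ₗ e.toLinearMap, ?_, ?_, h3.comp e.surjective, h4⟩
      · intro x y hxy
        apply e.injective
        apply h1
        simp only [LinearMap.lsmul_apply] at hxy ⊢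
        rw [← map_smul, hxy, map_smul]
      · intro x
        rw [LinearMap.comp_apply, h2]
        constructor
        · rintro ⟨y, hy⟩
          refine ⟨e.symm y, e.injective ?_⟩
          simp only [LinearMap.lsmul_apply] at hy ⊢
          rw [map_smul, e.apply_symm_apply, hy]; rfl
        · rintro ⟨y, rfl⟩
          exact ⟨e y, by simp⟩
  | cons z L ih =>
    obtain ⟨G1, _, _, b, h1, h2, h3, h4⟩ := h
    exact ⟨G1, _, _, b, h1, h2, h3, ih h4⟩

lemma RS.of_isWeaklyRegular (L : List B) (h : IsWeaklyRegular G L) :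
    RS B L G (G ⧸ (Ideal.ofList L • ⊤ : Submodule B G)) := by
  induction L generalizing G with
  | nil =>
    refine ⟨(Submodule.quotEquivOfEqBot _ ?_).symm⟩
    simp
  | cons z L ih =>
    rw [isWeaklyRegular_cons_iff] at h
    have h2 := ih h.2
    refine ⟨QuotSMulTop z G, _, _, Submodule.mkQ _, h.1, ?_, Submodule.mkQ_surjective _, ?_⟩
    · intro x
      rw [Submodule.mkQ_apply, Submodule.Quotient.mk_eq_zero, Submodule.mem_smul_pointwise_iff_exists]
      constructor
      · rintro ⟨y, -, rfl⟩; exact ⟨y, rfl⟩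
      · rintro ⟨y, rfl⟩; exact ⟨y, trivial, rfl⟩
    · have := RS.append (L' := []) h2 ⟨(Submodule.quotOfListConsSMulTopEquivQuotSMulTopInner G z L).symm⟩
      simpa using this

lemma KTower.congr {n : ℕ} {H H' : ℕ → Type u} [∀ i, AddCommGroup (H i)] [∀ i, Module B (H i)]
    [∀ i, AddCommGroup (H' i)] [∀ i, Module B (H' i)] (e : ∀ i, H i ≃ₗ[B] H' i)
    (h : KTower B n H) : KTower B n H' := by
  have hf : ∀ i, Module.Finite B (H' i) := fun i => by
    have := h.finite i
    exact Module.Finite.equiv (e i)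
  cases n with
  | zero =>
    refine ⟨hf, fun i => ?_⟩
    have := h.2 i
    exact (e (i+1)).symm.toEquiv.subsingleton
  | succ n =>
    obtain ⟨-, H1, _, _, z, α, δ, hT, h1, h2, h3⟩ := h
    refine ⟨hf, H1, _, _, z, fun i => (e i).toLinearMap ∘ₗ α i,
      fun i => δ i ∘ₗ (e (i+1)).symm.toLinearMap, hT, ?_, ?_, ?_⟩
    · intro i x
      rw [← h1 i x]; simp
    · intro i x
      refine (h2 i ((e (i+1)).symm x)).trans ?_
      constructor
      · rintro ⟨y, hy⟩; exact ⟨y, by simp [hy]⟩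
      · rintro ⟨y, hy⟩; exact ⟨y, by simp [← hy]⟩
    · intro i x
      refine (h3 i x).trans ?_
      constructor
      · rintro ⟨y, hy⟩; exact ⟨e _ y, by simp [hy]⟩
      · rintro ⟨y, hy⟩; exact ⟨_, hy⟩

variable {A : Type u} [CommRing A] [Algebra A B]

lemma T1map_lsmul (E N : Type u) [AddCommGroup E] [Module A E] [Module B E] [IsScalarTower A B E]
    [AddCommGroup N] [Module A N] (z : B) :
    T1map A N (LinearMap.lsmul B E z) = LinearMap.lsmul B (T1 A B E N) z := by
  ext x
  apply T1in_inj
  rw [T1map_in, LinearMap.lsmul_apply, map_smul]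
  generalize T1in A B E N x = y
  induction y with
  | zero => simp
  | add a b ha hb => rw [map_add, ha, hb, smul_add]
  | tmul a b => simp [TensorProduct.smul_tmul']

lemma rT_lsmul (E N : Type u) [AddCommGroup E] [Module A E] [Module B E] [IsScalarTower A B E]
    [AddCommGroup N] [Module A N] (z : B) :
    rT A N (LinearMap.lsmul B E z) = LinearMap.lsmul B (E ⊗[A] N) z := by
  ext x
  simp [TensorProduct.smul_tmul']

/-- `A`-module structure on a B-module -/
lemma nak_sub [IsNoetherianRing B] (X : Type u) [AddCommGroup X] [Module B X] [Module.Finite B X]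
    (z : B) (hz : z ∈ Ideal.jacobson (⊥ : Ideal B))
    (h : Function.Surjective (LinearMap.lsmul B X z)) : Subsingleton X := by
  have h2 : (⊤ : Submodule B X) ≤ Ideal.span {z} • ⊤ := by
    intro x _
    obtain ⟨y, rfl⟩ := h x
    exact Submodule.smul_mem_smul (Ideal.mem_span_singleton_self z) trivial
  have := Submodule.eq_bot_of_le_smul_of_le_jacobson_bot (Ideal.span {z}) ⊤ Module.Finite.fg_top h2
    ((Ideal.span_singleton_le_iff_mem _).2 hz)
  exact Submodule.subsingleton_iff B |>.1 (subsingleton_of_bot_eq_top this.symm)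

/-- tensoring a regular sequence -/
lemma RS_tensor [IsNoetherianRing A] [IsNoetherianRing B] (L : List B)
    (hL : ∀ z ∈ L, z ∈ Ideal.jacobson (⊥ : Ideal B))
    (M : Type u) [AddCommGroup M] [Module A M] [Module.Finite A M]
    (G G' : Type u) [AddCommGroup G] [Module A G] [Module B G] [IsScalarTower A B G]
    [AddCommGroup G'] [Module A G'] [Module B G'] [IsScalarTower A B G'] [Module.Finite B G]
    (h : RS B L G G') (h0 : ∀ i, Subsingleton (tor A B G' M i)) :
    (∀ i, Subsingleton (tor A B G M i)) ∧ RS B L (G ⊗[A] M) (G' ⊗[A] M) := by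
  induction L generalizing G with
  | nil =>
    obtain ⟨e⟩ := h
    refine ⟨fun i => (torCongr (A := A) M e i).toEquiv.subsingleton, ⟨?_⟩⟩
    exact TensorProduct.AlgebraTensorModule.congr e (LinearEquiv.refl A M)
  | cons z L ih =>
    obtain ⟨G1, _, _, b, h1, h2, h3, h4⟩ := h
    letI : Module A G1 := Module.compHom G1 (algebraMap A B)
    haveI : IsScalarTower A B G1 := ⟨fun x y w => by
      rw [Algebra.smul_def, mul_smul]; rfl⟩
    have : Module.Finite B G1 := Module.Finite.of_surjective b h3
    obtain ⟨k1, k2⟩ := ih (fun z hz => hL z (by simp [hz])) G1 h4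
    have k3 : ∀ i, Subsingleton (tor A B G M i) := fun i => by
      have := tor_finite (A := A) (B := B) G M i
      apply nak_sub _ z (hL z (by simp))
      have e := tor_mid (A := A) M h1 h2 h3 i
      unfold torMap at e
      rw [T1map_lsmul] at e
      intro x
      have := k1 i
      exact (e x).1 (Subsingleton.elim _ _)
    refine ⟨k3, G1 ⊗[A] M, _, _, rT A M b, ?_, ?_, rT_surj h3, k2⟩
    · obtain ⟨δ, d1, d2⟩ := T1_les0 (A := A) M h1 h2 h3
      rw [rT_lsmul] at d2
      rw [injective_iff_map_eq_zero]
      intro x hx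
      obtain ⟨y, rfl⟩ := (d2 x).1 hx
      have : Subsingleton (T1 A B G1 M) := k1 0
      rw [Subsingleton.elim y 0, map_zero]
    · rw [← rT_lsmul]
      exact rT_exact h2 h3

/-- towers from regular sequences -/
lemma RS_tower [IsNoetherianRing A] [IsNoetherianRing B] (L : List B) (n : ℕ)
    (N : Type u) [AddCommGroup N] [Module A N] [Module.Finite A N]
    (G G' : Type u) [AddCommGroup G] [Module A G] [Module B G] [IsScalarTower A B G]
    [AddCommGroup G'] [Module A G'] [Module B G'] [IsScalarTower A B G'] [Module.Finite B G]
    (h : RS B L G G') (h0 : KTower B n (fun i => tor A B G N i)) :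
    ∃ m, KTower B m (fun i => tor A B G' N i) := by
  induction L generalizing G n with
  | nil =>
    obtain ⟨e⟩ := h
    exact ⟨n, h0.congr (fun i => torCongr N e i)⟩
  | cons z L ih =>
    obtain ⟨G1, _, _, b, h1, h2, h3, h4⟩ := h
    letI : Module A G1 := Module.compHom G1 (algebraMap A B)
    haveI : IsScalarTower A B G1 := ⟨fun x y w => by
      rw [Algebra.smul_def, mul_smul]; rfl⟩
    have : Module.Finite B G1 := Module.Finite.of_surjective b h3
    refine ih (n+1) G1 h4 ?_
    choose δ d1 d2 using fun i => tor_les (A := A) N h1 h2 h3 i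
    refine ⟨fun i => tor_finite (A := A) (B := B) G1 N i, (fun i => tor A B G N i), _, _, z,
      fun i => torMap A N b i, δ, h0, ?_, d1, ?_⟩
    · intro i
      have := tor_mid (A := A) N h1 h2 h3 i
      unfold torMap at this
      rwa [T1map_lsmul] at this
    · intro i
      have := d2 i
      unfold torMap at this
      rwa [T1map_lsmul] at this

/-- comparison of T1 over A and over B -/
lemma T1_res (E N : Type u) [AddCommGroup E] [Module A E] [Module B E] [IsScalarTower A B E]
    [AddCommGroup N] [Module A N] :
    ∃ e : T1 A B E N ≃+ T1 A A E N, ∀ (a : A) x, e (algebraMap A B a • x) = a • e x := by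
  refine ⟨AddEquiv.refl _, fun a x => ?_⟩
  apply T1in_inj
  rw [map_smul]
  change T1in A B E N (algebraMap A B a • x) = a • T1in A B E N x
  rw [map_smul, algebraMap_smul]

lemma tor_killed (E N : Type u) [AddCommGroup E] [Module A E] [Module B E] [IsScalarTower A B E]
    [AddCommGroup N] [Module A N] (a : A) (ha : ∀ x : N, a • x = 0) (i : ℕ)
    (t : tor A B E N i) : algebraMap A B a • t = 0 := by
  obtain ⟨e, he⟩ := T1_res (A := A) (B := B) E (Om A i (ModuleCat.of A N))
  apply e.injective
  rw [he, map_zero]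
  obtain ⟨e'⟩ := tor_balance (A := A) E N i
  apply e'.injective
  rw [map_zero]
  have := map_smul e' a (e t)
  refine this.trans ?_
  generalize e' (e t) = w
  refine T1in_inj A A N (Om A i (ModuleCat.of A E)) ?_
  rw [map_smul, map_zero]
  generalize T1in A A N (Om A i (ModuleCat.of A E)) w = y
  induction y with
  | zero => simp
  | add a b ha hb => rw [smul_add, ha, hb, add_zero]
  | tmul x b => rw [TensorProduct.smul_tmul', ha, TensorProduct.zero_tmul]

end RS

end

section
set_option linter.unusedSectionVars false
set_option linter.style.haveILetI false

open TensorProduct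

section nakind
variable {A : Type u} [CommRing A] [IsNoetherianRing A] [IsLocalRing A]

/-- induction principle for f.g. modules over a local noetherian ring -/
lemma nak_induction
    (P : ∀ (N : Type u) [AddCommGroup N] [Module A N], Prop)
    (h0 : ∀ (N : Type u) [AddCommGroup N] [Module A N], Subsingleton N → P N)
    (hext : ∀ (N1 N2 N3 : Type u) [AddCommGroup N1] [Module A N1] [AddCommGroup N2] [Module A N2]
      [AddCommGroup N3] [Module A N3] (a : N1 →ₗ[A] N2) (b : N2 →ₗ[A] N3), Function.Injective a →
      Function.Exact a b → Function.Surjective b → P N1 → P N3 → P N2)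
    (hk : P (IsLocalRing.ResidueField A))
    (hn : ∀ (N : Type u) [AddCommGroup N] [Module A N] [Module.Finite A N] (z : A),
      z ∈ IsLocalRing.maximalIdeal A → Function.Injective (LinearMap.lsmul A N z) →
      P (N ⧸ LinearMap.range (LinearMap.lsmul A N z)) → P N)
    (N : Type u) [AddCommGroup N] [Module A N] [Module.Finite A N] : P N := by
  have hiso : ∀ (N1 N2 : Type u) [AddCommGroup N1] [Module A N1] [AddCommGroup N2] [Module A N2]
      (e : N1 ≃ₗ[A] N2), P N1 → P N2 := by
    intro N1 N2 _ _ _ _ e h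
    refine hext N1 N2 PUnit.{u+1} e.toLinearMap 0 e.injective ?_ (fun x => ⟨0, rfl⟩) h
      (h0 _ inferInstance)
    intro x
    exact ⟨fun _ => ⟨e.symm x, by simp⟩, fun _ => rfl⟩
  suffices H : ∀ K : Submodule A N, P (N ⧸ K) from
    hiso _ _ (Submodule.quotEquivOfEqBot ⊥ rfl) (H ⊥)
  intro K
  induction K using (wellFounded_gt (α := Submodule A N)).induction with
  | _ K ih =>
  set X := N ⧸ K with hX
  have hq : ∀ U : Submodule A X, U ≠ ⊥ → P (X ⧸ U) := by
    intro U hU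
    have hlt : K < U.comap K.mkQ := by
      refine lt_of_le_of_ne (fun x hx => ?_) fun h => hU ?_
      · have : K.mkQ x = 0 := (Submodule.Quotient.mk_eq_zero K).2 hx
        rw [Submodule.mem_comap, this]
        exact U.zero_mem
      · rw [eq_bot_iff]
        rintro x hx
        obtain ⟨y, rfl⟩ := K.mkQ_surjective x
        have : y ∈ U.comap K.mkQ := hx
        rw [← h] at this
        exact (Submodule.Quotient.mk_eq_zero K).2 this
    have := ih _ hlt
    refine hiso _ _ ?_ this
    have e := Submodule.quotientQuotientEquivQuotient K _ hlt.le
    refine e.symm.trans (Submodule.quotEquivOfEq _ _ ?_)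
    exact Submodule.map_comap_eq_of_surjective K.mkQ_surjective U
  by_cases hz : ∃ z ∈ IsLocalRing.maximalIdeal A, LinearMap.range (LinearMap.lsmul A X z) ≠ ⊥
  · obtain ⟨z, hz, hz2⟩ := hz
    by_cases hker : LinearMap.ker (LinearMap.lsmul A X z) = ⊥
    · exact hn X z hz (LinearMap.ker_eq_bot.1 hker) (hq _ hz2)
    · have h1 := hiso _ _ (LinearMap.quotKerEquivRange _) (hq _ hker)
      exact hext _ _ _ (Submodule.subtype _) (Submodule.mkQ _) (Submodule.injective_subtype _)
        (LinearMap.exact_subtype_mkQ _) (Submodule.mkQ_surjective _) h1 (hq _ hz2)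
  · push Not at hz
    by_cases hs : Subsingleton X
    · exact h0 _ hs
    rw [not_subsingleton_iff_nontrivial] at hs
    obtain ⟨x, hx⟩ := exists_ne (0 : X)
    have hxs : Submodule.span A {x} ≠ ⊥ := by
      rwa [Ne, Submodule.span_singleton_eq_bot]
    refine hext (Submodule.span A {x}) X _ (Submodule.subtype _) (Submodule.mkQ _)
      (Submodule.injective_subtype _)
        (LinearMap.exact_subtype_mkQ _) (Submodule.mkQ_surjective _) ?_ (hq _ hxs)
    have hm : IsLocalRing.maximalIdeal A = LinearMap.ker (LinearMap.toSpanSingleton A X x) := by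
      apply le_antisymm
      · intro z hz'
        have := hz z hz'
        rw [LinearMap.mem_ker, LinearMap.toSpanSingleton_apply]
        have h2 : LinearMap.lsmul A X z x ∈ LinearMap.range (LinearMap.lsmul A X z) := ⟨x, rfl⟩
        rw [this] at h2
        exact h2
      · apply IsLocalRing.le_maximalIdeal
        intro h
        apply hx
        have : (1 : A) ∈ LinearMap.ker (LinearMap.toSpanSingleton A X x) := by
          rw [h]; trivial
        simpa using this
    refine hiso (A ⧸ IsLocalRing.maximalIdeal A) _ ?_ hk
    exact (Submodule.quotEquivOfEq _ _ hm).trans ((LinearMap.quotKerEquivRange _).trans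
      (LinearEquiv.ofEq _ _ (LinearMap.range_toSpanSingleton x)))

end nakind

section base
variable {A B : Type u} [CommRing A] [CommRing B] [Algebra A B]

lemma RS_up (L : List A) (N G G' : Type u) [AddCommGroup N] [Module A N]
    [AddCommGroup G] [Module A G] [AddCommGroup G'] [Module A G']
    (h : RS A L G G') (n : ℕ) (h0 : ∀ j ≥ n, Subsingleton (tor A A G N j)) :
    ∀ j ≥ n + L.length, Subsingleton (tor A A G' N j) := by
  induction L generalizing G n with
  | nil =>
    obtain ⟨e⟩ := h
    intro j hj
    have := h0 j hj
    exact (torCongr (A := A) N e j).symm.toEquiv.subsingleton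
  | cons z L ih =>
    obtain ⟨G1, _, _, b, h1, h2, h3, h4⟩ := h
    intro j hj
    refine ih G1 h4 (n+1) ?_ j (by simp at hj; omega)
    intro j hj
    obtain ⟨j, rfl⟩ : ∃ i, j = i + 1 := ⟨j-1, by omega⟩
    obtain ⟨δ, d1, d2⟩ := tor_les (A := A) N h1 h2 h3 j
    have := h0 j (by omega)
    have := h0 (j+1) (by omega)
    exact sub_of_exact d1 ‹_› ‹_›

lemma RS_down (k : Type u) [AddCommGroup k] [Module A k] (L : List B)
    (hL : ∀ z ∈ L, ∃ a : A, algebraMap A B a = z ∧ ∀ x : k, a • x = 0)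
    (G G' : Type u) [AddCommGroup G] [Module A G] [Module B G] [IsScalarTower A B G]
    [AddCommGroup G'] [Module A G'] [Module B G'] [IsScalarTower A B G']
    (h : RS B L G G') (n : ℕ) (h0 : ∀ j ≥ n + L.length, Subsingleton (tor A B G' k j)) :
    ∀ j ≥ n, Subsingleton (tor A B G k j) := by
  induction L generalizing G n with
  | nil =>
    obtain ⟨e⟩ := h
    intro j hj
    have := h0 j (by simpa using hj)
    exact (torCongr (A := A) k e j).toEquiv.subsingleton
  | cons z L ih =>
    obtain ⟨G1, _, _, b, h1, h2, h3, h4⟩ := h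
    letI : Module A G1 := Module.compHom G1 (algebraMap A B)
    haveI : IsScalarTower A B G1 := ⟨fun x y w => by
      rw [Algebra.smul_def, mul_smul]; rfl⟩
    intro j hj
    have hs := ih (fun z hz => hL z (by simp [hz])) G1 h4 (n := n + 1)
    have hs1 : Subsingleton (tor A B G1 k (j+1)) :=
      hs (fun j hj => h0 j (by simp only [List.length_cons]; omega)) (j+1) (by omega)
    obtain ⟨δ, d1, d2⟩ := tor_les (A := A) k h1 h2 h3 j
    refine subsingleton_of_forall_eq 0 fun x => ?_
    obtain ⟨a, ha, hk⟩ := hL z (by simp)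
    unfold torMap at d2
    rw [T1map_lsmul] at d2
    obtain ⟨y, rfl⟩ := (d2 x).1 (by
      rw [LinearMap.lsmul_apply, ← ha]
      exact tor_killed G k a hk j x)
    rw [Subsingleton.elim y 0, map_zero]

/-- base vanishing -/
lemma base_vanish [IsNoetherianRing A] [IsLocalRing A] [IsNoetherianRing B]
    (hJ : ∀ a ∈ IsLocalRing.maximalIdeal A, algebraMap A B a ∈ Ideal.jacobson (⊥ : Ideal B))
    (LA : List A) (hLA : RS A LA A (IsLocalRing.ResidueField A))
    (L : List A) (hL : ∀ a ∈ L, a ∈ IsLocalRing.maximalIdeal A) (hlen : LA.length ≤ L.length + 1)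
    (E E'' : Type u) [AddCommGroup E] [Module A E] [Module B E] [IsScalarTower A B E]
    [AddCommGroup E''] [Module A E''] [Module B E''] [IsScalarTower A B E''] [Module.Finite B E]
    (hE : RS B (L.map (algebraMap A B)) E E'')
    (N : Type u) [AddCommGroup N] [Module A N] [Module.Finite A N] (j : ℕ) (hj : 1 ≤ j) :
    Subsingleton (tor A B E N j) := by
  have hsub : ∀ (E N : Type u) [AddCommGroup E] [Module A E] [Module B E] [IsScalarTower A B E]
      [AddCommGroup N] [Module A N] (j : ℕ), Subsingleton (tor A A N E j) ↔ Subsingleton (tor A B E N j) := by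
    intro E N _ _ _ _ _ _ j
    obtain ⟨e, he⟩ := T1_res (A := A) (B := B) E (Om A j (ModuleCat.of A N))
    obtain ⟨e'⟩ := tor_balance (A := A) E N j
    exact ⟨fun _ => (e.toEquiv.trans e'.toEquiv).subsingleton,
      fun _ => (e.toEquiv.trans e'.toEquiv).symm.subsingleton⟩
  suffices H : ∀ j ≥ 1, Subsingleton (tor A A N E j) from (hsub E N j).1 (H j hj)
  refine nak_induction (A := A) (fun N _ _ => ∀ j ≥ 1, Subsingleton (tor A A N E j)) ?_ ?_ ?_ ?_ N
  · intro N _ _ _ j _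
    have : Subsingleton (N ⊗[A] syz A (Om A j (ModuleCat.of A E))) := inferInstance
    exact sub_of_inj (T1in_inj A A N (Om A j (ModuleCat.of A E))) this
  · intro N1 N2 N3 _ _ _ _ _ _ a b ha hab hb h1 h3 j hj
    have := h1 j hj
    have := h3 j hj
    exact sub_of_exact (tor_mid (A := A) E ha hab hb j) ‹_› ‹_›
  · intro j hj
    rw [hsub]
    refine RS_down (IsLocalRing.ResidueField A) (L.map (algebraMap A B)) ?_ E E'' hE 1 ?_ j hj
    · intro z hz
      obtain ⟨a, ha, rfl⟩ := List.mem_map.1 hz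
      refine ⟨a, rfl, fun x => ?_⟩
      rw [Algebra.smul_def]
      have : algebraMap A (IsLocalRing.ResidueField A) a = 0 := by
        rw [IsLocalRing.ResidueField.algebraMap_eq]
        exact (IsLocalRing.residue_eq_zero_iff a).2 (hL a ha)
      rw [this, zero_mul]
    · intro j hj
      rw [← hsub]
      refine RS_up LA E'' A _ hLA 0 (fun j _ => T1_flat _ _ ) j ?_
      simp at hj; omega
  · intro N _ _ _ z hz hinj h j hj
    rw [hsub]
    have := tor_finite (A := A) (B := B) E N j
    refine nak_sub _ _ (hJ z hz) ?_
    have := h j hj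
    have e := tor_mid (A := A) E hinj (LinearMap.exact_map_mkQ_range _) (Submodule.mkQ_surjective _) j
    unfold torMap at e
    rw [T1map_lsmul] at e
    obtain ⟨e1, he⟩ := T1_res (A := A) (B := B) E (Om A j (ModuleCat.of A N))
    obtain ⟨e'⟩ := tor_balance (A := A) E N j
    intro x
    obtain ⟨y, hy⟩ := (e (e' (e1 x))).1 (Subsingleton.elim _ _)
    refine ⟨e1.symm (e'.symm y), e1.injective (e'.injective ?_)⟩
    rw [← hy, LinearMap.lsmul_apply, he, AddEquiv.apply_symm_apply]
    refine (map_smul e' z (e'.symm y)).trans ?_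
    rw [e'.apply_symm_apply]; rfl

end base
end

section
set_option linter.unusedSectionVars false
set_option linter.style.haveILetI false

open TensorProduct

section MvPS
variable {σ : Type} {V : Type u} [CommRing V]

lemma mvps_decomp (s : σ) (f : MvPowerSeries σ V) : ∃ g h : MvPowerSeries σ V,
    f = MvPowerSeries.X s * g + h ∧ ∀ α, (α s ≠ 0 → MvPowerSeries.coeff α h = 0) ∧
      (α s = 0 → MvPowerSeries.coeff α h = MvPowerSeries.coeff α f) := by
  classical
  let h : MvPowerSeries σ V := fun α => if α s = 0 then MvPowerSeries.coeff α f else 0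
  have hh : ∀ α, MvPowerSeries.coeff α h = if α s = 0 then MvPowerSeries.coeff α f else 0 :=
    fun α => rfl
  obtain ⟨g, hg⟩ : MvPowerSeries.X s ∣ f - h := by
    rw [MvPowerSeries.X_dvd_iff]
    intro m hm
    rw [map_sub, hh, if_pos hm, sub_self]
  refine ⟨g, h, by rw [← hg]; ring, fun α => ⟨fun h1 => ?_, fun h1 => ?_⟩⟩
  · rw [hh, if_neg h1]
  · rw [hh, if_pos h1]

lemma mvps_mem_span (l : List σ) (f : MvPowerSeries σ V) :
    f ∈ Ideal.ofList (l.map (MvPowerSeries.X (R := V))) ↔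
      ∀ α : σ →₀ ℕ, (∀ s ∈ l, α s = 0) → MvPowerSeries.coeff α f = 0 := by
  classical
  induction l generalizing f with
  | nil =>
    simp only [List.map_nil, Ideal.ofList_nil, Ideal.mem_bot, List.not_mem_nil, false_imp_iff,
      implies_true, true_imp_iff]
    exact MvPowerSeries.ext_iff
  | cons s l ih =>
    rw [List.map_cons, Ideal.ofList_cons, Submodule.mem_sup]
    constructor
    · rintro ⟨a, ha, b, hb, rfl⟩ α hα
      obtain ⟨g, rfl⟩ := Ideal.mem_span_singleton.1 ha
      rw [map_add, (ih b).1 hb α (fun t ht => hα t (by simp [ht])), add_zero]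
      exact MvPowerSeries.X_dvd_iff.1 ⟨g, rfl⟩ α (hα s (by simp))
    · intro hf
      obtain ⟨g, h, rfl, hh⟩ := mvps_decomp s f
      refine ⟨_, Ideal.mem_span_singleton.2 ⟨g, rfl⟩, h, (ih h).2 fun α hα => ?_, rfl⟩
      by_cases h0 : α s = 0
      · rw [(hh α).2 h0]
        exact hf α (by simpa [h0] using hα)
      · exact (hh α).1 h0

lemma mvps_regular (l : List σ) (hl : l.Nodup) :
    IsWeaklyRegular (MvPowerSeries σ V) (l.map (MvPowerSeries.X (R := V))) := by
  classical
  rw [isWeaklyRegular_iff_Fin]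
  intro i
  have hi : (i : ℕ) < l.length := by simpa using i.2
  rw [isSMulRegular_iff_right_eq_zero_of_smul]
  intro x hx
  obtain ⟨f, rfl⟩ := Submodule.mkQ_surjective _ x
  rw [← map_smul] at hx
  simp only [Submodule.mkQ_apply, Submodule.Quotient.mk_eq_zero, Ideal.smul_eq_mul, Ideal.mul_top,
    ← List.map_take, mvps_mem_span] at hx ⊢
  intro α hα
  have hnot : l[(i:ℕ)] ∉ l.take i := by
    intro hmem
    obtain ⟨j, hj, e⟩ := List.mem_iff_getElem.1 hmem
    rw [List.getElem_take] at e
    have := (List.Nodup.getElem_inj_iff hl).1 e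
    simp at hj; omega
  have := hx (α + Finsupp.single l[(i:ℕ)] 1) (fun s hs => by
    have hne : l[(i:ℕ)] ≠ s := by rintro rfl; exact hnot hs
    simp [hα s hs, hne])
  have e : (List.map (MvPowerSeries.X (R := V)) l)[i] = MvPowerSeries.X l[(i:ℕ)] := by simp
  rw [e, smul_eq_mul, add_comm, MvPowerSeries.X, MvPowerSeries.coeff_add_monomial_mul, one_mul] at this
  exact this

lemma mvps_hom_ext {τ : Type} [Finite σ] (F G : MvPowerSeries σ V →ₐ[V] MvPowerSeries τ V)
    (h : ∀ s, F (MvPowerSeries.X s) = G (MvPowerSeries.X s))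
    (h0 : ∀ s, MvPowerSeries.constantCoeff (F (MvPowerSeries.X s)) = 0) : F = G := by
  classical
  have hdec : ∀ (l : List σ) (f : MvPowerSeries σ V),
      f ∈ Ideal.ofList (l.map (MvPowerSeries.X (R := V))) → ∀ n : ℕ,
      (∀ g, (n : ℕ∞) ≤ (F g - G g).order) → ((n + 1 : ℕ) : ℕ∞) ≤ (F f - G f).order := by
    intro l f hf n hn
    induction l generalizing f with
    | nil => simp at hf; simp [hf]
    | cons s l ih =>
      rw [List.map_cons, Ideal.ofList_cons, Submodule.mem_sup] at hf
      obtain ⟨a, ha, b, hb, rfl⟩ := hf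
      obtain ⟨g, rfl⟩ := Ideal.mem_span_singleton.1 ha
      have e : F (MvPowerSeries.X s * g + b) - G (MvPowerSeries.X s * g + b) =
        F (MvPowerSeries.X s) * (F g - G g) + (F b - G b) := by
        simp only [map_add, map_mul, h]; ring
      rw [e]
      refine le_trans (le_min ?_ (ih b hb)) MvPowerSeries.min_order_le_add
      refine le_trans ?_ MvPowerSeries.le_order_mul
      have h1 : (1 : ℕ∞) ≤ (F (MvPowerSeries.X s)).order :=
        MvPowerSeries.one_le_order_iff_constCoeff_eq_zero.2 (h0 s)
      calc ((n+1:ℕ):ℕ∞) = 1 + n := by push_cast; ring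
        _ ≤ _ := add_le_add h1 (hn g)
  have key : ∀ n : ℕ, ∀ f, (n : ℕ∞) ≤ (F f - G f).order := by
    intro n
    induction n with
    | zero => intro f; simp
    | succ n ih =>
      intro f
      cases nonempty_fintype σ
      have e : F f - G f = F (f - MvPowerSeries.C (MvPowerSeries.constantCoeff f)) -
          G (f - MvPowerSeries.C (MvPowerSeries.constantCoeff f)) := by
        rw [map_sub, map_sub]
        have := (F.commutes (MvPowerSeries.constantCoeff f)).trans
          (G.commutes (MvPowerSeries.constantCoeff f)).symm
        change F (MvPowerSeries.C _) = G (MvPowerSeries.C _) at this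
        rw [this]; ring
      rw [e]
      refine hdec (Finset.univ : Finset σ).toList _ ?_ n ih
      rw [mvps_mem_span]
      intro α hα
      have : α = 0 := by ext s; exact hα s (by simp)
      subst this
      simp
  refine AlgHom.ext fun f => ?_
  rw [← sub_eq_zero, ← MvPowerSeries.order_eq_top_iff, ENat.eq_top_iff_forall_ge]
  exact fun n => key n f

end MvPS

section ring
variable {B : Type u} [CommRing B]

lemma RS_ring (L : List B) (hL : IsWeaklyRegular B L) (C : Type u) [CommRing C] [Module B C]
    (φ : B →+* C) (hφ : Function.Surjective φ) (hmod : ∀ b c, b • c = φ b * c)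
    (hker : RingHom.ker φ = Ideal.ofList L) : RS B L B C := by
  have h1 := RS.of_isWeaklyRegular L hL
  let f : B →ₗ[B] C := { toFun := φ, map_add' := map_add φ, map_smul' := fun b c => by simp [hmod] }
  have hk : (Ideal.ofList L • ⊤ : Submodule B B) = LinearMap.ker f := by
    rw [Ideal.smul_eq_mul, Ideal.mul_top, ← hker]; rfl
  have h2 : RS B [] (B ⧸ (Ideal.ofList L • ⊤ : Submodule B B)) C :=
    ⟨(Submodule.quotEquivOfEq _ _ hk).trans (LinearMap.quotKerEquivOfSurjective f hφ)⟩
  simpa using h1.append h2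

end ring

section kosz
variable (V : Type u) [CommRing V] [IsNoetherianRing V] [IsLocalRing V] (r : ℕ)


/-- the projection T ↦ 0, Y ↦ X -/
def kφ : (MvPowerSeries (Fin r ⊕ Fin r) V) →ₐ[V] (MvPowerSeries (Fin r) V) := MvPowerSeries.killCompl ⟨Sum.inr, Sum.inr_injective⟩

/-- the inclusion Y -/
def ky : (MvPowerSeries (Fin r) V) →ₐ[V] (MvPowerSeries (Fin r ⊕ Fin r) V) :=
  MvPowerSeries.substAlgHom (a := fun i => MvPowerSeries.X (Sum.inr i))
    (MvPowerSeries.hasSubst_of_constantCoeff_zero (by simp))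

/-- X ↦ T + Y -/
def kx : (MvPowerSeries (Fin r) V) →ₐ[V] (MvPowerSeries (Fin r ⊕ Fin r) V) :=
  MvPowerSeries.substAlgHom (a := fun i => MvPowerSeries.X (Sum.inl i) + MvPowerSeries.X (Sum.inr i))
    (MvPowerSeries.hasSubst_of_constantCoeff_zero (by simp))

lemma kφ_inl (i) : kφ V r (MvPowerSeries.X (Sum.inl i)) = 0 :=
  MvPowerSeries.killCompl_X_eq_zero (by simp)
lemma kφ_inr (i) : kφ V r (MvPowerSeries.X (Sum.inr i)) = MvPowerSeries.X i :=
  MvPowerSeries.killCompl_X i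

lemma ky_X (i) : ky V r (MvPowerSeries.X i) = MvPowerSeries.X (Sum.inr i) :=
  MvPowerSeries.substAlgHom_X _ i
lemma kx_X (i) : kx V r (MvPowerSeries.X i) =
    MvPowerSeries.X (Sum.inl i) + MvPowerSeries.X (Sum.inr i) :=
  MvPowerSeries.substAlgHom_X _ i

lemma kφ_ky (f : (MvPowerSeries (Fin r) V)) : kφ V r (ky V r f) = f := by
  have := mvps_hom_ext ((kφ V r).comp (ky V r)) (AlgHom.id V _) (fun s => by
    simp [ky_X, kφ_inr]) (fun s => by simp [ky_X, kφ_inr])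
  exact AlgHom.congr_fun this f

lemma kφ_kx (f : (MvPowerSeries (Fin r) V)) : kφ V r (kx V r f) = f := by
  have := mvps_hom_ext ((kφ V r).comp (kx V r)) (AlgHom.id V _) (fun s => by
    simp [kx_X, kφ_inr, kφ_inl]) (fun s => by simp [kx_X, kφ_inr, kφ_inl])
  exact AlgHom.congr_fun this f

/-- T ↦ T ± Y -/
def kt (ε : V) : (MvPowerSeries (Fin r ⊕ Fin r) V) →ₐ[V] (MvPowerSeries (Fin r ⊕ Fin r) V) :=
  MvPowerSeries.substAlgHom (a := Sum.elim (fun i => MvPowerSeries.X (Sum.inl i) +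
      ε • MvPowerSeries.X (Sum.inr i)) (fun i => MvPowerSeries.X (Sum.inr i)))
    (MvPowerSeries.hasSubst_of_constantCoeff_zero (by rintro (i | i) <;> simp))

lemma kt_inl (ε : V) (i) : kt V r ε (MvPowerSeries.X (Sum.inl i)) = MvPowerSeries.X (Sum.inl i) +
      ε • MvPowerSeries.X (Sum.inr i) :=
  MvPowerSeries.substAlgHom_X _ (Sum.inl i)
lemma kt_inr (ε : V) (i) : kt V r ε (MvPowerSeries.X (Sum.inr i)) = MvPowerSeries.X (Sum.inr i) :=
  MvPowerSeries.substAlgHom_X _ (Sum.inr i)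

lemma kt_inv (ε ε' : V) (h : ε + ε' = 0) (f : (MvPowerSeries (Fin r ⊕ Fin r) V)) : kt V r ε (kt V r ε' f) = f := by
  have := mvps_hom_ext ((kt V r ε).comp (kt V r ε')) (AlgHom.id V _) (by
    rintro (s | s)
    · simp only [AlgHom.comp_apply, kt_inl, map_add, map_smul, kt_inr, AlgHom.id_apply]
      rw [add_assoc, ← add_smul, h, zero_smul, add_zero]
    · simp [kt_inr]) (by
    rintro (s | s)
    · simp [kt_inl, kt_inr]
    · simp [kt_inr])
  exact AlgHom.congr_fun this f

/-- automorphism -/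
def kτ : (MvPowerSeries (Fin r ⊕ Fin r) V) ≃+* (MvPowerSeries (Fin r ⊕ Fin r) V) :=
  RingEquiv.ofRingHom (kt V r 1).toRingHom (kt V r (-1)).toRingHom
    (RingHom.ext fun f => kt_inv V r _ _ (by ring) f) (RingHom.ext fun f => kt_inv V r _ _ (by ring) f)

lemma kτ_inl (i) : kτ V r (MvPowerSeries.X (Sum.inl i)) =
    kx V r (MvPowerSeries.X i) := by
  rw [kx_X]
  refine (kt_inl V r 1 i).trans ?_
  rw [one_smul]

lemma kτ_symm_ky (f : (MvPowerSeries (Fin r) V)) : (kτ V r).symm (ky V r f) = ky V r f := by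
  have := mvps_hom_ext ((kt V r (-1)).comp (ky V r)) (ky V r) (fun s => by
    simp [ky_X, kt_inr]) (fun s => by simp [ky_X, kt_inr])
  exact AlgHom.congr_fun this f

lemma kφ_ker : RingHom.ker (kφ V r).toRingHom =
    Ideal.ofList ((List.finRange r).map fun i => MvPowerSeries.X (R := V) (Sum.inl i : Fin r ⊕ Fin r)) := by
  classical
  have e : ((List.finRange r).map fun i => MvPowerSeries.X (R := V) (Sum.inl i : Fin r ⊕ Fin r)) =
    (((List.finRange r).map Sum.inl).map (MvPowerSeries.X (R := V))) := by simp
  rw [e]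
  ext f
  rw [mvps_mem_span, RingHom.mem_ker]
  change kφ V r f = 0 ↔ _
  rw [MvPowerSeries.ext_iff]
  constructor
  · intro h α hα
    have h1 : α ∈ Set.range (Finsupp.embDomain (⟨Sum.inr, Sum.inr_injective⟩ : Fin r ↪ Fin r ⊕ Fin r)) := by
      rw [Finsupp.mem_range_embDomain_iff]
      rintro (s | s) hs
      · exact absurd (hα (Sum.inl s) (by simp)) (by simpa using hs)
      · exact ⟨s, rfl⟩
    obtain ⟨β, rfl⟩ := h1
    exact h β
  · intro h β
    refine h _ ?_
    intro s hs
    simp only [List.mem_map, List.mem_finRange, true_and] at hs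
    obtain ⟨i, rfl⟩ := hs
    exact Finsupp.embDomain_of_notMem_range _ _ _ (by simp)

lemma kreg : IsWeaklyRegular (MvPowerSeries (Fin r ⊕ Fin r) V)
    ((List.finRange r).map fun i => MvPowerSeries.X (R := V) (Sum.inl i : Fin r ⊕ Fin r)) := by
  have e : ((List.finRange r).map fun i => MvPowerSeries.X (R := V) (Sum.inl i : Fin r ⊕ Fin r)) =
    (((List.finRange r).map Sum.inl).map (MvPowerSeries.X (R := V))) := by simp
  rw [e]
  exact mvps_regular _ ((List.nodup_finRange r).map Sum.inl_injective)

lemma kreg' : IsWeaklyRegular (MvPowerSeries (Fin r ⊕ Fin r) V)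
    ((List.finRange r).map fun i => kx V r (MvPowerSeries.X i)) := by
  refine (AddEquiv.isWeaklyRegular_congr (e := (kτ V r).toAddEquiv) ?_).1 (kreg V r)
  rw [List.forall₂_map_left_iff, List.forall₂_map_right_iff, List.forall₂_same]
  intro i _ x
  rw [← kτ_inl]
  exact map_mul (kτ V r) _ _

/-- other projection -/
def kψ : (MvPowerSeries (Fin r ⊕ Fin r) V) →+* (MvPowerSeries (Fin r) V) := (kφ V r).toRingHom.comp (kτ V r).symm.toRingHom

lemma kψ_ky (f : (MvPowerSeries (Fin r) V)) : kψ V r (ky V r f) = f := by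
  change kφ V r ((kτ V r).symm (ky V r f)) = f
  rw [kτ_symm_ky, kφ_ky]

lemma kψ_ker : RingHom.ker (kψ V r) =
    Ideal.ofList ((List.finRange r).map fun i => kx V r (MvPowerSeries.X i)) := by
  have e : ((List.finRange r).map fun i => kx V r (MvPowerSeries.X i)) =
    ((List.finRange r).map fun i => MvPowerSeries.X (R := V) (Sum.inl i : Fin r ⊕ Fin r)).map
      (kτ V r).toRingHom := by
    rw [List.map_map]
    apply List.map_congr_left
    intro i _
    exact (kτ_inl V r i).symm
  rw [e, ← Ideal.map_ofList, ← kφ_ker]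
  ext f
  rw [Ideal.mem_map_iff_of_surjective (kτ V r).toRingHom (kτ V r).surjective]
  constructor
  · intro hf
    exact ⟨(kτ V r).symm f, hf, (kτ V r).apply_symm_apply f⟩
  · rintro ⟨g, hg, rfl⟩
    change kφ V r ((kτ V r).symm (kτ V r g)) = 0
    rw [RingEquiv.symm_apply_apply]
    exact hg

end kosz
end

section
set_option linter.unusedSectionVars false
set_option linter.style.haveILetI false

open TensorProduct

section kosz
variable (V : Type u) [CommRing V] [IsNoetherianRing V] [IsLocalRing V] (r : ℕ)

lemma mvps_X_mem {σ : Type} (s : σ) :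
    (MvPowerSeries.X s : MvPowerSeries σ V) ∈ IsLocalRing.maximalIdeal (MvPowerSeries σ V) := by
  rw [IsLocalRing.mem_maximalIdeal, mem_nonunits_iff, MvPowerSeries.isUnit_iff_constantCoeff]
  simp

lemma kosz1 (M : Type u) [AddCommGroup M] [Module (MvPowerSeries (Fin r) V) M]
    [Module.Finite (MvPowerSeries (Fin r) V) M]
    [Module (MvPowerSeries (Fin r ⊕ Fin r) V) M]
    (hM : ∀ (b : MvPowerSeries (Fin r ⊕ Fin r) V) (m : M), b • m = kφ V r b • m) :
    ∃ (E : Type u) (_ : AddCommGroup E) (_ : Module (MvPowerSeries (Fin r ⊕ Fin r) V) E)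
      (E'' : Type u) (_ : AddCommGroup E'') (_ : Module (MvPowerSeries (Fin r ⊕ Fin r) V) E''),
      Module.Finite (MvPowerSeries (Fin r ⊕ Fin r) V) E ∧
      RS (MvPowerSeries (Fin r ⊕ Fin r) V)
        ((List.finRange r).map fun i => MvPowerSeries.X (Sum.inl i)) E M ∧
      RS (MvPowerSeries (Fin r ⊕ Fin r) V)
        ((List.finRange r).map fun i => kx V r (MvPowerSeries.X i)) E E'' := by
  letI : Algebra (MvPowerSeries (Fin r) V) (MvPowerSeries (Fin r ⊕ Fin r) V) :=
    (ky V r).toRingHom.toAlgebra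
  have halg : ∀ a, algebraMap (MvPowerSeries (Fin r) V) (MvPowerSeries (Fin r ⊕ Fin r) V) a =
    ky V r a := fun a => rfl
  have gen : ∀ (χ : MvPowerSeries (Fin r ⊕ Fin r) V →+* MvPowerSeries (Fin r) V)
      (L : List (MvPowerSeries (Fin r ⊕ Fin r) V))
      (h1 : IsWeaklyRegular (MvPowerSeries (Fin r ⊕ Fin r) V) L)
      (h2 : ∀ f, χ (ky V r f) = f) (h3 : RingHom.ker χ = Ideal.ofList L)
      (h4 : ∀ z ∈ L, z ∈ IsLocalRing.maximalIdeal (MvPowerSeries (Fin r ⊕ Fin r) V)),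
      ∃ (E' : Type u) (_ : AddCommGroup E') (_ : Module (MvPowerSeries (Fin r ⊕ Fin r) V) E')
      (e : E' ≃+ M), (∀ b x, e (b • x) = χ b • e x) ∧ RS (MvPowerSeries (Fin r ⊕ Fin r) V) L
        (MvPowerSeries (Fin r ⊕ Fin r) V ⊗[MvPowerSeries (Fin r) V] M) E' := by
    intro χ L h1 h2 h3 h4
    let C := MvPowerSeries (Fin r) V
    letI mC : Module (MvPowerSeries (Fin r ⊕ Fin r) V) C := Module.compHom _ χ
    have hsm : ∀ (b : MvPowerSeries (Fin r ⊕ Fin r) V) (c : C), b • c = χ b * c := fun _ _ => rfl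
    haveI : IsScalarTower (MvPowerSeries (Fin r) V) (MvPowerSeries (Fin r ⊕ Fin r) V) C :=
      ⟨fun a b c => by
        rw [hsm, hsm, Algebra.smul_def, halg, map_mul, h2, smul_eq_mul, mul_assoc]⟩
    have hr := RS_ring L h1 C χ (fun f => ⟨_, h2 f⟩) hsm h3
    have := (RS_tensor (A := MvPowerSeries (Fin r) V) L (fun z hz => by
      rw [IsLocalRing.jacobson_eq_maximalIdeal ⊥ bot_ne_top]; exact h4 z hz) M _ C hr
      (fun i => T1_flat _ _)).2
    refine ⟨C ⊗[MvPowerSeries (Fin r) V] M, _, _,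
      (TensorProduct.lid (MvPowerSeries (Fin r) V) M).toAddEquiv, ?_, this⟩
    intro b x
    induction x with
    | zero => simp
    | add x y hx hy => rw [smul_add, map_add, map_add, hx, hy, smul_add]
    | tmul c m =>
      rw [TensorProduct.smul_tmul', hsm]
      have hl : ∀ y, (TensorProduct.lid (MvPowerSeries (Fin r) V) M).toAddEquiv y =
        (TensorProduct.lid (MvPowerSeries (Fin r) V) M) y := fun _ => rfl
      rw [hl, hl, TensorProduct.lid_tmul, TensorProduct.lid_tmul, mul_smul]
  obtain ⟨E1, _, _, e1, he1, R1⟩ := gen (kφ V r).toRingHom _ (kreg V r) (kφ_ky V r) (kφ_ker V r) (by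
    intro z hz
    obtain ⟨i, -, rfl⟩ := List.mem_map.1 hz
    exact mvps_X_mem V _)
  obtain ⟨E2, i1, i2, e2, he2, R2⟩ := gen (kψ V r) _ (kreg' V r) (kψ_ky V r) (kψ_ker V r) (by
    intro z hz
    obtain ⟨i, -, rfl⟩ := List.mem_map.1 hz
    rw [kx_X]
    exact Ideal.add_mem _ (mvps_X_mem V _) (mvps_X_mem V _))
  refine ⟨_, _, _, E2, i1, i2, inferInstance, ?_, R2⟩
  have : RS (MvPowerSeries (Fin r ⊕ Fin r) V) [] E1 M := ⟨{ e1 with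
    map_smul' := fun b x => by
      have := he1 b x
      simp only [RingHom.id_apply]
      exact this.trans (hM b _).symm }⟩
  simpa using R1.append this

lemma RS.comap {B C : Type u} [CommRing B] [CommRing C] (χ : B →+* C) (s : C → B)
    (hs : ∀ c, χ (s c) = c) (L : List C) (G G' : Type u) [AddCommGroup G] [AddCommGroup G']
    [Module B G] [Module C G] [Module B G'] [Module C G'] (hG : ∀ (b : B) (g : G), b • g = χ b • g)
    (hG' : ∀ (b : B) (g : G'), b • g = χ b • g) (h : RS C L G G') : RS B (L.map s) G G' := by
  induction L generalizing G with
  | nil =>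
    obtain ⟨e⟩ := h
    refine ⟨{ e with map_smul' := fun b x => ?_ }⟩
    have := map_smul e (χ b) x
    simp only [RingHom.id_apply]
    rw [hG, hG']; exact this
  | cons z L ih =>
    obtain ⟨G1, i1, i2, b, h1, h2, h3, h4⟩ := h
    letI mB : Module B G1 := Module.compHom G1 χ
    have hz : ⇑(LinearMap.lsmul B G (s z)) = ⇑(LinearMap.lsmul C G z) := by
      funext x; simp [hG, hs]
    refine ⟨G1, i1, mB, { toFun := b, map_add' := map_add b, map_smul' := fun c x => ?_ }, ?_, ?_,
      h3, ih G1 (fun _ _ => rfl) h4⟩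
    · rw [hG, map_smul]; rfl
    · rw [hz]; exact h1
    · rw [hz]; exact h2

lemma kosz_RSQ (LV : List V) (hLV : RS V LV V (IsLocalRing.ResidueField V)) :
    ∃ LA : List (MvPowerSeries (Fin r) V), LA.length = LV.length + r ∧
      RS (MvPowerSeries (Fin r) V) LA (MvPowerSeries (Fin r) V)
        (IsLocalRing.ResidueField (MvPowerSeries (Fin r) V)) := by
  classical
  letI mV : Module (MvPowerSeries (Fin r) V) V := Module.compHom V MvPowerSeries.constantCoeff
  have hmV : ∀ (b : MvPowerSeries (Fin r) V) (v : V), b • v = MvPowerSeries.constantCoeff b • v :=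
    fun _ _ => rfl
  letI mk : Module (MvPowerSeries (Fin r) V) (IsLocalRing.ResidueField V) :=
    Module.compHom _ (MvPowerSeries.constantCoeff (R := V) (σ := Fin r))
  have hmk : ∀ (b : MvPowerSeries (Fin r) V) (v : IsLocalRing.ResidueField V),
    b • v = MvPowerSeries.constantCoeff b • v := fun _ _ => rfl
  have r1 : RS (MvPowerSeries (Fin r) V) ((List.finRange r).map (MvPowerSeries.X (R := V)))
      (MvPowerSeries (Fin r) V) V := by
    refine RS_ring _ (mvps_regular _ (List.nodup_finRange r)) V MvPowerSeries.constantCoeff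
      (fun v => ⟨MvPowerSeries.C v, by simp⟩) hmV ?_
    ext f
    rw [mvps_mem_span, RingHom.mem_ker]
    constructor
    · intro h α hα
      have : α = 0 := by ext s; exact hα s (by simp)
      subst this
      simpa using h
    · intro h
      simpa using h 0 (by simp)
  have r2 := RS.comap (MvPowerSeries.constantCoeff (R := V) (σ := Fin r)) (fun v => MvPowerSeries.C v)
    (fun v => by simp) LV V _ hmV hmk hLV
  have r3 : RS (MvPowerSeries (Fin r) V) [] (IsLocalRing.ResidueField V)
      (IsLocalRing.ResidueField (MvPowerSeries (Fin r) V)) := by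
    let g : MvPowerSeries (Fin r) V →ₗ[MvPowerSeries (Fin r) V] IsLocalRing.ResidueField V :=
      { toFun := fun f => IsLocalRing.residue V (MvPowerSeries.constantCoeff f)
        map_add' := by intro x y; simp
        map_smul' := by
          intro x y
          simp only [smul_eq_mul, map_mul, RingHom.id_apply, hmk]
          rw [Algebra.smul_def]; rfl }
    have hg : Function.Surjective g := fun y => by
      obtain ⟨v, rfl⟩ := IsLocalRing.residue_surjective y
      exact ⟨MvPowerSeries.C v, by simp [g]⟩
    have hk : IsLocalRing.maximalIdeal (MvPowerSeries (Fin r) V) = LinearMap.ker g := by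
      ext f
      rw [IsLocalRing.mem_maximalIdeal, mem_nonunits_iff, MvPowerSeries.isUnit_iff_constantCoeff,
        LinearMap.mem_ker]
      change _ ↔ IsLocalRing.residue V (MvPowerSeries.constantCoeff f) = 0
      rw [IsLocalRing.residue_eq_zero_iff, IsLocalRing.mem_maximalIdeal, mem_nonunits_iff]
    exact ⟨((Submodule.quotEquivOfEq _ _ hk).trans (LinearMap.quotKerEquivOfSurjective g hg)).symm⟩
  refine ⟨_, ?_, r1.append (r2.append r3)⟩
  simp [add_comm]

theorem kosz_tower (LV : List V) (hLV : RS V LV V (IsLocalRing.ResidueField V))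
    (hlen : LV.length ≤ 1)
    (M N : Type u) [AddCommGroup M] [Module (MvPowerSeries (Fin r) V) M]
    [Module.Finite (MvPowerSeries (Fin r) V) M]
    [AddCommGroup N] [Module (MvPowerSeries (Fin r) V) N]
    [Module.Finite (MvPowerSeries (Fin r) V) N] :
    ∃ m, @KTower (MvPowerSeries (Fin r ⊕ Fin r) V) _ m
      (fun i => tor (MvPowerSeries (Fin r) V) (MvPowerSeries (Fin r) V) M N i) _
      (fun _ => Module.compHom _ (kφ V r).toRingHom) := by
  letI mM : Module (MvPowerSeries (Fin r ⊕ Fin r) V) M := Module.compHom M (kφ V r).toRingHom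
  obtain ⟨E, _, _, E'', _, _, hfin, h1, h2⟩ := kosz1 V r M (fun _ _ => rfl)
  letI : Algebra (MvPowerSeries (Fin r) V) (MvPowerSeries (Fin r ⊕ Fin r) V) :=
    (kx V r).toRingHom.toAlgebra
  have halg : ∀ a, algebraMap (MvPowerSeries (Fin r) V) (MvPowerSeries (Fin r ⊕ Fin r) V) a =
    kx V r a := fun a => rfl
  letI : Module (MvPowerSeries (Fin r) V) E := Module.compHom E (kx V r).toRingHom
  letI : Module (MvPowerSeries (Fin r) V) E'' := Module.compHom E'' (kx V r).toRingHom
  haveI : IsScalarTower (MvPowerSeries (Fin r) V) (MvPowerSeries (Fin r ⊕ Fin r) V) E :=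
    ⟨fun a b c => by rw [Algebra.smul_def, mul_smul]; rfl⟩
  haveI : IsScalarTower (MvPowerSeries (Fin r) V) (MvPowerSeries (Fin r ⊕ Fin r) V) E'' :=
    ⟨fun a b c => by rw [Algebra.smul_def, mul_smul]; rfl⟩
  have hsm : ∀ (b : MvPowerSeries (Fin r ⊕ Fin r) V) (c : M), b • c = kφ V r b • c := fun _ _ => rfl
  haveI : IsScalarTower (MvPowerSeries (Fin r) V) (MvPowerSeries (Fin r ⊕ Fin r) V) M :=
    ⟨fun a b c => by
      rw [hsm, hsm, Algebra.smul_def, halg, map_mul, kφ_kx, mul_smul]⟩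
  obtain ⟨LA, hLA, RA⟩ := kosz_RSQ V r LV hLV
  have hv : ∀ j, 1 ≤ j → Subsingleton
      (tor (MvPowerSeries (Fin r) V) (MvPowerSeries (Fin r ⊕ Fin r) V) E N j) := by
    intro j hj
    refine base_vanish (A := MvPowerSeries (Fin r) V) (B := MvPowerSeries (Fin r ⊕ Fin r) V) ?_ LA RA
      ((List.finRange r).map fun i => MvPowerSeries.X i) ?_ ?_ E E'' ?_ N j hj
    · intro a ha
      rw [IsLocalRing.jacobson_eq_maximalIdeal ⊥ bot_ne_top]
      rw [IsLocalRing.mem_maximalIdeal, mem_nonunits_iff] at ha ⊢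
      intro hu
      have := hu.map (kφ V r)
      rw [halg, kφ_kx] at this
      exact ha this
    · intro a ha
      obtain ⟨i, -, rfl⟩ := List.mem_map.1 ha
      exact mvps_X_mem V _
    · simp [hLA]; omega
    · rw [List.map_map]; exact h2
  have ht0 : KTower (MvPowerSeries (Fin r ⊕ Fin r) V) 0
      (fun i => tor (MvPowerSeries (Fin r) V) (MvPowerSeries (Fin r ⊕ Fin r) V) E N i) :=
    ⟨fun i => tor_finite (A := MvPowerSeries (Fin r) V) (B := MvPowerSeries (Fin r ⊕ Fin r) V) E N i,
      fun i => hv (i+1) (by omega)⟩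
  obtain ⟨m, hm⟩ := RS_tower (A := MvPowerSeries (Fin r) V) _ 0 N E M h1 ht0
  refine ⟨m, ?_⟩
  letI inst : ∀ i, Module (MvPowerSeries (Fin r ⊕ Fin r) V)
    (tor (MvPowerSeries (Fin r) V) (MvPowerSeries (Fin r) V) M N i) := fun i =>
      Module.compHom _ (kφ V r).toRingHom
  refine hm.congr fun i => ?_
  have ex := T1_res (A := MvPowerSeries (Fin r) V) (B := MvPowerSeries (Fin r ⊕ Fin r) V) M
    (Om (MvPowerSeries (Fin r) V) i (ModuleCat.of (MvPowerSeries (Fin r) V) N))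
  refine { ex.choose with map_smul' := fun b x => ?_ }
  have he := ex.choose_spec (kφ V r b) x
  have hb : b • x = algebraMap (MvPowerSeries (Fin r) V) (MvPowerSeries (Fin r ⊕ Fin r) V) (kφ V r b) • x := by
    apply T1in_inj
    rw [map_smul, map_smul]
    generalize T1in (MvPowerSeries (Fin r) V) (MvPowerSeries (Fin r ⊕ Fin r) V) M _ x = y
    induction y with
    | zero => simp
    | add a b ha hb => rw [smul_add, smul_add, ha, hb]
    | tmul m n =>
      rw [TensorProduct.smul_tmul', TensorProduct.smul_tmul', hsm, hsm, halg, kφ_kx]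
  have := congrArg ex.choose hb
  exact this.trans he

end kosz
end

section
set_option linter.unusedSectionVars false
set_option linter.style.haveILetI false
open TensorProduct

section FS
open MvPolynomial

lemma pderiv_rename_inj {σ τ k0 : Type*} [CommRing k0] (g : σ → τ) (hg : Function.Injective g)
    (i : σ) (p : MvPolynomial σ k0) :
    pderiv (g i) (rename g p) = rename g (pderiv i p) := by
  classical
  induction p using MvPolynomial.induction_on with
  | C a => simp
  | add p q hp hq => simp [hp, hq]
  | mul_X p j hp =>
    simp only [map_mul, rename_X, Derivation.leibniz, hp, smul_eq_mul, map_add, pderiv_X]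
    by_cases h : i = j
    · subst h; simp
    · have : g i ≠ g j := fun e => h (hg e)
      simp [h, this, eq_comm]

lemma kd_zero_iff {k0 A σ : Type*} [CommRing k0] [CommRing A] [Algebra k0 A]
    [Algebra (MvPolynomial σ k0) A] [IsScalarTower k0 (MvPolynomial σ k0) A]
    (x : MvPolynomial σ k0) :
    ((1 : A) ⊗ₜ[MvPolynomial σ k0] (KaehlerDifferential.D k0 (MvPolynomial σ k0) x)) = 0 ↔
      ∀ i, algebraMap (MvPolynomial σ k0) A (pderiv i x) = 0 := by
  let b := (KaehlerDifferential.mvPolynomialBasis k0 σ).baseChange A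
  rw [← b.repr.map_eq_zero_iff, Finsupp.ext_iff]
  refine forall_congr' fun i => ?_
  simp [b, Algebra.smul_def]

lemma fs_crit {k0 A σ : Type*} [CommRing k0] [CommRing A] [Algebra k0 A]
    (v : σ → A) (hv : Function.Surjective (aeval (R := k0) v)) :
    Subsingleton (Algebra.H1Cotangent k0 A) ↔
      ∀ x : MvPolynomial σ k0, aeval v x = 0 → (∀ i, aeval v (pderiv i x) = 0) →
        x ∈ (RingHom.ker (aeval (R := k0) v)) ^ 2 := by
  letI : Algebra (MvPolynomial σ k0) A := (aeval v).toAlgebra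
  haveI : IsScalarTower k0 (MvPolynomial σ k0) A :=
    IsScalarTower.of_algebraMap_eq' (aeval v).comp_algebraMap.symm
  have hs : Function.Surjective (algebraMap (MvPolynomial σ k0) A) := hv
  rw [← Algebra.FormallySmooth.kerCotangentToTensor_injective_iff (R := k0) hs,
    injective_iff_map_eq_zero]
  have key : ∀ x : RingHom.ker (algebraMap (MvPolynomial σ k0) A),
     (KaehlerDifferential.kerCotangentToTensor k0 (MvPolynomial σ k0) A (Ideal.toCotangent _ x) = 0
      → Ideal.toCotangent _ x = 0) ↔ ((∀ i, aeval v (pderiv i x.1) = 0) →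
        x.1 ∈ (RingHom.ker (aeval (R := k0) v)) ^ 2) := by
    intro x
    rw [KaehlerDifferential.kerCotangentToTensor_toCotangent, kd_zero_iff,
      Ideal.toCotangent_eq_zero]
    rfl
  constructor
  · intro h x hx
    exact (key ⟨x, hx⟩).1 (h _)
  · intro h y
    obtain ⟨x, rfl⟩ := Ideal.toCotangent_surjective _ y
    exact (key x).2 (h x.1 x.2)

lemma fs_of_perfect (k0 k : Type*) [Field k0] [Field k] [Algebra k0 k] [PerfectField k0] :
    Algebra.FormallySmooth k0 k := by
  classical
  refine ⟨inferInstance, ?_⟩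
  have hsur : ∀ (A : Type _) [CommRing A] [Algebra k0 A],
      Function.Surjective (aeval (R := k0) (id : A → A)) :=
    fun A _ _ a => ⟨X a, by simp⟩
  rw [fs_crit (id : k → k) (hsur k)]
  intro x hx hd
  obtain ⟨s, q, rfl⟩ := exists_finset_rename x
  let L := IntermediateField.adjoin k0 (s : Set k)
  haveI : Algebra.EssFiniteType k0 L :=
    IntermediateField.essFiniteType_iff.2 ⟨s, rfl⟩
  have hL : Algebra.FormallySmooth k0 L := inferInstance
  have hL1 := hL.subsingleton_h1Cotangent
  rw [fs_crit (id : L → L) (hsur L)] at hL1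
  let ι : {a // a ∈ s} → L := fun a => ⟨a.1, IntermediateField.subset_adjoin _ _ a.2⟩
  let j : L → k := algebraMap L k
  have hj : Function.Injective j := (algebraMap L k).injective
  have hι : Function.Injective ι := fun a b h => Subtype.ext (congrArg (fun t : L => (t : k)) h)
  have hq : rename (R := k0) (Subtype.val : {a // a ∈ s} → k) q = rename j (rename ι q) := by
    rw [rename_rename]; rfl
  have hcomm : ∀ p : MvPolynomial L k0, aeval (R := k0) (id : k → k) (rename j p) =
      algebraMap L k (aeval (R := k0) (id : L → L) p) := by
    intro p
    rw [aeval_rename, ← MvPolynomial.aeval_algebraMap_apply]; rfl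
  rw [hq] at hx hd ⊢
  have h2 := hL1 (rename ι q) ?_ ?_
  · have := Ideal.mem_map_of_mem (rename (R := k0) j).toRingHom h2
    rw [Ideal.map_pow] at this
    refine Ideal.pow_right_mono ?_ 2 this
    rw [Ideal.map_le_iff_le_comap]
    intro p hp
    have hp' : aeval (R := k0) (id : L → L) p = 0 := hp
    change aeval (R := k0) (id : k → k) (rename j p) = 0
    rw [hcomm, hp', map_zero]
  · apply hj
    change algebraMap L k _ = algebraMap L k _
    rw [← hcomm, hx, map_zero]
  · intro i
    apply hj
    change algebraMap L k _ = algebraMap L k _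
    rw [← hcomm, ← pderiv_rename_inj j hj, hd, map_zero]

end FS

section Coeff

lemma flat_quot {R S : Type*} [CommRing R] [CommRing S] (φ : R →+* S) (hφ : φ.Flat)
    (I : Ideal R) (J : Ideal S) (hJ : J = I.map φ) (g : R ⧸ I →+* S ⧸ J)
    (hg : g.comp (Ideal.Quotient.mk I) = (Ideal.Quotient.mk J).comp φ) : g.Flat := by
  algebraize [φ, g]
  subst hJ
  haveI : IsScalarTower R (R ⧸ I) (S ⧸ I.map φ) := IsScalarTower.of_algebraMap_eq' hg.symm
  let e : (S ⧸ I.map φ) ≃ₗ[R] ((R ⧸ I) ⊗[R] S) :=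
    ((Algebra.TensorProduct.quotIdealMapEquivTensorQuot S I).toLinearEquiv.restrictScalars R).trans
      (TensorProduct.comm R S (R ⧸ I))
  have hs : Function.Surjective (algebraMap R (R ⧸ I)) := Ideal.Quotient.mk_surjective
  exact Module.Flat.of_linearEquiv (e.extendScalarsOfSurjective hs)

lemma perfect_of_finite_field (K : Type*) [Field K] [Finite K] : PerfectField K := inferInstance

lemma int_flat (V : Type*) [CommRing V] [IsLocalRing V] (p : ℕ) (hp : p.Prime)
    (hreg : (p : V) ∈ nonZeroDivisors V) (hm : (p : V) ∈ IsLocalRing.maximalIdeal V) :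
    (Int.castRingHom V).Flat := by
  have h : Module.Flat ℤ V := by
    rw [Module.Flat.flat_iff_torsion_eq_bot_of_isBezout]
    rw [eq_bot_iff]
    intro x hx
    obtain ⟨⟨a, ha⟩, hax⟩ := hx
    have ha0 : a ≠ 0 := nonZeroDivisors.ne_zero ha
    have hax' : (a : V) * x = 0 := by
      have : a • x = 0 := hax
      rwa [zsmul_eq_mul] at this
    have hpi : ¬ IsUnit (p : ℤ) := (Nat.prime_iff_prime_int.1 hp).not_isUnit
    obtain ⟨c, hac, hc⟩ := FiniteMultiplicity.exists_eq_pow_mul_and_not_dvd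
      (FiniteMultiplicity.of_not_isUnit hpi ha0)
    generalize multiplicity (p : ℤ) a = n at hac
    subst hac
    have hcu : IsUnit (c : V) := by
      by_contra hcon
      have hcm : (c : V) ∈ IsLocalRing.maximalIdeal V := (IsLocalRing.mem_maximalIdeal _).2 hcon
      have hcop : IsCoprime (p : ℤ) c :=
        ((Nat.prime_iff_prime_int.1 hp).coprime_iff_not_dvd).2 hc
      obtain ⟨u, v, huv⟩ := hcop
      have h1 : (1 : V) ∈ IsLocalRing.maximalIdeal V := by
        have : ((u * p + v * c : ℤ) : V) = 1 := by rw [huv]; simp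
        rw [← this]; push_cast
        exact Ideal.add_mem _ (Ideal.mul_mem_left _ _ hm) (Ideal.mul_mem_left _ _ hcm)
      exact (IsLocalRing.maximalIdeal.isMaximal V).ne_top ((Ideal.eq_top_iff_one _).2 h1)
    have hpn : ((p : V) ^ n) ∈ nonZeroDivisors V := pow_mem hreg n
    push_cast at hax'
    rw [mul_assoc] at hax'
    have h2 := (mem_nonZeroDivisors_iff.1 hpn).1 _ hax'
    simpa using (hcu.mul_right_eq_zero.1 h2)
  have he : (Int.castRingHom V) = algebraMap ℤ V := rfl
  rw [he]
  exact (RingHom.flat_algebraMap_iff).2 h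

lemma int_quot_hom_ext {n : ℤ} {S : Type*} [CommRing S] (f g : (ℤ ⧸ Ideal.span {n}) →+* S) :
    f = g := Ideal.Quotient.ringHom_ext (RingHom.ext_int _ _)

/-- the structure map of `V / p ^ b` over `ℤ / p ^ b`. -/
def zpMap (V : Type*) [CommRing V] (p b : ℕ) :
    (ℤ ⧸ Ideal.span {(p : ℤ) ^ b}) →+* (V ⧸ Ideal.span {(p : V) ^ b}) :=
  Ideal.quotientMap _ (Int.castRingHom V) (by
    rw [Ideal.span_le]
    intro x hx
    rw [Set.mem_singleton_iff] at hx
    subst hx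
    simp)

lemma zpMap_fs (V : Type*) [CommRing V] [IsLocalRing V] (p : ℕ) (hp : p.Prime)
    (hreg : (p : V) ∈ nonZeroDivisors V)
    (hm : Ideal.span {(p : V)} = IsLocalRing.maximalIdeal V) (b : ℕ) :
    (zpMap V p (b + 1)).FormallySmooth := by
  have hpm : (p : V) ∈ IsLocalRing.maximalIdeal V := hm ▸ Ideal.mem_span_singleton_self _
  induction b with
  | zero =>
    have hmz : (Ideal.span {(p : ℤ) ^ (0 + 1)}).IsMaximal := by
      have := (Nat.prime_iff_prime_int.1 hp)
      rw [zero_add, pow_one]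
      exact PrincipalIdealRing.isMaximal_of_irreducible this.irreducible
    have hmV : (Ideal.span {(p : V) ^ (0 + 1)}).IsMaximal := by
      rw [zero_add, pow_one, hm]; infer_instance
    letI := Ideal.Quotient.field (Ideal.span {(p : ℤ) ^ (0 + 1)})
    letI := Ideal.Quotient.field (Ideal.span {(p : V) ^ (0 + 1)})
    haveI : Finite (ℤ ⧸ Ideal.span {(p : ℤ) ^ (0 + 1)}) := by
      have e := Int.quotientSpanNatEquivZMod p
      rw [zero_add, pow_one]
      haveI : NeZero p := ⟨hp.ne_zero⟩
      exact Finite.of_equiv _ e.symm.toEquiv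
    letI := (zpMap V p (0 + 1)).toAlgebra
    exact fs_of_perfect _ _
  | succ b ih =>
    have hleZ : Ideal.span {(p : ℤ) ^ (b + 1 + 1)} ≤ Ideal.span {(p : ℤ) ^ (b + 1)} :=
      Ideal.span_singleton_le_span_singleton.2 (pow_dvd_pow _ (Nat.le_succ _))
    have hleV : Ideal.span {(p : V) ^ (b + 1 + 1)} ≤ Ideal.span {(p : V) ^ (b + 1)} :=
      Ideal.span_singleton_le_span_singleton.2 (pow_dvd_pow _ (Nat.le_succ _))
    have hkZ : RingHom.ker (Ideal.Quotient.factor hleZ) =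
        Ideal.span {Ideal.Quotient.mk (Ideal.span {(p : ℤ) ^ (b + 1 + 1)}) ((p : ℤ) ^ (b + 1))} := by
      rw [Ideal.Quotient.factor_ker, Ideal.map_span, Set.image_singleton]
    have hkV : RingHom.ker (Ideal.Quotient.factor hleV) =
        Ideal.span {Ideal.Quotient.mk (Ideal.span {(p : V) ^ (b + 1 + 1)}) ((p : V) ^ (b + 1))} := by
      rw [Ideal.Quotient.factor_ker, Ideal.map_span, Set.image_singleton]
    refine RingHom.FormallySmooth.of_flat_of_ker_eq_map_of_square_zero _
      (flat_quot (Int.castRingHom V) (int_flat V p hp hreg hpm) _ _ ?_ _ ?_)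
      (Ideal.Quotient.factor hleZ) (Ideal.Quotient.factor hleV) (zpMap V p (b + 1))
      (Ideal.Quotient.factor_surjective _) (Ideal.Quotient.factor_surjective _)
      (int_quot_hom_ext _ _) ?_ ?_ ih
    · rw [Ideal.map_span, Set.image_singleton]; simp
    · exact RingHom.ext_int _ _
    · rw [hkZ, Ideal.span_singleton_pow, ← map_pow, Ideal.span_singleton_eq_bot,
        Ideal.Quotient.eq_zero_iff_mem, Ideal.mem_span_singleton, ← pow_mul]
      exact pow_dvd_pow _ (by omega)
    · rw [hkZ, hkV, Ideal.map_span, Set.image_singleton]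
      simp [zpMap]

lemma coeff_step (V : Type*) [CommRing V] [IsLocalRing V] (p : ℕ) (hp : p.Prime)
    (hreg : (p : V) ∈ nonZeroDivisors V)
    (hm : Ideal.span {(p : V)} = IsLocalRing.maximalIdeal V)
    {Q : Type*} [CommRing Q] (m : Ideal Q) (hpQ : (p : Q) ∈ m) (b : ℕ)
    (φ : V →+* Q ⧸ m ^ (b + 1)) :
    ∃ ψ : V →+* Q ⧸ m ^ (b + 1 + 1),
      (Ideal.Quotient.factor (Ideal.pow_le_pow_right (Nat.le_succ (b + 1)))).comp ψ = φ := by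
  let B := Q ⧸ m ^ (b + 1 + 1)
  let C := Q ⧸ m ^ (b + 1)
  have hpB : ((p : B)) ^ (b + 1 + 1) = 0 := by
    have : (p : B) = Ideal.Quotient.mk _ (p : Q) := by simp
    rw [this, ← map_pow, Ideal.Quotient.eq_zero_iff_mem]
    exact Ideal.pow_mem_pow hpQ _
  let π : B →+* C := Ideal.Quotient.factor (Ideal.pow_le_pow_right (Nat.le_succ (b + 1)))
  have hpC : ((p : C)) ^ (b + 1 + 1) = 0 := by
    have := congrArg π hpB
    simpa using this
  let Z := ℤ ⧸ Ideal.span {(p : ℤ) ^ (b + 1 + 1)}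
  let W := V ⧸ Ideal.span {(p : V) ^ (b + 1 + 1)}
  let zB : Z →+* B := Ideal.Quotient.lift _ (Int.castRingHom B) (by
    intro x hx
    obtain ⟨y, rfl⟩ := Ideal.mem_span_singleton.1 hx
    simp [hpB])
  let φ' : W →+* C := Ideal.Quotient.lift _ φ (by
    intro x hx
    obtain ⟨y, rfl⟩ := Ideal.mem_span_singleton.1 hx
    simp [hpC])
  letI : Algebra Z B := zB.toAlgebra
  letI : Algebra Z C := (π.comp zB).toAlgebra
  letI : Algebra Z W := (zpMap V p (b + 1 + 1)).toAlgebra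
  haveI hfs : Algebra.FormallySmooth Z W := zpMap_fs V p hp hreg hm (b + 1)
  let π' : B →ₐ[Z] C := { π with commutes' := fun z => rfl }
  let φ'' : W →ₐ[Z] C := { φ' with
    commutes' := fun z => DFunLike.congr_fun
      (int_quot_hom_ext (φ'.comp (zpMap V p (b + 1 + 1))) (π.comp zB)) z }
  have hsurj : Function.Surjective π' :=
    Ideal.Quotient.factor_surjective (Ideal.pow_le_pow_right (Nat.le_succ (b + 1)))
  have hnil : IsNilpotent (RingHom.ker (π' : B →+* C)) := by
    have : RingHom.ker (π' : B →+* C) = (m ^ (b + 1)).map (Ideal.Quotient.mk (m ^ (b + 1 + 1))) :=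
      Ideal.Quotient.factor_ker (Ideal.pow_le_pow_right (Nat.le_succ (b + 1)))
    refine ⟨2, ?_⟩
    rw [this, ← Ideal.map_pow, ← pow_mul, Ideal.zero_eq_bot, Ideal.map_eq_bot_iff_le_ker,
      Ideal.mk_ker]
    exact Ideal.pow_le_pow_right (by omega)
  let ψ := Algebra.FormallySmooth.liftOfSurjective φ'' π' hsurj hnil
  refine ⟨(ψ : W →+* B).comp (Ideal.Quotient.mk _), ?_⟩
  ext v
  have := Algebra.FormallySmooth.liftOfSurjective_apply φ'' π' hsurj hnil (Ideal.Quotient.mk _ v)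
  exact this

lemma coeff_mixed (V : Type*) [CommRing V] [IsLocalRing V] (p : ℕ) (hp : p.Prime)
    (hreg : (p : V) ∈ nonZeroDivisors V)
    (hm : Ideal.span {(p : V)} = IsLocalRing.maximalIdeal V)
    {Q : Type*} [CommRing Q] (m : Ideal Q) [IsAdicComplete m Q] (hpQ : (p : Q) ∈ m)
    (φ : V →+* Q ⧸ m) :
    ∃ ψ : V →+* Q, (Ideal.Quotient.mk m).comp ψ = φ := by
  let φ1 : V →+* Q ⧸ m ^ (0 + 1) :=
    (Ideal.Quotient.factor (by rw [zero_add, pow_one])).comp φ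
  choose nxt hnxt using fun b => coeff_step V p hp hreg hm m hpQ b
  let F : ∀ b : ℕ, V →+* Q ⧸ m ^ (b + 1) := fun b => Nat.rec φ1 (fun b g => nxt b g) b
  have hF : ∀ b, (Ideal.Quotient.factor (Ideal.pow_le_pow_right (Nat.le_succ (b + 1)))).comp
      (F (b + 1)) = F b := fun b => hnxt b (F b)
  let G : ∀ b : ℕ, V →+* Q ⧸ m ^ b := fun b =>
    (Ideal.Quotient.factor (Ideal.pow_le_pow_right (Nat.le_succ b))).comp (F b)
  have hG : ∀ b, (Ideal.Quotient.factorPow m (Nat.le_succ b)).comp (G (b + 1)) = G b := by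
    intro b
    change _ = (Ideal.Quotient.factor (Ideal.pow_le_pow_right (Nat.le_succ b))).comp (F b)
    rw [← hF b]
  have hG' : ∀ {a b : ℕ} (hle : a ≤ b), (Ideal.Quotient.factorPow m hle).comp (G b) = G a := by
    intro a b hle
    induction b, hle using Nat.le_induction with
    | base => ext v; simp
    | succ b hab ih =>
      rw [← ih, ← hG b]
      ext v
      obtain ⟨y, hy⟩ := Ideal.Quotient.mk_surjective (G (b + 1) v)
      simp only [RingHom.comp_apply, ← hy]
      rfl
  refine ⟨IsAdicComplete.liftRingHom m G hG', ?_⟩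
  ext v
  have h1 := IsAdicComplete.mk_liftRingHom m G hG' 1 v
  have h2 : G 1 v = Ideal.Quotient.factor (by rw [pow_one]) (φ v) := by
    rw [← hG 1] 
    obtain ⟨y, hy⟩ := Ideal.Quotient.mk_surjective (φ v)
    have h3 : F 1 v = F 1 v := rfl
    have h4 := RingHom.congr_fun (hF 0) v
    have h5 : F 0 v = Ideal.Quotient.factor (by rw [zero_add, pow_one]) (φ v) := rfl
    rw [h5, ← hy] at h4
    rw [← hy]
    have h6 := RingHom.congr_fun (hG 1) v
    rw [h6]
    exact h4
  rw [h2] at h1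
  obtain ⟨y, hy⟩ := Ideal.Quotient.mk_surjective (φ v)
  rw [← hy] at h1 ⊢
  rw [Ideal.Quotient.factor_mk, Ideal.Quotient.eq, pow_one] at h1
  exact Ideal.Quotient.eq.2 h1

lemma coeff_equal {Q : Type u} [CommRing Q] (m : Ideal Q) [m.IsMaximal] [IsAdicComplete m Q]
    (K : Type u) [Field K] (i : K →+* Q) :
    ∃ ψ : (Q ⧸ m) →+* Q, (Ideal.Quotient.mk m).comp ψ = RingHom.id _ := by
  have key : ∀ (k0 : Type) [Field k0] [PerfectField k0] (j : k0 →+* Q),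
      ∃ ψ : (Q ⧸ m) →+* Q, (Ideal.Quotient.mk m).comp ψ = RingHom.id _ := by
    intro k0 _ _ j
    letI := j.toAlgebra
    letI := Ideal.Quotient.field m
    haveI : Algebra.FormallySmooth k0 (Q ⧸ m) := fs_of_perfect _ _
    obtain ⟨g, hg⟩ := Algebra.FormallySmooth.exists_mkₐ_comp_eq_of_isAdicComplete
      (AlgHom.id k0 (Q ⧸ m))
    exact ⟨g.toRingHom, RingHom.ext fun x => DFunLike.congr_fun hg x⟩
  obtain ⟨p, hp⟩ := CharP.exists K
  rcases CharP.char_is_prime_or_zero K p with h | h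
  · haveI : Fact p.Prime := ⟨h⟩
    exact key (ZMod p) (i.comp (ZMod.castHom (dvd_refl p) K))
  · subst h
    haveI : CharZero K := CharP.charP_to_charZero K
    exact key ℚ (i.comp (algebraMap ℚ K))

end Coeff
end

section
set_option linter.unusedSectionVars false
set_option linter.style.haveILetI false

lemma wreg_append {A : Type u} [CommRing A] (L : List A) (z : A) :
    IsWeaklyRegular A (L ++ [z]) ↔
      IsWeaklyRegular A L ∧ ∀ a, z * a ∈ Ideal.ofList L → a ∈ Ideal.ofList L := by
  have key : ∀ (I : Ideal A) (w : A), IsSMulRegular (A ⧸ I • (⊤ : Ideal A)) w ↔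
      ∀ a, w * a ∈ I → a ∈ I := by
    intro I w
    rw [isSMulRegular_iff_right_eq_zero_of_smul]
    have hI : I • (⊤ : Ideal A) = I := by simp
    constructor
    · intro h a ha
      have := h (Submodule.Quotient.mk a) (by
        rw [← Submodule.Quotient.mk_smul, Submodule.Quotient.mk_eq_zero, hI]; exact ha)
      rwa [Submodule.Quotient.mk_eq_zero, hI] at this
    · intro h x hx
      obtain ⟨a, rfl⟩ := Submodule.mkQ_surjective _ x
      rw [Submodule.mkQ_apply, ← Submodule.Quotient.mk_smul, Submodule.Quotient.mk_eq_zero, hI] at hx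
      rw [Submodule.mkQ_apply, Submodule.Quotient.mk_eq_zero, hI]
      exact h a hx
  rw [isWeaklyRegular_iff, isWeaklyRegular_iff]
  simp only [key]
  constructor
  · intro h
    refine ⟨fun i hi => ?_, ?_⟩
    · have := h i (by simp; omega)
      rw [List.getElem_append_left hi, List.take_append_of_le_length hi.le] at this
      exact this
    · have := h L.length (by simp)
      simpa using this
  · rintro ⟨h1, h2⟩ i hi
    by_cases h : i < L.length
    · rw [List.getElem_append_left h, List.take_append_of_le_length h.le]
      exact h1 i h
    · have : i = L.length := by simp at hi; omega
      subst this
      simpa using h2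

lemma inj_of_reg {P A : Type u} [CommRing P] [IsNoetherianRing P] [CommRing A] (Φ : P →+* A)
    (L : List P) (hL : ∀ z ∈ L, z ∈ Ideal.jacobson (⊥ : Ideal P))
    (hreg : IsWeaklyRegular A (L.map Φ))
    (h : ∀ g, Φ g ∈ Ideal.ofList (L.map Φ) → g ∈ Ideal.ofList L) : Function.Injective Φ := by
  induction L using List.reverseRecOn with
  | nil =>
    rw [injective_iff_map_eq_zero]
    intro a ha
    simpa using h a (by simp [ha])
  | append_singleton L z ih =>
    rw [List.map_append, List.map_singleton, wreg_append] at hreg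
    refine ih (fun w hw => hL w (by simp [hw])) hreg.1 ?_
    let K : Ideal P := Ideal.comap Φ (Ideal.ofList (L.map Φ))
    have hle : K ≤ Ideal.ofList L ⊔ (Ideal.span {z}) • K := by
      intro g hg
      have h1 := h g (by
        rw [List.map_append, Ideal.ofList_append]
        exact Submodule.mem_sup_left hg)
      rw [Ideal.ofList_append, Ideal.ofList_singleton, Submodule.mem_sup] at h1
      obtain ⟨j, hj, y, hy, rfl⟩ := h1
      obtain ⟨c, rfl⟩ := Ideal.mem_span_singleton.1 hy
      have hΦj : Φ j ∈ Ideal.ofList (L.map Φ) := by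
        rw [← Ideal.map_ofList]; exact Ideal.mem_map_of_mem _ hj
      have h2 : Φ z * Φ c ∈ Ideal.ofList (L.map Φ) := by
        have : Φ (j + z * c) ∈ Ideal.ofList (L.map Φ) := hg
        rw [map_add, map_mul] at this
        exact (Submodule.add_mem_iff_right _ hΦj).1 this
      exact Submodule.add_mem_sup hj
        (Submodule.smul_mem_smul (Ideal.mem_span_singleton_self z) (hreg.2 _ h2))
    have := Submodule.le_of_le_smul_of_le_jacobson_bot (IsNoetherian.noetherian K)
      ((Ideal.span_singleton_le_iff_mem _).2 (hL z (by simp))) hle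
    exact fun g hg => this hg

lemma psmap {A : Type u} [CommRing A] (m : Ideal A) [IsAdicComplete m A] (V : Type u) [CommRing V]
    (r : ℕ) (x : Fin r → A) (hx : ∀ i, x i ∈ m) (ψ : V →+* A) :
    ∃ Φ : MvPowerSeries (Fin r) V →+* A, (∀ i, Φ (MvPowerSeries.X i) = x i) ∧
      ∀ v, Φ (MvPowerSeries.C v) = ψ v := by
  let e : MvPolynomial (Fin r) V →+* A := MvPolynomial.eval₂Hom ψ x
  have he : ∀ n, (MvPolynomial.idealOfVars (Fin r) V) ^ n ≤ Ideal.comap e (m ^ n) := by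
    intro n
    rw [← Ideal.map_le_iff_le_comap, Ideal.map_pow]
    refine Ideal.pow_right_mono ?_ n
    rw [MvPolynomial.idealOfVars, Ideal.map_span, Ideal.span_le]
    rintro _ ⟨_, ⟨i, rfl⟩, rfl⟩
    simpa [e] using hx i
  let f : ∀ n, MvPowerSeries (Fin r) V →+* A ⧸ m ^ n := fun n =>
    (Ideal.quotientMap (m ^ n) e (he n)).comp
      (MvPowerSeries.truncTotalAlgHom (Fin r) V n).toRingHom
  have hfa : ∀ n p, f n p = Ideal.Quotient.mk (m ^ n) (e (p.truncTotal n)) := fun n p => rfl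
  have hf : ∀ {a b : ℕ} (hle : a ≤ b), (Ideal.Quotient.factorPow m hle).comp (f b) = f a := by
    intro a b hle
    ext p
    rw [RingHom.comp_apply, hfa, hfa]
    change Ideal.Quotient.mk (m ^ a) (e (p.truncTotal b)) = _
    rw [Ideal.Quotient.eq, ← map_sub]
    exact he a (MvPowerSeries.truncTotal_sub_truncTotal_mem_pow_idealOfVars hle le_rfl p)
  have hpoly : ∀ q : MvPolynomial (Fin r) V, IsAdicComplete.liftRingHom m f hf (q : MvPowerSeries (Fin r) V) = e q := by
    intro q
    rw [← sub_eq_zero]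
    refine IsHausdorff.haus (inferInstance : IsHausdorff m A) _ fun n => ?_
    rw [SModEq.zero, smul_eq_mul, Ideal.mul_top, ← Ideal.Quotient.eq, IsAdicComplete.mk_liftRingHom, hfa,
      Ideal.Quotient.eq, ← map_sub]
    refine he n ?_
    exact (MvPolynomial.mem_pow_idealOfVars_iff' ..).mpr fun y hy ↦ by
      simp [MvPowerSeries.coeff_truncTotal _ hy]
  refine ⟨IsAdicComplete.liftRingHom m f hf, fun i => ?_, fun v => ?_⟩
  · have := hpoly (MvPolynomial.X i)
    rw [MvPolynomial.coe_X] at this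
    rw [this]; simp [e]
  · have := hpoly (MvPolynomial.C v)
    rw [MvPolynomial.coe_C] at this
    rw [this]; simp [e]

/-- Structure theorem, abstract form. -/
lemma psiso {A : Type u} [CommRing A] (m : Ideal A) [IsAdicComplete m A]
    (V : Type u) [CommRing V] [IsNoetherianRing V] [IsLocalRing V]
    (r : ℕ) (x : Fin r → A) (hx : ∀ i, x i ∈ m) (hreg : IsWeaklyRegular A (List.ofFn x))
    (ψ : V →+* A)
    (hψ : Function.Bijective ((Ideal.Quotient.mk (Ideal.span (Set.range x))).comp ψ)) :
    Nonempty (MvPowerSeries (Fin r) V ≃+* A) := by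
  obtain ⟨Φ, hX, hC⟩ := psmap m V r x hx ψ
  let LX : List (MvPowerSeries (Fin r) V) := (List.finRange r).map (MvPowerSeries.X (R := V))
  have hLX : LX.map Φ = List.ofFn x := by
    rw [List.map_map, List.ofFn_eq_map]
    congr 1; ext i; simp [hX]
  have hsp : Ideal.ofList (List.ofFn x) = Ideal.span (Set.range x) := by
    rw [Ideal.ofList]; congr 1; ext y; simp [List.mem_ofFn]
  have hmap : (Ideal.span (Set.range (MvPowerSeries.X (σ := Fin r) (R := V)))).map Φ =
      Ideal.span (Set.range x) := by
    rw [Ideal.map_span, ← Set.range_comp]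
    congr 2; ext i; simp [hX]
  refine ⟨RingEquiv.ofBijective Φ ⟨?_, ?_⟩⟩
  · refine inj_of_reg Φ LX ?_ (hLX ▸ hreg) ?_
    · intro z hz
      obtain ⟨i, -, rfl⟩ := List.mem_map.1 hz
      refine IsLocalRing.maximalIdeal_le_jacobson _ ?_
      exact mvps_X_mem V i
    · intro g hg
      rw [hLX, hsp] at hg
      rw [mvps_mem_span]
      intro α hα
      have hα0 : α = 0 := by ext i; simpa using hα i (by simp)
      subst hα0
      have hd : g - MvPowerSeries.C (MvPowerSeries.coeff 0 g) ∈ Ideal.ofList LX := by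
        rw [mvps_mem_span]
        intro α hα
        have hα0 : α = 0 := by ext i; simpa using hα i (by simp)
        subst hα0
        simp
      have h1 : Φ (g - MvPowerSeries.C (MvPowerSeries.coeff 0 g)) ∈ Ideal.span (Set.range x) := by
        rw [← hsp, ← hLX, ← Ideal.map_ofList]; exact Ideal.mem_map_of_mem _ hd
      rw [map_sub, hC] at h1
      have h2 : ψ (MvPowerSeries.coeff 0 g) ∈ Ideal.span (Set.range x) := by
        simpa using Ideal.sub_mem _ hg h1
      exact hψ.1 (by rw [map_zero]; exact Ideal.Quotient.eq_zero_iff_mem.2 h2)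
  · have hH : IsHausdorff (Ideal.span (Set.range x)) A := by
      have h0 : IsHausdorff m A := inferInstance
      refine ⟨fun a ha => h0.haus a fun n => ?_⟩
      refine (ha n).mono (Submodule.smul_mono_left (Ideal.pow_right_mono ?_ n))
      rw [Ideal.span_le]; rintro _ ⟨i, rfl⟩; exact hx i
    have : IsHausdorff ((Ideal.span (Set.range (MvPowerSeries.X (σ := Fin r) (R := V)))).map Φ) A := by
      rwa [hmap]
    refine surjective_of_mk_map_comp_surjective
      (I := Ideal.span (Set.range (MvPowerSeries.X (σ := Fin r) (R := V)))) Φ ?_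
    rw [hmap]
    intro y
    obtain ⟨v, hv⟩ := hψ.2 y
    exact ⟨MvPowerSeries.C v, by rw [← hv]; simp [hC]⟩

end

section
set_option linter.unusedSectionVars false
set_option linter.style.haveILetI false

lemma mixed_split {Q : Type u} [CommRing Q] [IsLocalRing Q] (L : List Q)
    (hL : ∀ z ∈ L, z ∈ IsLocalRing.maximalIdeal Q) (p : Q) (hp : p ∈ Ideal.ofList L) :
    p ∈ (IsLocalRing.maximalIdeal Q) ^ 2 ∨ ∃ l1 y l2, L = l1 ++ y :: l2 ∧
      ∃ a : Q, IsUnit a ∧ p - a * y ∈ Ideal.ofList (l1 ++ l2) := by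
  induction L generalizing p with
  | nil =>
    left
    have : p = 0 := by simpa using hp
    rw [this]; exact zero_mem _
  | cons z L ih =>
    rw [Ideal.ofList_cons, Submodule.mem_sup] at hp
    obtain ⟨w, hw, q, hq, rfl⟩ := hp
    obtain ⟨c, rfl⟩ := Ideal.mem_span_singleton.1 hw
    by_cases hc : IsUnit c
    · right
      refine ⟨[], z, L, rfl, c, hc, ?_⟩
      rw [mul_comm z c, add_sub_cancel_left]; exact hq
    · have hcz : z * c ∈ (IsLocalRing.maximalIdeal Q) ^ 2 := by
        rw [pow_two]
        exact Ideal.mul_mem_mul (hL z (by simp)) ((IsLocalRing.mem_maximalIdeal c).2 hc)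
      rcases ih (fun w hw => hL w (by simp [hw])) q hq with h | ⟨l1, y, l2, rfl, a, ha, h⟩
      · left; exact Ideal.add_mem _ hcz h
      · right
        refine ⟨z :: l1, y, l2, rfl, a, ha, ?_⟩
        rw [List.cons_append, Ideal.ofList_cons, add_sub_assoc]
        exact Submodule.add_mem_sup hw h

lemma mixed_reg {Q : Type u} [CommRing Q] [IsLocalRing Q] [IsNoetherianRing Q] (L : List Q)
    (hL : ∀ z ∈ L, z ∈ IsLocalRing.maximalIdeal Q) (hreg : IsWeaklyRegular Q L)
    (hgen : Ideal.ofList L = IsLocalRing.maximalIdeal Q)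
    (p : Q) (hp : p ∈ IsLocalRing.maximalIdeal Q) (hp2 : p ∉ (IsLocalRing.maximalIdeal Q) ^ 2) :
    ∃ xs : List Q, (∀ z ∈ xs, z ∈ IsLocalRing.maximalIdeal Q) ∧
      IsWeaklyRegular Q (xs ++ [p]) ∧ Ideal.ofList (xs ++ [p]) = IsLocalRing.maximalIdeal Q := by
  rcases mixed_split L hL p (hgen ▸ hp) with h | ⟨l1, y, l2, rfl, a, ha, h⟩
  · exact absurd h hp2
  have hperm : List.Perm (l1 ++ y :: l2) ((l1 ++ l2) ++ [y]) := by
    refine List.perm_middle.trans ?_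
    exact (List.perm_append_singleton y (l1 ++ l2)).symm
  have hreg' := IsLocalRing.isWeaklyRegular_of_perm_of_subset_maximalIdeal hreg hperm hL
  rw [wreg_append] at hreg'
  have hsub : ∀ z ∈ l1 ++ l2, z ∈ IsLocalRing.maximalIdeal Q := fun z hz => hL z (by
    simp only [List.mem_append, List.mem_cons] at hz ⊢; tauto)
  refine ⟨l1 ++ l2, hsub, ?_, ?_⟩
  · rw [wreg_append]
    refine ⟨hreg'.1, fun b hb => hreg'.2 b ?_⟩
    have h1 : a * (y * b) ∈ Ideal.ofList (l1 ++ l2) := by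
      have := Ideal.sub_mem _ hb (Ideal.mul_mem_right b _ h)
      ring_nf at this ⊢; exact this
    obtain ⟨u, rfl⟩ := ha
    have := Ideal.mul_mem_left _ (↑u⁻¹ : Q) h1
    rwa [← mul_assoc, Units.inv_mul, one_mul] at this
  · rw [Ideal.ofList_append]
    apply le_antisymm
    · refine sup_le (Ideal.span_le.2 hsub) ?_
      rw [Ideal.ofList_singleton, Ideal.span_singleton_le_iff_mem]; exact hp
    · rw [← hgen]
      refine Ideal.span_le.2 fun z hz => ?_
      have hz' : z ∈ l1 ++ y :: l2 := hz
      have hz2 := hperm.mem_iff.1 hz'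
      rw [List.mem_append, List.mem_singleton] at hz2
      rcases hz2 with hz2 | rfl
      · exact Submodule.mem_sup_left (Ideal.subset_span hz2)
      · have h1 : a * z ∈ Ideal.ofList (l1 ++ l2) ⊔ Ideal.ofList [p] := by
          have : a * z = -(p - a * z) + p := by ring
          rw [this]
          refine Submodule.add_mem_sup (neg_mem h) ?_
          rw [Ideal.ofList_singleton]; exact Ideal.mem_span_singleton_self p
        obtain ⟨u, rfl⟩ := ha
        have := Ideal.mul_mem_left _ (↑u⁻¹ : Q) h1
        rwa [← mul_assoc, Units.inv_mul, one_mul] at this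

lemma adic_congr {Q : Type u} [CommRing Q] (m : Ideal Q) {X Y : Type u} [AddCommGroup X] [Module Q X]
    [AddCommGroup Y] [Module Q Y] (e : X ≃ₗ[Q] Y) (h : IsAdicComplete m Y) : IsAdicComplete m X := by
  have hm : ∀ n (x : X), x ∈ (m ^ n • ⊤ : Submodule Q X) ↔ e x ∈ (m ^ n • ⊤ : Submodule Q Y) := by
    intro n x
    have : (m ^ n • ⊤ : Submodule Q Y) = (m ^ n • ⊤ : Submodule Q X).map (e : X →ₗ[Q] Y) := by
      rw [Submodule.map_smul'', Submodule.map_top, LinearEquiv.range]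
    rw [this]
    constructor
    · intro h; exact ⟨x, h, rfl⟩
    · rintro ⟨y, hy, hxy⟩
      rwa [← e.injective hxy]
  have hs : ∀ n (x y : X), x ≡ y [SMOD (m ^ n • ⊤ : Submodule Q X)] ↔
      e x ≡ e y [SMOD (m ^ n • ⊤ : Submodule Q Y)] := by
    intro n x y
    rw [SModEq.sub_mem, SModEq.sub_mem, hm, map_sub]
  have h1 : IsHausdorff m X := ⟨fun x hx => by
    refine (map_eq_zero_iff e e.injective).1 (h.toIsHausdorff.haus _ fun n => ?_)
    have := (hs n _ _).1 (hx n)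
    rwa [map_zero] at this⟩
  have h2 : IsPrecomplete m X := ⟨fun f hf => by
    obtain ⟨L, hL⟩ := h.toIsPrecomplete.prec (f := fun n => e (f n))
      (fun {a b} hab => (hs a _ _).1 (hf hab))
    refine ⟨e.symm L, fun n => (hs n _ _).2 ?_⟩
    rw [LinearEquiv.apply_symm_apply]; exact hL n⟩
  exact { h1, h2 with }

/-- Quotients of the completion by extended ideals are complete. -/
lemma hat_quot_complete (Q : Type u) [CommRing Q] [IsNoetherianRing Q] (m J : Ideal Q) :
    IsAdicComplete m (AdicCompletion m Q ⧸ J.map (algebraMap Q (AdicCompletion m Q))) := by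
  let e1 := (Algebra.TensorProduct.quotIdealMapEquivTensorQuot (AdicCompletion m Q) J).toLinearEquiv
  let e2 := AdicCompletion.ofTensorProductEquivOfFiniteNoetherian m (Q ⧸ J)
  exact adic_congr m ((e1.trans e2).restrictScalars Q)
    (AdicCompletion.isAdicComplete (Ideal.fg_of_isNoetherianRing m))

/-- The output of the structure theorem. -/
def IsPS (A : Type u) [CommRing A] : Prop :=
  ∃ (V : Type u) (_ : CommRing V) (_ : IsNoetherianRing V) (_ : IsLocalRing V) (r : ℕ) (LV : List V),
    LV.length ≤ 1 ∧ RS V LV V (IsLocalRing.ResidueField V) ∧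
      Nonempty (MvPowerSeries (Fin r) V ≃+* A)

lemma reg_hat (Q : Type u) [CommRing Q] [IsNoetherianRing Q] (m : Ideal Q) (L : List Q)
    (h : IsWeaklyRegular Q L) :
    IsWeaklyRegular (AdicCompletion m Q) (L.map (algebraMap Q (AdicCompletion m Q))) := by
  haveI : Module.Flat Q (AdicCompletion m Q) := AdicCompletion.flat_of_isNoetherian m
  exact h.of_flat

lemma ofFn_get_map {Q A : Type u} [CommRing Q] [CommRing A] (g : Q →+* A) (L : List Q) :
    List.ofFn (fun i : Fin L.length => g (L.get i)) = L.map g := by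
  apply List.ext_get
  · simp
  · intro n h1 h2
    simp

lemma span_range_get {Q A : Type u} [CommRing Q] [CommRing A] (g : Q →+* A) (L : List Q) :
    Ideal.span (Set.range (fun i : Fin L.length => g (L.get i))) = (Ideal.ofList L).map g := by
  rw [Ideal.map_ofList, ← ofFn_get_map, Ideal.ofList]
  congr 1; ext y; exact (List.mem_ofFn).symm

lemma struct_equal (Q : Type u) [CommRing Q] [IsNoetherianRing Q] [IsLocalRing Q] (L : List Q)
    (hreg : IsWeaklyRegular Q L) (hgen : Ideal.ofList L = IsLocalRing.maximalIdeal Q)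
    (K : Type u) [Field K] (i : K →+* Q) :
    IsPS (AdicCompletion (IsLocalRing.maximalIdeal Q) Q) := by
  let A := AdicCompletion (IsLocalRing.maximalIdeal Q) Q
  let m := IsLocalRing.maximalIdeal A
  letI : Field (A ⧸ m) := Ideal.Quotient.field m
  obtain ⟨ψ, hψ⟩ := coeff_equal m K ((algebraMap Q A).comp i)
  have hmap : m = (IsLocalRing.maximalIdeal Q).map (algebraMap Q A) :=
    AdicCompletion.maximalIdeal_eq_map
  refine ⟨A ⧸ m, inferInstance, inferInstance, inferInstance, L.length, [], by simp, ?_, ?_⟩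
  · refine ⟨LinearEquiv.ofBijective (Algebra.linearMap (A ⧸ m) (IsLocalRing.ResidueField (A ⧸ m))) ⟨?_, ?_⟩⟩
    · exact (algebraMap (A ⧸ m) (IsLocalRing.ResidueField (A ⧸ m))).injective
    · exact IsLocalRing.residue_surjective
  · refine psiso m (A ⧸ m) L.length (fun i => algebraMap Q A (L.get i)) ?_ ?_ ψ ?_
    · intro i
      rw [hmap]
      refine Ideal.mem_map_of_mem _ (hgen.le ?_)
      exact (Ideal.subset_span (List.get_mem L i))
    · rw [ofFn_get_map]; exact reg_hat Q _ L hreg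
    · rw [span_range_get, hgen, ← hmap, hψ]
      exact Function.bijective_id

lemma struct_mixed (Q : Type u) [CommRing Q] [IsNoetherianRing Q] [IsLocalRing Q] (xs : List Q)
    (p : ℕ) (hp : p.Prime) (hpm : (p : Q) ∈ IsLocalRing.maximalIdeal Q)
    (hxm : ∀ z ∈ xs, z ∈ IsLocalRing.maximalIdeal Q)
    (hreg : IsWeaklyRegular Q (xs ++ [(p : Q)]))
    (hgen : Ideal.ofList (xs ++ [(p : Q)]) = IsLocalRing.maximalIdeal Q) :
    IsPS (AdicCompletion (IsLocalRing.maximalIdeal Q) Q) := by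
  let A := AdicCompletion (IsLocalRing.maximalIdeal Q) Q
  let m := IsLocalRing.maximalIdeal A
  have hmap : m = (IsLocalRing.maximalIdeal Q).map (algebraMap Q A) :=
    AdicCompletion.maximalIdeal_eq_map
  let J : Ideal A := (Ideal.ofList xs).map (algebraMap Q A)
  have hJm : J ≤ m := by
    rw [hmap]; exact Ideal.map_mono (Ideal.span_le.2 hxm)
  have hJmQ : Ideal.ofList xs ≤ IsLocalRing.maximalIdeal Q := Ideal.span_le.2 hxm
  let V := A ⧸ J
  have hpA : algebraMap Q A (p : Q) = (p : A) := map_natCast _ p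
  haveI : Nontrivial V := Ideal.Quotient.nontrivial_iff.2 (ne_top_of_le_ne_top (Ideal.IsPrime.ne_top inferInstance) hJm)
  haveI : IsLocalRing V := IsLocalRing.of_surjective' (Ideal.Quotient.mk J) Ideal.Quotient.mk_surjective
  -- maximal ideal of V
  have hmV0 : (IsLocalRing.maximalIdeal Q).map (algebraMap Q V) = Ideal.span {(p : V)} := by
    refine (congrArg (fun I => I.map (algebraMap Q V)) hgen.symm).trans ?_
    rw [Ideal.ofList_append, Ideal.ofList_singleton, Ideal.map_sup,
      Ideal.map_span (algebraMap Q V) {(p : Q)}, Set.image_singleton, map_natCast]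
    rw [sup_eq_right, IsScalarTower.algebraMap_eq Q A V, ← Ideal.map_map]
    have : Ideal.map (algebraMap A V) J = ⊥ := Ideal.map_quotient_self J
    exact (this.trans_le bot_le)
  have hmV : Ideal.span {(p : V)} = IsLocalRing.maximalIdeal V := by
    rw [← hmV0, IsScalarTower.algebraMap_eq Q A V, ← Ideal.map_map, ← hmap]
    refine (IsLocalRing.eq_maximalIdeal ?_)
    have : Function.Surjective (algebraMap A V) := Ideal.Quotient.mk_surjective
    refine Ideal.IsMaximal.map_of_surjective_of_ker_le this ?_
    have : RingHom.ker (algebraMap A V) = J := Ideal.mk_ker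
    rw [this]; exact hJm
  have hcomp : IsAdicComplete (Ideal.span {(p : V)}) V := by
    rw [← hmV0, IsAdicComplete.map_algebraMap_iff]
    exact hat_quot_complete Q _ _
  have hregA := reg_hat Q (IsLocalRing.maximalIdeal Q) _ hreg
  rw [List.map_append, List.map_singleton, wreg_append, ← Ideal.map_ofList] at hregA
  have hpn : ∀ v : V, (p : V) * v = 0 → v = 0 := by
    intro v hv
    obtain ⟨a, rfl⟩ := Ideal.Quotient.mk_surjective v
    refine Ideal.Quotient.eq_zero_iff_mem.2 (hregA.2 a ?_)
    rw [map_natCast]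
    refine Ideal.Quotient.eq_zero_iff_mem.1 ?_
    rw [map_mul, map_natCast]; exact hv
  have hpnz : (p : V) ∈ nonZeroDivisors V := by
    rw [mem_nonZeroDivisors_iff_right]
    intro v hv; exact hpn v (by rw [mul_comm]; exact hv)
  have hhaus : ∀ v : V, (∀ n : ℕ, v ∈ Ideal.span {(p : V)} ^ n) → v = 0 := by
    intro v hv
    refine hcomp.toIsHausdorff.haus v fun n => ?_
    rw [SModEq.zero, smul_eq_mul, Ideal.mul_top]; exact hv n
  haveI hN : IsNoetherianRing V := by
    refine IsNoetherianRing.of_prime fun P hP => ?_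
    by_cases hpP : (p : V) ∈ P
    · have : P = Ideal.span {(p : V)} := by
        refine le_antisymm ?_ ((Ideal.span_singleton_le_iff_mem _).2 hpP)
        rw [hmV]; exact IsLocalRing.le_maximalIdeal hP.ne_top
      rw [this]; exact ⟨{(p : V)}, by simp⟩
    · have key : ∀ n : ℕ, P ≤ Ideal.span {(p : V)} ^ n := by
        intro n
        induction n with
        | zero => simp
        | succ n ih =>
          intro v hv
          have h1 : v ∈ Ideal.span {(p : V)} := by
            rw [hmV]; exact IsLocalRing.le_maximalIdeal hP.ne_top hv
          obtain ⟨w, rfl⟩ := Ideal.mem_span_singleton.1 h1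
          have hw := (hP.mem_or_mem hv).resolve_left hpP
          rw [pow_succ']
          exact Ideal.mul_mem_mul (Ideal.mem_span_singleton_self _) (ih hw)
      have : P = ⊥ := (Submodule.eq_bot_iff _).2 fun v hv => hhaus v fun n => key n hv
      rw [this]; exact Submodule.fg_bot
  have hpmA : (p : A) ∈ m := by
    rw [← hpA, hmap]; exact Ideal.mem_map_of_mem _ hpm
  obtain ⟨ψ, hψ⟩ := coeff_mixed V p hp hpnz hmV m hpmA (Ideal.Quotient.factor hJm)
  let θ : V →+* V := (Ideal.Quotient.mk J).comp ψ
  have hθ : ∀ v, θ v - v ∈ Ideal.span {(p : V)} := by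
    intro v
    obtain ⟨a, rfl⟩ := Ideal.Quotient.mk_surjective v
    have h1 := RingHom.congr_fun hψ (Ideal.Quotient.mk J a)
    have h2 : Ideal.Quotient.mk m (ψ (Ideal.Quotient.mk J a)) = Ideal.Quotient.mk m a := h1
    rw [Ideal.Quotient.eq] at h2
    change Ideal.Quotient.mk J _ - Ideal.Quotient.mk J a ∈ _
    rw [← map_sub]
    have : m.map (Ideal.Quotient.mk J) = Ideal.span {(p : V)} := by
      rw [← hmV0, IsScalarTower.algebraMap_eq Q A V, ← Ideal.map_map, ← hmap]; rfl
    rw [← this]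
    exact Ideal.mem_map_of_mem _ h2
  have hθp : (Ideal.span {(p : V)}).map θ = Ideal.span {(p : V)} := by
    rw [Ideal.map_span, Set.image_singleton, map_natCast]
  have hsurj : Function.Surjective θ := by
    have : IsHausdorff ((Ideal.span {(p : V)}).map θ) V := by rw [hθp]; infer_instance
    refine surjective_of_mk_map_comp_surjective (I := Ideal.span {(p : V)}) θ ?_
    rw [hθp]
    intro y
    obtain ⟨v, rfl⟩ := Ideal.Quotient.mk_surjective y
    exact ⟨v, Ideal.Quotient.eq.2 (hθ v)⟩
  have hinj : Function.Injective θ := by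
    rw [injective_iff_map_eq_zero]
    intro v hv
    refine hhaus v fun n => ?_
    have : ∀ n : ℕ, ∀ v, θ v = 0 → v ∈ Ideal.span {(p : V)} ^ n := by
      intro n
      induction n with
      | zero => simp
      | succ n ih =>
        intro v hv
        have h1 := hθ v
        rw [hv, zero_sub, neg_mem_iff] at h1
        obtain ⟨w, rfl⟩ := Ideal.mem_span_singleton.1 h1
        rw [map_mul, map_natCast] at hv
        rw [pow_succ']
        exact Ideal.mul_mem_mul (Ideal.mem_span_singleton_self _) (ih w (hpn _ hv))
    exact this n v hv
  refine ⟨V, inferInstance, hN, inferInstance, xs.length, [(p : V)], by simp, ?_, ?_⟩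
  · refine ⟨IsLocalRing.ResidueField V, inferInstance, inferInstance,
      Algebra.linearMap V (IsLocalRing.ResidueField V), ?_, ?_, IsLocalRing.residue_surjective,
      ⟨LinearEquiv.refl _ _⟩⟩
    · rw [injective_iff_map_eq_zero]
      intro v hv; exact hpn v hv
    · intro v
      change IsLocalRing.residue V v = 0 ↔ _
      rw [IsLocalRing.residue_eq_zero_iff, ← hmV, Ideal.mem_span_singleton]
      constructor
      · rintro ⟨c, rfl⟩; exact ⟨c, rfl⟩
      · rintro ⟨c, rfl⟩; exact ⟨c, rfl⟩
  · refine psiso m V xs.length (fun i => algebraMap Q A (xs.get i)) ?_ ?_ ψ ?_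
    · intro i
      rw [hmap]
      exact Ideal.mem_map_of_mem _ (hxm _ (List.get_mem xs i))
    · rw [ofFn_get_map]; exact hregA.1
    · rw [span_range_get]
      exact ⟨hinj, hsurj⟩

end

section
set_option linter.unusedSectionVars false
set_option linter.style.haveILetI false

/-- Extending a surjection `Q → S` to the completion. -/
lemma hat_ext (Q : Type u) [CommRing Q] [IsNoetherianRing Q] [IsLocalRing Q] (S : Type u)
    [CommRing S] [IsLocalRing S] [IsAdicComplete (IsLocalRing.maximalIdeal S) S] (f : Q) (g : Q →+* S)
    (hg : Function.Surjective g) (hk : RingHom.ker g = Ideal.span {f}) :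
    ∃ G : AdicCompletion (IsLocalRing.maximalIdeal Q) Q →+* S, Function.Surjective G ∧
      RingHom.ker G = Ideal.span {algebraMap Q (AdicCompletion (IsLocalRing.maximalIdeal Q) Q) f} := by
  let m := IsLocalRing.maximalIdeal Q
  let A := AdicCompletion m Q
  let mS := IsLocalRing.maximalIdeal S
  have hmS : m.map g = mS := by
    apply le_antisymm
    · rw [Ideal.map_le_iff_le_comap]
      intro q hq
      refine (IsLocalRing.mem_maximalIdeal _).2 fun hu => ?_
      obtain ⟨s, hs⟩ := hu.exists_right_inv
      obtain ⟨q', rfl⟩ := hg s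
      have h1 : 1 - q * q' ∈ RingHom.ker g := by
        rw [RingHom.mem_ker, map_sub, map_mul, hs, map_one, sub_self]
      have h2 := IsLocalRing.le_maximalIdeal (RingHom.ker_ne_top g) h1
      have h3 : (1 : Q) ∈ m := by
        have := Ideal.add_mem _ h2 (Ideal.mul_mem_right q' _ hq)
        rwa [sub_add_cancel] at this
      exact (Ideal.ne_top_iff_one m).1 (Ideal.IsPrime.ne_top inferInstance) h3
    · intro s hs
      obtain ⟨q, rfl⟩ := hg s
      refine Ideal.mem_map_of_mem _ ((IsLocalRing.mem_maximalIdeal _).2 fun hq => ?_)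
      exact (IsLocalRing.mem_maximalIdeal _).1 hs (hq.map g)
  have he : ∀ n, m ^ n ≤ Ideal.comap g (mS ^ n) := by
    intro n
    rw [← Ideal.map_le_iff_le_comap, Ideal.map_pow, hmS]
  let F : ∀ n, A →+* S ⧸ mS ^ n := fun n =>
    (Ideal.quotientMap (mS ^ n) g (he n)).comp (AdicCompletion.evalₐ m n).toRingHom
  have hF : ∀ {a b : ℕ} (hle : a ≤ b), (Ideal.Quotient.factorPow mS hle).comp (F b) = F a := by
    intro a b hle
    ext x
    obtain ⟨q, hq⟩ := Ideal.Quotient.mk_surjective (AdicCompletion.evalₐ m b x)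
    have h1 : AdicCompletion.evalₐ m a x = Ideal.Quotient.mk _ q := by
      obtain ⟨c, rfl⟩ := AdicCompletion.mk_surjective m Q x
      rw [AdicCompletion.evalₐ_mk] at hq ⊢
      rw [Ideal.Quotient.eq] at hq ⊢
      have h2 := (AdicCompletion.AdicCauchySequence.mk_eq_mk (I := m) (M := Q) hle c)
      have h3 : c b - c a ∈ m ^ a := by
        have h4 := (Submodule.Quotient.eq _).1 h2
        simpa using h4
      have h5 := Ideal.add_mem _ (Ideal.pow_le_pow_right hle hq) h3
      have h6 : c a - q = -((q - c b) + (c b - c a)) := by ring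
      rw [h6]; exact neg_mem h5
    change Ideal.Quotient.factorPow mS hle (Ideal.quotientMap (mS ^ b) g (he b) (AdicCompletion.evalₐ m b x)) =
      Ideal.quotientMap (mS ^ a) g (he a) (AdicCompletion.evalₐ m a x)
    rw [h1, ← hq]
    rfl
  let G := IsAdicComplete.liftRingHom mS F hF
  have hG : ∀ q : Q, G (algebraMap Q A q) = g q := by
    intro q
    rw [← sub_eq_zero]
    refine IsHausdorff.haus (inferInstance : IsHausdorff mS S) _ fun n => ?_
    rw [SModEq.zero, smul_eq_mul, Ideal.mul_top, ← Ideal.Quotient.eq, IsAdicComplete.mk_liftRingHom]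
    change Ideal.quotientMap (mS ^ n) g (he n) (AdicCompletion.evalₐ m n (algebraMap Q A q)) = _
    rw [AlgHom.commutes]
    rfl
  refine ⟨G, fun s => ?_, ?_⟩
  · obtain ⟨q, rfl⟩ := hg s
    exact ⟨_, hG q⟩
  · apply le_antisymm
    · intro a ha
      have ha0 : G a = 0 := ha
      have hc := hat_quot_complete Q m (Ideal.span {f})
      have hmapf : (Ideal.span {f}).map (algebraMap Q A) = Ideal.span {algebraMap Q A f} := by
        rw [Ideal.map_span, Set.image_singleton]
      rw [hmapf] at hc
      rw [← Ideal.Quotient.eq_zero_iff_mem]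
      refine hc.toIsHausdorff.haus _ fun n => ?_
      rw [SModEq.zero]
      obtain ⟨q, hq⟩ := Ideal.Quotient.mk_surjective (AdicCompletion.evalₐ m n a)
      have h1 : a - algebraMap Q A q ∈ (m ^ n • ⊤ : Submodule Q A) := by
        rw [AdicCompletion.pow_smul_top_eq_ker_eval (Ideal.fg_of_isNoetherianRing m)]
        rw [LinearMap.mem_ker, map_sub, sub_eq_zero]
        have h2 : AdicCompletion.evalₐ m n a = AdicCompletion.evalₐ m n (algebraMap Q A q) := by
          rw [AlgHom.commutes, ← hq]; rfl
        rw [← AdicCompletion.factor_evalₐ_eq_eval (I := m) a (by simp),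
          ← AdicCompletion.factor_evalₐ_eq_eval (I := m) _ (by simp), h2]
      have h2 : g q ∈ mS ^ n := by
        have h3 : Ideal.Quotient.mk (mS ^ n) (G a) = F n a := IsAdicComplete.mk_liftRingHom ..
        have h4 : F n a = Ideal.Quotient.mk (mS ^ n) (g q) := by
          change Ideal.quotientMap (mS ^ n) g (he n) (AdicCompletion.evalₐ m n a) = _
          rw [← hq]; rfl
        rw [h4, ha0, map_zero] at h3
        exact Ideal.Quotient.eq_zero_iff_mem.1 h3.symm
      rw [← hmS, ← Ideal.map_pow, Ideal.mem_map_iff_of_surjective g hg] at h2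
      obtain ⟨q', hq', hqq⟩ := h2
      have h5 : q - q' ∈ Ideal.span {f} := by
        rw [← hk, RingHom.mem_ker, map_sub, hqq, sub_self]
      let ρ : A →ₗ[Q] A ⧸ Ideal.span {algebraMap Q A f} :=
        (Ideal.Quotient.mkₐ Q (Ideal.span {algebraMap Q A f})).toLinearMap
      have h6 : ρ (algebraMap Q A q) = q' • ρ 1 := by
        have h7 : ρ (algebraMap Q A q) = ρ (algebraMap Q A q') := by
          change Ideal.Quotient.mk _ _ = Ideal.Quotient.mk _ _
          rw [Ideal.Quotient.eq, ← map_sub, ← hmapf]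
          exact Ideal.mem_map_of_mem _ h5
        rw [h7, ← map_smul, Algebra.smul_def, mul_one]
      have h8 : ρ a = ρ (a - algebraMap Q A q) + q' • ρ 1 := by
        rw [map_sub, h6, sub_add_cancel]
      change ρ a ∈ _
      rw [h8]
      refine Submodule.add_mem _ ?_ (Submodule.smul_mem_smul hq' Submodule.mem_top)
      have h9 := Submodule.mem_map_of_mem (f := ρ) h1
      rw [Submodule.map_smul''] at h9
      exact Submodule.smul_mono le_rfl le_top h9
    · rw [Ideal.span_singleton_le_iff_mem, RingHom.mem_ker, hG, ← RingHom.mem_ker, hk]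
      exact Ideal.mem_span_singleton_self f

lemma span_nonunits (R : Type u) [CommRing R] [IsLocalRing R] :
    Ideal.span (nonunits R) = IsLocalRing.maximalIdeal R :=
  Submodule.span_eq (IsLocalRing.maximalIdeal R)

/-- The structure theorem in the form used below. -/
theorem struct_thm (R : Type u) [CommRing R] [IsNoetherianRing R] [IsLocalRing R]
    (hhyp : ∃ (Q : Type u) (_ : CommRing Q), IsUnramifiedRegLocal Q ∧
      ∃ f : Q, f ∈ nonunits Q ∧ f ∈ nonZeroDivisors Q ∧
        Nonempty ((Q ⧸ Ideal.span {f}) ≃+* AdicCompletion (Ideal.span (nonunits R)) R)) :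
    ∃ (V : Type u) (_ : CommRing V) (_ : IsNoetherianRing V) (_ : IsLocalRing V) (r : ℕ)
      (LV : List V) (f : MvPowerSeries (Fin r) V)
      (π : MvPowerSeries (Fin r) V →+* AdicCompletion (IsLocalRing.maximalIdeal R) R),
      LV.length ≤ 1 ∧ RS V LV V (IsLocalRing.ResidueField V) ∧
      f ∈ IsLocalRing.maximalIdeal (MvPowerSeries (Fin r) V) ∧
      f ∈ nonZeroDivisors (MvPowerSeries (Fin r) V) ∧ Function.Surjective π ∧
      RingHom.ker π = Ideal.span {f} := by
  rw [span_nonunits] at hhyp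
  obtain ⟨Q, _, ⟨⟨hN, hloc, L, hLreg, hLm, hLgen⟩, hch⟩, f, hfm, hfn, ⟨e⟩⟩ := hhyp
  rw [span_nonunits] at hLgen
  have hps : IsPS (AdicCompletion (IsLocalRing.maximalIdeal Q) Q) := by
    rcases hch with ⟨K, _, ⟨i⟩⟩ | ⟨-, p, hp, hpm, hp2⟩
    · exact struct_equal Q L hLreg hLgen K i
    · rw [span_nonunits] at hp2
      obtain ⟨xs, hxm, hxr, hxg⟩ := mixed_reg L hLm hLreg hLgen (p : Q) hpm hp2
      exact struct_mixed Q xs p hp hpm hxm hxr hxg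
  obtain ⟨V, _, _, _, r, LV, hlen, hRS, ⟨ε⟩⟩ := hps
  obtain ⟨G, hGs, hGk⟩ := hat_ext Q (AdicCompletion (IsLocalRing.maximalIdeal R) R) f
    (e.toRingHom.comp (Ideal.Quotient.mk _)) (e.surjective.comp Ideal.Quotient.mk_surjective) (by
      ext q
      rw [RingHom.mem_ker, RingHom.comp_apply]
      change e _ = 0 ↔ _
      rw [map_eq_zero_iff e e.injective, Ideal.Quotient.eq_zero_iff_mem])
  let A := AdicCompletion (IsLocalRing.maximalIdeal Q) Q
  let a : A := algebraMap Q A f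
  have ha : a ∈ IsLocalRing.maximalIdeal A := by
    rw [AdicCompletion.maximalIdeal_eq_map]; exact Ideal.mem_map_of_mem _ hfm
  have han : a ∈ nonZeroDivisors A := by
    have h1 : IsWeaklyRegular Q ([] ++ [f]) := by
      rw [wreg_append]
      refine ⟨IsWeaklyRegular.nil .., fun b hb => ?_⟩
      simp only [Ideal.ofList_nil, Ideal.mem_bot] at hb ⊢
      exact (mem_nonZeroDivisors_iff.1 hfn).1 b hb
    have h2 := reg_hat Q (IsLocalRing.maximalIdeal Q) _ h1
    rw [List.map_append, List.map_singleton, wreg_append] at h2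
    rw [mem_nonZeroDivisors_iff_right]
    intro b hb
    simpa using h2.2 b (by simpa [mul_comm] using hb)
  refine ⟨V, inferInstance, inferInstance, inferInstance, r, LV, ε.symm a, G.comp ε.toRingHom, hlen, hRS,
    ?_, ?_, hGs.comp ε.surjective, ?_⟩
  · rw [IsLocalRing.mem_maximalIdeal] at ha ⊢
    intro h
    apply ha
    have := h.map ε
    rwa [RingEquiv.apply_symm_apply] at this
  · rw [mem_nonZeroDivisors_iff_right]
    intro b hb
    apply ε.injective
    rw [map_zero]
    refine (mem_nonZeroDivisors_iff_right.1 han) _ ?_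
    rw [← ε.apply_symm_apply a, ← map_mul, hb, map_zero]
  · ext q
    rw [RingHom.mem_ker, RingHom.comp_apply]
    change ε q ∈ RingHom.ker G ↔ _
    rw [hGk, Ideal.mem_span_singleton, Ideal.mem_span_singleton]
    exact ⟨fun h => by simpa using map_dvd ε.symm h, fun h => by simpa using map_dvd ε h⟩

end

section
set_option linter.unusedSectionVars false

/-! ## Part E: the counting argument for rigidity -/

section dao
variable {B : Type u} [CommRing B] [IsNoetherianRing B]

lemma dao_count (l : AddFn B) {n : ℕ} {T U : ℕ → Type u} [∀ i, AddCommGroup (T i)]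
    [∀ i, Module B (T i)] [∀ i, AddCommGroup (U i)] [∀ i, Module B (U i)]
    (hT : KTower B n T) (hU : ∀ i, Module.Finite B (U i))
    (a : ∀ i, T (i+1) →ₗ[B] U (i+1)) (b : ∀ i, U (i+2) →ₗ[B] U i) (c : ∀ i, U i →ₗ[B] T (i+1))
    (E1 : ∀ i, Function.Exact (a (i+1)) (b i)) (E2 : ∀ i, Function.Exact (b i) (c i))
    (E3 : ∀ i, Function.Exact (c i) (a i))
    {C : Type u} [AddCommGroup C] [Module B C] (β : U 1 →ₗ[B] C) (E0 : Function.Exact (a 0) β)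
    (hU0 : Subsingleton (U 0)) (hfin : ∀ i, l.f (U i) ≠ ⊤)
    (hper : ∀ n0, ∃ j, n0 ≤ j ∧ l.f (U (j+1)) = l.f (U j)) : ∀ i, l.f (U i) = 0 := by
  have hTf := hT.finite
  obtain ⟨ρ, hρ0, hρ1⟩ : ∃ ρ : ℕ → ℕ∞, ρ 0 = l.f (LinearMap.range β) ∧
      ∀ i, ρ (i+1) = l.f (LinearMap.range (b i)) :=
    ⟨fun i => Nat.casesOn i (l.f (LinearMap.range β)) (fun i => l.f (LinearMap.range (b i))),
      rfl, fun _ => rfl⟩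
  have e1 : ∀ i, l.f (U (i+1)) = l.f (LinearMap.range (a i)) + ρ i := by
    intro i
    cases i with
    | zero => rw [hρ0]; exact l.add_exact _ _ E0
    | succ i => rw [hρ1]; exact l.add_exact _ _ (E1 i)
  have e2 : ∀ i, l.f (U i) = ρ (i+1) + l.f (LinearMap.range (c i)) := by
    intro i; rw [hρ1]; exact l.add_exact _ _ (E2 i)
  have e3 : ∀ i, l.f (T (i+1)) = l.f (LinearMap.range (c i)) + l.f (LinearMap.range (a i)) :=
    fun i => l.add_exact _ _ (E3 i)
  generalize hA : (fun i => l.f (LinearMap.range (a i))) = A at *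
  generalize hC : (fun i => l.f (LinearMap.range (c i))) = Cc at *
  have hA' : ∀ i, l.f (LinearMap.range (a i)) = A i := fun i => by rw [← hA]
  have hC' : ∀ i, l.f (LinearMap.range (c i)) = Cc i := fun i => by rw [← hC]
  simp only [hA'] at e1 e3
  simp only [hC'] at e2 e3
  have f1 : ∀ i, A i ≠ ⊤ := fun i h => hfin (i+1) (by rw [e1, h, top_add])
  have f2 : ∀ i, ρ i ≠ ⊤ := fun i h => hfin (i+1) (by rw [e1, h, add_top])
  have f3 : ∀ i, Cc i ≠ ⊤ := fun i h => hfin i (by rw [e2, h, add_top])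
  have f4 : ∀ i, l.f (T (i+1)) ≠ ⊤ := fun i => by
    rw [e3]; exact WithTop.add_ne_top.2 ⟨f3 i, f1 i⟩
  lift A to ℕ → ℕ using f1
  lift ρ to ℕ → ℕ using f2
  lift Cc to ℕ → ℕ using f3
  obtain ⟨u, hu⟩ : ∃ u : ℕ → ℕ, ∀ i, l.f (U i) = u i :=
    ⟨fun i => (l.f (U i)).toNat, fun i => (ENat.natCast_toNat (hfin i)).symm⟩
  have g1 : ∀ i, (u (i+1) : ℤ) = A i + ρ i := fun i => by
    have := e1 i; rw [hu] at this; beta_reduce at this; exact_mod_cast this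
  have g2 : ∀ i, (u i : ℤ) = ρ (i+1) + Cc i := fun i => by
    have := e2 i; rw [hu] at this; beta_reduce at this; exact_mod_cast this
  have g3 : ∀ i, ((l.f (T (i+1))).toNat : ℤ) = Cc i + A i := fun i => by
    rw [e3]; norm_cast
  have u0 : u 0 = 0 := by
    have := hu 0; rw [l.zero _ hU0] at this; exact_mod_cast this.symm
  have hchi : ∀ m, chi1 l T m = u 0 - ρ 0 - (-1)^m * ((u m : ℤ) - ρ m) := by
    intro m
    induction m with
    | zero => simp [chi1]
    | succ m ih =>
      unfold chi1 at ih ⊢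
      rw [Finset.sum_range_succ, ih, g3, pow_succ]
      have h1 := g1 m
      have h2 := g2 m
      have : (Cc m : ℤ) + A m = u m - ρ (m+1) + u (m+1) - ρ m := by linarith
      rw [this]; ring
  obtain ⟨m, hm, hm'⟩ := hper (n+1)
  have e5 : (u (m+1) : ℤ) = u m := by
    rw [hu, hu] at hm'; exact_mod_cast hm'
  have e6 : Cc m = 0 := by
    have h1 := g3 m
    have := hT.vanish (m+1) (by omega)
    rw [l.zero _ this] at h1
    have : (Cc m : ℤ) + A m = 0 := by simpa using h1.symm
    omega
  have key : chi1 l T (m+1) = - ρ 0 := by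
    rw [hchi, u0, e5, g2 m, e6]; push_cast; ring
  have pos := chi_nonneg l hT f4 (m+1) (by omega)
  have r0 : ρ 0 = 0 := by
    have : (0:ℤ) ≤ - ρ 0 := by rw [← key]; exact pos
    omega
  have hz := tower_Str l hT f4 (m+1) (by omega) (by rw [key, r0]; simp)
  have g4 : ∀ i, A i = 0 := fun i => by
    have := g3 i; rw [hz i] at this
    have : (Cc i : ℤ) + A i = 0 := by simpa using this.symm
    omega
  have hall : ∀ i, u i = 0 ∧ u (i+1) = 0 := by
    intro i
    induction i with
    | zero =>
      refine ⟨u0, ?_⟩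
      have := g1 0; rw [g4, r0] at this; simpa using this
    | succ i ih =>
      refine ⟨ih.2, ?_⟩
      have h1 := g1 (i+1)
      have h2 := g2 i
      rw [g4] at h1; rw [ih.1] at h2
      push_cast at h1 h2
      omega
  intro i
  rw [hu, (hall i).1]; rfl

/-- Rigidity, abstract version. -/
theorem dao_vanish {n : ℕ} {T U : ℕ → Type u} [∀ i, AddCommGroup (T i)]
    [∀ i, Module B (T i)] [∀ i, AddCommGroup (U i)] [∀ i, Module B (U i)]
    (hT : KTower B n T) (hU : ∀ i, Module.Finite B (U i))
    (a : ∀ i, T (i+1) →ₗ[B] U (i+1)) (b : ∀ i, U (i+2) →ₗ[B] U i) (c : ∀ i, U i →ₗ[B] T (i+1))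
    (E1 : ∀ i, Function.Exact (a (i+1)) (b i)) (E2 : ∀ i, Function.Exact (b i) (c i))
    (E3 : ∀ i, Function.Exact (c i) (a i))
    {C : Type u} [AddCommGroup C] [Module B C] (β : U 1 →ₗ[B] C) (E0 : Function.Exact (a 0) β)
    (hU0 : Subsingleton (U 0))
    (hmin : ∀ q : PrimeSpectrum B, (∃ i, q ∈ Module.support B (U i)) →
      (∀ i, ∀ q' : PrimeSpectrum B, q' < q → q' ∉ Module.support B (U i)) →
      ∃ l : AddFn B, (∀ i, l.f (U i) ≠ ⊤) ∧ (∀ i, l.f (U i) = 0 → q ∉ Module.support B (U i)) ∧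
        ∀ n0, ∃ j, n0 ≤ j ∧ l.f (U (j+1)) = l.f (U j)) : ∀ i, Subsingleton (U i) := by
  by_contra hc
  push Not at hc
  obtain ⟨i, hi⟩ := hc
  have hne : ({q | ∃ i, q ∈ Module.support B (U i)} : Set (PrimeSpectrum B)).Nonempty := by
    obtain ⟨q, hq⟩ := Module.nonempty_support_of_nontrivial (R := B) (M := U i)
    exact ⟨q, i, hq⟩
  obtain ⟨q, ⟨j, hj⟩, hq⟩ := (wf_prime B).has_min _ hne
  obtain ⟨l, h1, h2, h3⟩ := hmin q ⟨j, hj⟩ (fun i q' h h' => hq q' ⟨i, h'⟩ h)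
  exact h2 j (dao_count l hT hU a b c E1 E2 E3 β E0 hU0 h1 h3 j) hj

end dao

end

section
set_option linter.unusedSectionVars false
set_option linter.style.haveILetI false
open TensorProduct

/-! ## Part D: change of rings -/

section chg
variable {Q S : Type u} [CommRing Q] [CommRing S] [Algebra Q S] (f : Q)
  (hs : Function.Surjective (algebraMap Q S)) (hk : RingHom.ker (algebraMap Q S) = Ideal.span {f})
  (hf : f ∈ nonZeroDivisors Q)

include hs hk hf in
lemma fin_seq (ι : Type u) :
    ∃ (a : (ι →₀ Q) →ₗ[Q] (ι →₀ Q)) (b : (ι →₀ Q) →ₗ[Q] (ι →₀ S)), (∀ x, a x = f • x) ∧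
      Function.Injective a ∧ Function.Exact a b ∧ Function.Surjective b := by
  refine ⟨LinearMap.lsmul Q _ f, Finsupp.mapRange.linearMap (Algebra.linearMap Q S),
    fun x => rfl, ?_, ?_, ?_⟩
  · rw [injective_iff_map_eq_zero]
    intro x hx
    ext i
    have := DFunLike.congr_fun hx i
    simp only [LinearMap.lsmul_apply, Finsupp.smul_apply, smul_eq_mul, Finsupp.zero_apply] at this
    exact (mul_left_mem_nonZeroDivisors_eq_zero_iff hf).1 this
  · intro x
    constructor
    · intro hx
      have h1 : ∀ i, ∃ y, x i = f * y := by
        intro i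
        have := DFunLike.congr_fun hx i
        have h2 : x i ∈ RingHom.ker (algebraMap Q S) := by simpa using this
        rw [hk, Ideal.mem_span_singleton] at h2
        exact h2
      choose g hg using h1
      classical
      refine ⟨Finsupp.onFinset x.support (fun i => if x i = 0 then 0 else g i) ?_, ?_⟩
      · intro i hi
        rw [Finsupp.mem_support_iff]
        intro h; simp [h] at hi
      · ext i
        simp only [LinearMap.lsmul_apply, Finsupp.smul_apply, smul_eq_mul, Finsupp.onFinset_apply]
        split_ifs with h
        · rw [h, mul_zero]
        · exact (hg i).symm
    · rintro ⟨y, rfl⟩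
      ext i
      have : algebraMap Q S f = 0 := by
        rw [← RingHom.mem_ker, hk]; exact Ideal.mem_span_singleton_self f
      simp [Algebra.smul_def, this]
  · exact Finsupp.mapRange_surjective _ (map_zero _) hs

include hs hk hf in
lemma free_acyc (ι : Type u) (K : Type u) [AddCommGroup K] [Module Q K]
    (hK : ∀ x : K, f • x = 0 → x = 0) (i : ℕ) : Subsingleton (tor Q Q (ι →₀ S) K i) := by
  obtain ⟨a, b, ha, h1, h2, h3⟩ := fin_seq f hs hk hf ι
  cases i with
  | zero =>
    obtain ⟨δ, d1, d2⟩ := T1_les0 (A := Q) K h1 h2 h3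
    have h5 : Function.Injective (rT Q K a) := by
      have e : rT Q K a = lT Q Q (ι →₀ Q) (LinearMap.lsmul Q K f) := by
        ext x y; simp [ha, TensorProduct.smul_tmul']
      rw [e]
      apply lT_inj
      rw [injective_iff_map_eq_zero]
      exact hK
    have hz : δ = 0 := by
      ext x
      apply h5
      rw [d2.apply_apply_eq_zero]; simp
    refine subsingleton_of_forall_eq 0 fun x => ?_
    obtain ⟨y, rfl⟩ := (d1 x).1 (by rw [hz]; rfl)
    have : Subsingleton (T1 Q Q (ι →₀ Q) K) := T1_flat _ _
    rw [Subsingleton.elim y 0, map_zero]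
    rfl
  | succ i =>
    obtain ⟨δ, d1, d2⟩ := tor_les (A := Q) K h1 h2 h3 i
    exact sub_of_exact d1 (T1_flat _ _) (T1_flat _ _)

/-- `Q`-semilinear additive equivalences. -/
def SL (Q S : Type u) [CommRing Q] [CommRing S] [Algebra Q S] (X Y : Type u) [AddCommGroup X]
    [Module Q X] [AddCommGroup Y] [Module S Y] : Prop :=
  ∃ e : X ≃+ Y, ∀ (q : Q) (x : X), e (q • x) = algebraMap Q S q • e x

lemma T1_chg0 (K N : Type u) [AddCommGroup K] [Module Q K]
    [AddCommGroup N] [Module S N] [Module Q N] [IsScalarTower Q S N] :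
    ∃ e : N ⊗[Q] K ≃ₗ[S] (S ⊗[Q] K) ⊗[S] N, ∀ x y, e (x ⊗ₜ y) = (1 ⊗ₜ y) ⊗ₜ x := by
  refine ⟨(AlgebraTensorModule.cancelBaseChange Q S S N K).symm.trans
    (TensorProduct.comm S N (S ⊗[Q] K)), fun x y => ?_⟩
  simp

include hs hk hf in
lemma T1_chg (K N : Type u) [AddCommGroup K] [Module Q K] (hK : ∀ x : K, f • x = 0 → x = 0)
    [AddCommGroup N] [Module S N] [Module Q N] [IsScalarTower Q S N] :
    SL Q S (T1 Q Q K N) (T1 S S (S ⊗[Q] K) N) := by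
  letI : Module Q (syz S N) := Module.compHom _ (algebraMap Q S)
  haveI : IsScalarTower Q S (syz S N) := ⟨fun x y z => by
    rw [Algebra.smul_def, mul_smul]; rfl⟩
  obtain ⟨e1⟩ := T1_balance (A := Q) K N
  have hfa : Subsingleton (T1 Q Q (cov S N) K) := free_acyc f hs hk hf _ K hK 0
  obtain ⟨e2⟩ := T1_shift (A := Q) (B := Q) (a := (syzIn S N).restrictScalars Q)
    (b := (covMap S N).restrictScalars Q) K (syzIn_inj S N) (syz_exact S N) (covMap_surj S N)
    hfa
  obtain ⟨e3, h3⟩ := T1_chg0 (Q := Q) (S := S) K (syz S N)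
  obtain ⟨e4, h4⟩ := T1_chg0 (Q := Q) (S := S) K (cov S N)
  have hc : ∀ x, e4 (rT Q K ((syzIn S N).restrictScalars Q) x) =
      lT S S (S ⊗[Q] K) (syzIn S N) (e3 x) := by
    intro x
    induction x with
    | zero => simp
    | tmul x y => simp [h3, h4]
    | add x y hx hy => simp only [map_add, hx, hy]
  let φ : LinearMap.ker (rT Q K ((syzIn S N).restrictScalars Q)) ≃+ T1 S S (S ⊗[Q] K) N :=
    { toFun := fun x => ⟨e3 x.1, by
        rw [LinearMap.mem_ker, ← hc, LinearMap.mem_ker.1 x.2, map_zero]⟩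
      invFun := fun x => ⟨e3.symm x.1, by
        rw [LinearMap.mem_ker]; apply e4.injective
        rw [hc, LinearEquiv.apply_symm_apply, map_zero]
        exact x.2⟩
      left_inv := fun x => by simp
      right_inv := fun x => Subtype.ext (by simp)
      map_add' := fun x y => Subtype.ext (by simp; rfl) }
  refine ⟨(e1.trans e2).toAddEquiv.trans φ, fun q x => ?_⟩
  change φ ((e1.trans e2) (q • x)) = _ • φ ((e1.trans e2) x)
  rw [map_smul]
  generalize (e1.trans e2) x = y
  apply Subtype.ext
  change e3 (q • y.1) = algebraMap Q S q • e3 y.1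
  rw [← map_smul, algebraMap_smul]

include hs hk hf in
lemma tor_chg (K N : Type u) [AddCommGroup K] [Module Q K] (hK : ∀ x : K, f • x = 0 → x = 0)
    [AddCommGroup N] [Module S N] [Module Q N] [IsScalarTower Q S N] (i : ℕ) :
    SL Q S (tor Q Q K N i) (tor S S (S ⊗[Q] K) N i) := by
  induction i generalizing N with
  | zero => exact T1_chg f hs hk hf K N hK
  | succ i ih =>
    letI : Module Q (syz S N) := Module.compHom _ (algebraMap Q S)
    haveI : IsScalarTower Q S (syz S N) := ⟨fun x y z => by
      rw [Algebra.smul_def, mul_smul]; rfl⟩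
    obtain ⟨e1⟩ := tor_balance (A := Q) K N (i+1)
    obtain ⟨e2⟩ := tor_shift (A := Q) (B := Q) (a := (syzIn S N).restrictScalars Q)
      (b := (covMap S N).restrictScalars Q) K (syzIn_inj S N) (syz_exact S N) (covMap_surj S N) i
      (free_acyc f hs hk hf _ K hK i) (free_acyc f hs hk hf _ K hK (i+1))
    obtain ⟨e3⟩ := tor_balance (A := Q) (syz S N) K i
    obtain ⟨e4, h4⟩ := ih (syz S N)
    refine ⟨((e1.trans e2).trans e3).toAddEquiv.trans e4, fun q x => ?_⟩
    change e4 (((e1.trans e2).trans e3) (q • x)) = _ • e4 (((e1.trans e2).trans e3) x)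
    rw [map_smul, h4]
    rfl

include hs hk hf in
lemma chg_T1S (E : Type u) [AddCommGroup E] [Module S E] [Module Q E] [IsScalarTower Q S E] :
    Nonempty (T1 Q S S E ≃ₗ[S] E) := by
  have hkill : ∀ x : E, f • x = 0 := fun x => by
    have : algebraMap Q S f = 0 := by
      rw [← RingHom.mem_ker, hk]; exact Ideal.mem_span_singleton_self f
    rw [← algebraMap_smul S f x, this, zero_smul]
  -- the sequence 0 → Q → Q → S → 0
  have h1 : Function.Injective (LinearMap.lsmul Q Q f) := by
    rw [injective_iff_map_eq_zero]
    intro x hx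
    exact (mul_left_mem_nonZeroDivisors_eq_zero_iff hf).1 hx
  have h2 : Function.Exact (LinearMap.lsmul Q Q f) (Algebra.linearMap Q S) := by
    intro x
    rw [Algebra.linearMap_apply, ← RingHom.mem_ker, hk, Ideal.mem_span_singleton]
    exact ⟨fun ⟨y, hy⟩ => ⟨y, hy.symm⟩, fun ⟨y, hy⟩ => ⟨y, hy.symm⟩⟩
  obtain ⟨e1⟩ := T1_shift (A := Q) (B := Q) E h1 h2 hs (T1_flat _ _)
  have h3 : rT Q E (LinearMap.lsmul Q Q f) = 0 := by
    ext x
    have : f ⊗ₜ[Q] x = 0 := by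
      rw [← mul_one f, ← smul_eq_mul, TensorProduct.smul_tmul, hkill, tmul_zero]
    simp [this]
  rw [h3, LinearMap.ker_zero] at e1
  let e2 : T1 Q Q S E ≃ₗ[Q] E := e1.trans (Submodule.topEquiv.trans (TensorProduct.lid Q E))
  let e3 : T1 Q S S E ≃+ T1 Q Q S E :=
    { toFun := fun x => ⟨x.1, x.2⟩
      invFun := fun x => ⟨x.1, x.2⟩
      left_inv := fun x => rfl
      right_inv := fun x => rfl
      map_add' := fun x y => rfl }
  let e4 := e3.trans e2.toAddEquiv
  refine ⟨{ e4 with map_smul' := ?_ }⟩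
  intro s x
  obtain ⟨q, rfl⟩ := hs s
  change e2 (e3 (algebraMap Q S q • x)) = algebraMap Q S q • e2 (e3 x)
  rw [algebraMap_smul S q (e2 (e3 x)), ← map_smul]
  refine congrArg e2 ?_
  apply Subtype.ext
  change algebraMap Q S q • x.1 = q • x.1
  rw [algebraMap_smul]

include hs in
lemma chg_T0S (E : Type u) [AddCommGroup E] [Module S E] [Module Q E] [IsScalarTower Q S E] :
    Nonempty (S ⊗[Q] E ≃ₗ[S] E) := by
  let g : S ⊗[Q] E →ₗ[S] E := LinearMap.liftBaseChange S LinearMap.id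
  have hg : ∀ y, y = 1 ⊗ₜ (g y) := by
    intro y
    induction y with
    | zero => simp
    | tmul s x =>
      obtain ⟨q, rfl⟩ := hs s
      simp only [g, LinearMap.liftBaseChange_tmul, LinearMap.id_apply, algebraMap_smul]
      rw [← smul_tmul, Algebra.algebraMap_eq_smul_one]
    | add x y hx hy => rw [map_add, tmul_add, ← hx, ← hy]
  refine ⟨LinearEquiv.ofBijective g ⟨fun x y h => ?_, fun x => ⟨1 ⊗ₜ x, ?_⟩⟩⟩
  · rw [hg x, hg y, h]
  · simp [g]

include hs hk hf in
lemma chg_seq (E N : Type u) [AddCommGroup E] [Module S E] [Module Q E] [IsScalarTower Q S E]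
    [AddCommGroup N] [Module S N] [Module Q N] [IsScalarTower Q S N] :
    ∃ (a : ∀ i, tor S S (S ⊗[Q] syz Q E) N i →ₗ[S] tor S S E N (i+1))
      (b : ∀ i, tor S S E N (i+2) →ₗ[S] tor S S E N i)
      (c : ∀ i, tor S S E N i →ₗ[S] tor S S (S ⊗[Q] syz Q E) N i)
      (C : Type u) (_ : AddCommGroup C) (_ : Module S C) (β : tor S S E N 1 →ₗ[S] C),
      (∀ i, Function.Exact (a (i+1)) (b i)) ∧ (∀ i, Function.Exact (b i) (c i)) ∧
      (∀ i, Function.Exact (c i) (a i)) ∧ Function.Exact (a 0) β ∧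
      ∀ i, SL Q S (tor Q Q E N (i+1)) (tor S S (S ⊗[Q] syz Q E) N i) := by
  have hK : ∀ x : syz Q E, f • x = 0 → x = 0 := by
    intro x hx
    apply syzIn_inj Q E
    have h1 : f • syzIn Q E x = 0 := by rw [← map_smul, hx, map_zero]
    rw [map_zero]
    ext i
    have := DFunLike.congr_fun h1 i
    exact (mul_left_mem_nonZeroDivisors_eq_zero_iff hf).1 this
  obtain ⟨eX⟩ := chg_T1S f hs hk hf E
  obtain ⟨eE⟩ := chg_T0S (Q := Q) hs E
  set K := syz Q E with hKdef
  let g : S ⊗[Q] syz Q E →ₗ[S] S ⊗[Q] cov Q E := lT Q S S (syzIn Q E)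
  let j : E →ₗ[S] S ⊗[Q] syz Q E := T1in Q S S E ∘ₗ eX.symm.toLinearMap
  have j1 : Function.Injective j := (T1in_inj Q S S E).comp eX.symm.injective
  obtain ⟨Ω, _, _, gr, ι, j3, p1, hι⟩ : ∃ (Ω : Type u) (_ : AddCommGroup Ω) (_ : Module S Ω)
      (gr : S ⊗[Q] syz Q E →ₗ[S] Ω) (ι : Ω →ₗ[S] S ⊗[Q] cov Q E), Function.Surjective gr ∧
      Function.Injective ι ∧ ∀ x, ι (gr x) = g x :=
    ⟨LinearMap.range g, inferInstance, inferInstance, g.rangeRestrict,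
      (LinearMap.range g).subtype, g.surjective_rangeRestrict, Submodule.injective_subtype _,
      fun _ => rfl⟩
  have j2 : Function.Exact j gr := by
    intro x
    have : gr x = 0 ↔ g x = 0 := by
      rw [← hι, ← map_zero ι, p1.eq_iff]
    rw [this]
    refine (T1_exact Q S S E x).trans ?_
    constructor
    · rintro ⟨y, rfl⟩; exact ⟨eX y, by simp [j]⟩
    · rintro ⟨y, rfl⟩; exact ⟨eX.symm y, by simp [j]⟩
  let p : S ⊗[Q] cov Q E →ₗ[S] E := eE.toLinearMap ∘ₗ lT Q S S (covMap Q E)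
  have p2 : Function.Exact ι p := by
    intro x
    have h := lT_exact (B := S) S (syz_exact Q E) (covMap_surj Q E) x
    have h' : p x = 0 ↔ lT Q S S (covMap Q E) x = 0 := by simp [p]
    rw [h', h]
    constructor
    · rintro ⟨y, rfl⟩; exact ⟨gr y, hι y⟩
    · rintro ⟨y, rfl⟩
      obtain ⟨z, rfl⟩ := j3 y
      exact ⟨z, (hι z).symm⟩
  have p3 : Function.Surjective p := eE.surjective.comp (lT_surj S (covMap_surj Q E))
  have sh : ∀ i, Nonempty (tor S S E N (i+1) ≃ₗ[S] tor S S Ω N i) := fun i =>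
    tor_shift (A := S) N p1 p2 p3 i (T1_flat _ _) (T1_flat _ _)
  have sh' := fun i => (sh i).some
  have lesj := fun i => tor_les (A := S) (B := S) (a := j) (b := gr) N j1 j2 j3 i
  choose δ d1 d2 using lesj
  obtain ⟨δ0, d3, d4⟩ := T1_les0 (A := S) (B := S) (a := j) (b := gr) N j1 j2 j3
  refine ⟨fun i => (sh' i).symm.toLinearMap ∘ₗ torMap S N gr i,
    fun i => δ i ∘ₗ (sh' (i+1)).toLinearMap, fun i => torMap S N j i, E ⊗[S] N, inferInstance,
    inferInstance, δ0 ∘ₗ (sh' 0).toLinearMap, ?_, ?_, ?_, ?_, ?_⟩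
  · intro i x
    refine (d1 i _).trans ?_
    constructor
    · rintro ⟨y, hy⟩; exact ⟨y, by simp [hy]⟩
    · rintro ⟨y, rfl⟩; exact ⟨y, by simp⟩
  · intro i x
    refine (d2 i _).trans ?_
    constructor
    · rintro ⟨y, hy⟩; exact ⟨(sh' (i+1)).symm y, by simp [hy]⟩
    · rintro ⟨y, rfl⟩; exact ⟨sh' (i+1) y, by simp⟩
  · intro i x
    rw [← tor_mid (A := S) (B := S) (a := j) (b := gr) N j1 j2 j3 i x]
    simp
  · intro x
    refine (d3 _).trans ?_
    constructor
    · rintro ⟨y, hy⟩; exact ⟨y, by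
        change (sh' 0).symm (T1map S N gr y) = _
        rw [hy]; exact (sh' 0).symm_apply_apply x⟩
    · rintro ⟨y, rfl⟩; exact ⟨y, ((sh' 0).apply_symm_apply _).symm⟩
  · intro i
    obtain ⟨e1⟩ := tor_shift (A := Q) (B := Q) N (syzIn_inj Q E) (syz_exact Q E)
      (covMap_surj Q E) i (T1_flat _ _) (T1_flat _ _)
    obtain ⟨e2, h2⟩ := tor_chg f hs hk hf (syz Q E) N hK i
    refine ⟨e1.toAddEquiv.trans e2, fun q x => ?_⟩
    change e2 (e1 (q • x)) = _ • e2 (e1 x)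
    rw [map_smul, h2]

end chg

end

section
set_option linter.unusedSectionVars false
set_option linter.style.haveILetI false
open TensorProduct

/-! ## flat base change for tor -/

section bc
variable {A S : Type u} [CommRing A] [CommRing S] [Algebra A S]

lemma bc_seq [Module.Flat A S] {X Y Z : Type u} [AddCommGroup X] [Module A X] [AddCommGroup Y] [Module A Y]
    [AddCommGroup Z] [Module A Z] {a : X →ₗ[A] Y} {b : Y →ₗ[A] Z} (ha : Function.Injective a)
    (hab : Function.Exact a b) (hb : Function.Surjective b) :
    Function.Injective (a.baseChange S) ∧ Function.Exact (a.baseChange S) (b.baseChange S) ∧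
      Function.Surjective (b.baseChange S) :=
  ⟨Module.Flat.lTensor_preserves_injective_linearMap (M := S) a ha, lTensor_exact S hab hb,
    LinearMap.lTensor_surjective S hb⟩

lemma bc_T1 [Module.Flat A S] (M N : Type u) [AddCommGroup M] [Module A M] [AddCommGroup N] [Module A N] :
    Nonempty (T1 S S (S ⊗[A] M) (S ⊗[A] N) ≃ₗ[S] S ⊗[A] T1 A A M N) := by
  obtain ⟨h1, h2, h3⟩ := bc_seq (S := S) (syzIn_inj A M) (syz_exact A M) (covMap_surj A M)
  obtain ⟨e1⟩ := T1_shift (A := S) (B := S) (S ⊗[A] N) h1 h2 h3 (T1_flat _ _)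
  obtain ⟨e2⟩ := T1_shift (A := A) (B := A) N (syzIn_inj A M) (syz_exact A M) (covMap_surj A M)
    (T1_flat _ _)
  have e3 : S ⊗[A] LinearMap.ker (rT A N (syzIn A M)) ≃ₗ[S] S ⊗[A] T1 A A M N :=
    AlgebraTensorModule.congr (LinearEquiv.refl S S) e2.symm
  have e4 : S ⊗[A] LinearMap.ker (rT A N (syzIn A M)) ≃ₗ[S] LinearMap.ker
      (AlgebraTensorModule.lTensor S S (rT A N (syzIn A M))) :=
    LinearMap.tensorKerEquiv S S (rT A N (syzIn A M))
  suffices e5 : LinearMap.ker (rT S (S ⊗[A] N) ((syzIn A M).baseChange S)) ≃ₗ[S] LinearMap.ker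
      (AlgebraTensorModule.lTensor S S (rT A N (syzIn A M))) from
    ⟨(e1.trans e5).trans (e4.symm.trans e3)⟩
  refine LinearEquiv.ofSubmodules (AlgebraTensorModule.distribBaseChange A S (syz A M) N).symm _ _ ?_
  ext x
  rw [Submodule.mem_map_equiv, LinearMap.mem_ker, LinearMap.mem_ker, LinearEquiv.symm_symm,
    ← (AlgebraTensorModule.distribBaseChange A S (cov A M) N).symm.map_eq_zero_iff]
  have : (AlgebraTensorModule.distribBaseChange A S (cov A M) N).symm.toLinearMap ∘ₗ
      (rT S (S ⊗[A] N) ((syzIn A M).baseChange S)) ∘ₗ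
      (AlgebraTensorModule.distribBaseChange A S (syz A M) N).toLinearMap =
      AlgebraTensorModule.lTensor S S (rT A N (syzIn A M)) := by
    ext x y
    refine Eq.trans (AlgebraTensorModule.distribBaseChange_symm_tmul (R := A) (A := S)
      (syzIn A M x) y 1 1) ?_
    rw [mul_one]
    rfl
  exact Eq.congr (congrArg (fun f => f x) this) rfl

lemma bc_tor [Module.Flat A S] (M N : Type u) [AddCommGroup M] [Module A M] [AddCommGroup N] [Module A N] (i : ℕ) :
    Nonempty (tor S S (S ⊗[A] M) (S ⊗[A] N) i ≃ₗ[S] S ⊗[A] tor A A M N i) := by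
  induction i generalizing M with
  | zero => exact bc_T1 M N
  | succ i ih =>
    obtain ⟨h1, h2, h3⟩ := bc_seq (S := S) (syzIn_inj A M) (syz_exact A M) (covMap_surj A M)
    obtain ⟨e1⟩ := tor_shift (A := S) (B := S) (S ⊗[A] N) h1 h2 h3 i (T1_flat _ _) (T1_flat _ _)
    obtain ⟨e2⟩ := tor_shift (A := A) (B := A) N (syzIn_inj A M) (syz_exact A M) (covMap_surj A M) i
      (T1_flat _ _) (T1_flat _ _)
    obtain ⟨e⟩ := ih (syz A M)
    exact ⟨e1.trans (e.trans (AlgebraTensorModule.congr (LinearEquiv.refl S S) e2.symm))⟩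

lemma pdLE_tor (k : ℕ) (E Y : Type u) [AddCommGroup E] [Module A E] [AddCommGroup Y] [Module A Y]
    (h : pdLE A k E) (i : ℕ) (hi : k ≤ i) : Subsingleton (tor A A E Y i) := by
  induction k generalizing E i with
  | zero =>
    have : Module.Projective A E := h
    exact T1_flat _ _
  | succ k ih =>
    obtain ⟨P, _, _, hP, f, hf, hk⟩ := h
    obtain ⟨j, rfl⟩ : ∃ j, i = j + 1 := ⟨i - 1, by omega⟩
    obtain ⟨e⟩ := tor_shift (A := A) (B := A) Y (LinearMap.ker f).injective_subtype
      (LinearMap.exact_subtype_ker_map f) hf j (T1_flat _ _) (T1_flat _ _)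
    have := ih _ hk j (by omega)
    exact e.injective.subsingleton

lemma tor_loc_ann [IsNoetherianRing A] (p : Ideal A) [p.IsPrime] (M N : Type u) [AddCommGroup M] [Module A M]
    [AddCommGroup N] [Module A N] [Module.Finite A M] [Module.Finite A N] (k : ℕ)
    (h : pdLE (Localization.AtPrime p) k (LocalizedModule p.primeCompl M)) (i : ℕ) (hi : k ≤ i) :
    ∃ s : A, s ∉ p ∧ ∀ x : tor A A M N i, s • x = 0 := by
  obtain ⟨e⟩ := bc_tor (A := A) (S := Localization.AtPrime p) M N i
  have h1 := pdLE_tor k _ (Localization.AtPrime p ⊗[A] N) h i hi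
  have e2 : tor (Localization.AtPrime p) (Localization.AtPrime p) (LocalizedModule p.primeCompl M)
    (Localization.AtPrime p ⊗[A] N) i ≃ₗ[Localization.AtPrime p] _ :=
    torCongr (Localization.AtPrime p ⊗[A] N) (LocalizedModule.equivTensorProduct p.primeCompl M) i
  have h2 : Subsingleton (Localization.AtPrime p ⊗[A] tor A A M N i) :=
    (e2.trans e).symm.injective.subsingleton
  have h3 : Subsingleton (LocalizedModule p.primeCompl (tor A A M N i)) :=
    (LocalizedModule.equivTensorProduct p.primeCompl (tor A A M N i)).injective.subsingleton
  have := tor_finite (A := A) (B := A) M N i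
  have h4 : (⟨p, inferInstance⟩ : PrimeSpectrum A) ∉ Module.support A (tor A A M N i) := by
    rw [Module.mem_support_iff, not_nontrivial_iff_subsingleton]; exact h3
  obtain ⟨s, hs, hs'⟩ := exists_ann _ h4
  exact ⟨s, hs, hs'⟩

end bc
end

section
set_option linter.unusedSectionVars false
set_option linter.style.haveILetI false
open TensorProduct

section res
variable {A : Type u} [CommRing A]

lemma tor_res (M : Type u) [AddCommGroup M] [Module A M] (i : ℕ) :
    ∀ (N : Type u) [AddCommGroup N] [Module A N]
    (P : ℕ → Type u) [∀ n, AddCommGroup (P n)] [∀ n, Module A (P n)] [∀ n, Module.Flat A (P n)]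
    (d : ∀ n, P (n+1) →ₗ[A] P n) (ε : P 0 →ₗ[A] N) (_ : Function.Surjective ε)
    (_ : Function.Exact (d 0) ε) (_ : ∀ n, Function.Exact (d (n+1)) (d n)),
    ∃ h : LinearMap.ker (rT A M (d i)) →ₗ[A] tor A A N M i, Function.Surjective h ∧
      ∀ x, h x = 0 ↔ ∃ y, rT A M (d (i+1)) y = (x : P (i+1) ⊗[A] M) := by
  induction i with
  | zero =>
    intro N _ _ P _ _ _ d ε hε h0 hd
    obtain ⟨e⟩ := T1_shift (A := A) (B := A) M (LinearMap.ker ε).injective_subtype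
      (LinearMap.exact_subtype_ker_map ε) hε (T1_flat _ _)
    have hmem : ∀ x, d 0 x ∈ LinearMap.ker ε := fun x => h0.apply_apply_eq_zero x
    let p : P 1 →ₗ[A] LinearMap.ker ε := (d 0).codRestrict _ hmem
    have hp : Function.Surjective p := by
      rintro ⟨x, hx⟩
      obtain ⟨y, hy⟩ := (h0 x).1 hx
      exact ⟨y, Subtype.ext hy⟩
    have hpe : Function.Exact (d 1) p := by
      intro x
      rw [← hd 0 x]
      exact ⟨fun h => congrArg Subtype.val h, fun h => Subtype.ext h⟩
    have hc : rT A M (LinearMap.ker ε).subtype ∘ₗ rT A M p = rT A M (d 0) := by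
      ext; rfl
    let g : LinearMap.ker (rT A M (d 0)) →ₗ[A] LinearMap.ker (rT A M (LinearMap.ker ε).subtype) :=
      (rT A M p).restrict (fun x hx => by
        rw [LinearMap.mem_ker] at hx ⊢
        rw [← hc] at hx; exact hx)
    suffices hh : ∃ h : LinearMap.ker (rT A M (d 0)) →ₗ[A] T1 A A N M, Function.Surjective h ∧
      ∀ x, h x = 0 ↔ ∃ y, rT A M (d 1) y = (x : P 1 ⊗[A] M) from hh
    refine ⟨e.symm.toLinearMap ∘ₗ g, e.symm.surjective.comp ?_, ?_⟩
    · rintro ⟨x, hx⟩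
      obtain ⟨y, hy⟩ := rT_surj (A := A) (N := M) hp x
      refine ⟨⟨y, ?_⟩, Subtype.ext hy⟩
      rw [LinearMap.mem_ker, ← hc, LinearMap.comp_apply, hy]; exact hx
    · rintro ⟨x, hx⟩
      rw [LinearMap.comp_apply, LinearEquiv.coe_coe, LinearEquiv.map_eq_zero_iff]
      refine Iff.trans ?_ (rT_exact (A := A) (N := M) hpe hp x)
      exact ⟨fun h => congrArg Subtype.val h, fun h => Subtype.ext h⟩
  | succ i ih =>
    intro N _ _ P _ _ _ d ε hε h0 hd
    have hmem : ∀ x, d 0 x ∈ LinearMap.ker ε := fun x => h0.apply_apply_eq_zero x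
    let p : P 1 →ₗ[A] LinearMap.ker ε := (d 0).codRestrict _ hmem
    have hp : Function.Surjective p := by
      rintro ⟨x, hx⟩
      obtain ⟨y, hy⟩ := (h0 x).1 hx
      exact ⟨y, Subtype.ext hy⟩
    have hpe : Function.Exact (d 1) p := by
      intro x
      rw [← hd 0 x]
      exact ⟨fun h => congrArg Subtype.val h, fun h => Subtype.ext h⟩
    obtain ⟨e⟩ := tor_shift (A := A) (B := A) M (LinearMap.ker ε).injective_subtype
      (LinearMap.exact_subtype_ker_map ε) hε i (T1_flat _ _) (T1_flat _ _)
    obtain ⟨h, h1, h2⟩ := ih (LinearMap.ker ε) (fun n => P (n+1)) (fun n => d (n+1)) p hp hpe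
      (fun n => hd (n+1))
    refine ⟨e.symm.toLinearMap ∘ₗ h, e.symm.surjective.comp h1, fun x => ?_⟩
    rw [LinearMap.comp_apply, LinearEquiv.coe_coe, LinearEquiv.map_eq_zero_iff]
    exact h2 x

lemma hom_equiv (sc : ShortComplex (ModuleCat.{u} A)) {Y Z H : Type u} [AddCommGroup Y] [Module A Y]
    [AddCommGroup Z] [Module A Z] [AddCommGroup H] [Module A H] {X : Type u} [AddCommGroup X] [Module A X]
    (f : X →ₗ[A] Y) (g : Y →ₗ[A] Z) (e1 : sc.X₁ ≃ₗ[A] X) (e2 : sc.X₂ ≃ₗ[A] Y) (e3 : sc.X₃ ≃ₗ[A] Z)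
    (h12 : ∀ x, f (e1 x) = e2 (sc.f x)) (h23 : ∀ x, g (e2 x) = e3 (sc.g x))
    (h : LinearMap.ker g →ₗ[A] H) (hs : Function.Surjective h)
    (hk : ∀ x, h x = 0 ↔ ∃ y, f y = (x : Y)) : Nonempty (sc.homology ≃ₗ[A] H) := by
  suffices ee : (LinearMap.ker sc.g.hom ⧸ LinearMap.range sc.moduleCatToCycles) ≃ₗ[A] H from
    ⟨sc.moduleCatHomologyIso.toLinearEquiv.trans ee⟩
  let φ : LinearMap.ker sc.g.hom →ₗ[A] LinearMap.ker g :=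
    e2.toLinearMap.restrict (fun x hx => by
      rw [LinearMap.mem_ker] at hx ⊢
      rw [LinearEquiv.coe_coe, h23]
      erw [hx]; exact map_zero _)
  have hφ : Function.Surjective (h ∘ₗ φ) := by
    refine hs.comp ?_
    rintro ⟨y, hy⟩
    refine ⟨⟨e2.symm y, ?_⟩, Subtype.ext (e2.apply_symm_apply y)⟩
    rw [LinearMap.mem_ker]
    apply e3.injective
    rw [map_zero]
    refine (h23 _).symm.trans ?_
    rw [e2.apply_symm_apply]; exact hy
  have hr : LinearMap.range sc.moduleCatToCycles = LinearMap.ker (h ∘ₗ φ) := by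
    ext x
    rw [LinearMap.mem_ker, LinearMap.comp_apply, hk]
    constructor
    · rintro ⟨y, rfl⟩
      exact ⟨e1 y, h12 y⟩
    · rintro ⟨y, hy⟩
      refine ⟨e1.symm y, Subtype.ext (e2.injective ?_)⟩
      refine (h12 _).symm.trans ?_
      rw [e1.apply_symm_apply]; exact hy
  exact (Submodule.quotEquivOfEq _ _ hr).trans ((h ∘ₗ φ).quotKerEquivOfSurjective hφ)

lemma TorM_tor (M N : Type u) [AddCommGroup M] [Module A M] [AddCommGroup N] [Module A N] (i : ℕ) :
    Nonempty (TorM A (i+1) M N ≃ₗ[A] tor A A M N i) := by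
  let P := projectiveResolution (ModuleCat.of A N)
  have hfl : ∀ n, Module.Flat A (P.complex.X n) := fun n => by
    have : Projective (P.complex.X n) := P.projective n
    have : Module.Projective A (P.complex.X n) := (IsProjective.iff_projective (P.complex.X n)).2 this
    infer_instance
  obtain ⟨ε, hε, hε'⟩ : ∃ ε : P.complex.X 0 →ₗ[A] N, Function.Surjective ε ∧
      Function.Exact (P.complex.d 1 0).hom ε :=
    ⟨(P.π.f 0).hom, (ModuleCat.epi_iff_surjective _).1 inferInstance,
      (ShortComplex.ShortExact.moduleCat_exact_iff_function_exact _).1 P.exact₀⟩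
  obtain ⟨h, h1, h2⟩ := tor_res M i N (fun n => P.complex.X n) (fun n => (P.complex.d (n+1) n).hom)
    ε hε hε'
    (fun n => (ShortComplex.ShortExact.moduleCat_exact_iff_function_exact _).1 (P.exact_succ n))
  obtain ⟨eb⟩ := tor_balance (A := A) M N i
  let F := (MonoidalCategory.tensoringLeft (ModuleCat.{u} A)).obj (ModuleCat.of A M)
  let C := (F.mapHomologicalComplex (ComplexShape.down ℕ)).obj P.complex
  have e1 : TorModCat A (i+1) M N ≅ C.homology (i+1) := P.isoLeftDerivedObj F (i+1)
  let sc := C.sc' (i+2) (i+1) i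
  have e2 : C.homology (i+1) ≅ sc.homology := ShortComplex.homologyMapIso (C.isoSc' (i+2) (i+1) i (by simp) (by simp))
  have hc : ∀ n (x : (M ⊗[A] P.complex.X (n+1) : Type u)),
      rT A M (P.complex.d (n+1) n).hom (TensorProduct.comm A M (P.complex.X (n+1)) x) =
      TensorProduct.comm A M (P.complex.X n) ((P.complex.d (n+1) n).hom.lTensor M x) := by
    intro n x
    induction x using TensorProduct.induction_on with
    | zero => simp
    | tmul a b => rfl
    | add a b ha hb => simp only [map_add, ha, hb]
  obtain ⟨e3⟩ := hom_equiv sc (rT A M (P.complex.d (i+2) (i+1)).hom) (rT A M (P.complex.d (i+1) i).hom)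
    (TensorProduct.comm A M (P.complex.X (i+2))) (TensorProduct.comm A M (P.complex.X (i+1)))
    (TensorProduct.comm A M (P.complex.X i)) (hc (i+1)) (hc i) h h1 h2
  exact ⟨((e1 ≪≫ e2).toLinearEquiv.trans e3).trans eb.symm⟩
end res
end

section
set_option linter.unusedSectionVars false
set_option linter.style.haveILetI false
open TensorProduct

section lens
variable {B : Type u} [CommRing B] [IsNoetherianRing B]

/-- the length -/
def lenFn (B : Type u) [CommRing B] : AddFn B where
  f H _ _ := Module.length B H
  zero H _ _ hH := by
    rw [Module.length_eq_zero_iff]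
    infer_instance
  add H1 H2 H3 _ _ _ _ _ _ a b hf ha hab hb := Module.length_eq_add_of_exact a b ha hb hab

lemma addfn_ne_top (l : AddFn B) (q : PrimeSpectrum B) (hq : l.f (B ⧸ q.asIdeal) ≠ ⊤)
    (H : Type u) [AddCommGroup H] [Module B H] [Module.Finite B H]
    (h : ∀ p ∈ Module.support B H, p = q ∨ l.f (B ⧸ p.asIdeal) = 0) : l.f H ≠ ⊤ := by
  revert h
  induction ‹Module.Finite B H› using
    IsNoetherianRing.induction_on_isQuotientEquivQuotientPrime B with
  | subsingleton N => intro h; rw [l.zero _ inferInstance]; simp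
  | quotient N p e =>
    intro h
    rw [l.iso e]
    rcases h p (by
      rw [e.support_eq]
      exact supp_quot p p le_rfl) with rfl | h
    · exact hq
    · rw [h]; simp
  | exact N1 N2 N3 a b ha hb hab h1 h3 =>
    intro h
    rw [l.add N1 N2 N3 a b inferInstance ha hab hb]
    refine WithTop.add_ne_top.2 ⟨h1 fun p hp => h p ?_, h3 fun p hp => h p ?_⟩
    · exact Module.support_subset_of_injective a ha hp
    · exact Module.support_subset_of_surjective b hb hp

lemma lenAt_self (q : PrimeSpectrum B) : (lenAt B q).f (B ⧸ q.asIdeal) ≠ ⊤ := by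
  change Module.length (Localization.AtPrime q.asIdeal)
    (LocalizedModule q.asIdeal.primeCompl (B ⧸ q.asIdeal)) ≠ ⊤
  let φ : Localization.AtPrime q.asIdeal →ₗ[Localization.AtPrime q.asIdeal]
    (LocalizedModule q.asIdeal.primeCompl (B ⧸ q.asIdeal)) :=
    LinearMap.toSpanSingleton _ _ (LocalizedModule.mk (Ideal.Quotient.mk _ 1) 1)
  have hφ : Function.Surjective φ := by
    intro x
    induction x using LocalizedModule.induction_on with | _ m s
    obtain ⟨b, rfl⟩ := Ideal.Quotient.mk_surjective m
    refine ⟨Localization.mk b s, ?_⟩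
    simp only [φ, LinearMap.toSpanSingleton_apply]
    rw [LocalizedModule.mk_smul_mk, mul_one]
    congr 1
    rw [← Ideal.Quotient.mk_eq_mk, ← Ideal.Quotient.mk_eq_mk, ← Submodule.Quotient.mk_smul, smul_eq_mul, mul_one]
  have hk : IsLocalRing.maximalIdeal (Localization.AtPrime q.asIdeal) ≤ LinearMap.ker φ := by
    intro y hy
    rw [← Localization.AtPrime.map_eq_maximalIdeal] at hy
    refine Submodule.span_induction ?_ ?_ ?_ ?_ hy
    · rintro _ ⟨b, hb, rfl⟩
      rw [LinearMap.mem_ker]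
      simp only [φ, LinearMap.toSpanSingleton_apply]
      rw [algebraMap_smul, LocalizedModule.smul'_mk]
      rw [← Ideal.Quotient.mk_eq_mk, ← Submodule.Quotient.mk_smul, smul_eq_mul, mul_one,
        (Submodule.Quotient.mk_eq_zero _).2 hb, LocalizedModule.zero_mk]
    · exact zero_mem _
    · intro x y _ _ hx hy; exact add_mem hx hy
    · intro a x _ hx; exact Submodule.smul_mem _ _ hx
  let ψ := Submodule.liftQ _ φ hk
  have hψ : Function.Surjective ψ := by
    intro x
    obtain ⟨y, rfl⟩ := hφ x
    exact ⟨Submodule.Quotient.mk y, rfl⟩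
  have h1 : IsSimpleModule (Localization.AtPrime q.asIdeal) (Localization.AtPrime q.asIdeal ⧸
      IsLocalRing.maximalIdeal (Localization.AtPrime q.asIdeal)) :=
    isSimpleModule_iff_isCoatom.2 (IsLocalRing.maximalIdeal.isMaximal _).out
  have h2 := Module.length_le_of_surjective ψ hψ
  have h3 := @Module.length_eq_one _ _ _ _ _ h1
  rw [h3] at h2
  exact ne_top_of_le_ne_top (by simp) h2

end lens

section rig
variable {R S B : Type u} [CommRing R] [CommRing S] [CommRing B] [Algebra R S] [Algebra B S]
  [IsNoetherianRing R] [IsNoetherianRing B] [IsLocalRing R] [IsLocalRing S] [Module.Flat R S]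
  [IsLocalHom (algebraMap R S)]

lemma hmin_R (hm : (IsLocalRing.maximalIdeal R).map (algebraMap R S) = IsLocalRing.maximalIdeal S)
    (hB : Function.Surjective (algebraMap B S)) {U X : ℕ → Type u} [∀ i, AddCommGroup (U i)]
    [∀ i, Module S (U i)] [∀ i, Module B (U i)] [∀ i, IsScalarTower B S (U i)]
    [∀ i, AddCommGroup (X i)] [∀ i, Module R (X i)] (hU : ∀ i, Module.Finite B (U i))
    (e : ∀ i, Nonempty (U i ≃ₗ[S] S ⊗[R] X i))
    (hp : ∀ p : Ideal R, p.IsPrime → p ≠ IsLocalRing.maximalIdeal R → ∃ k, ∀ i ≥ k, ∃ s ∉ p,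
      ∀ x : X i, s • x = 0)
    (hl : (∀ i, IsFiniteLength R (X i)) → ∀ n0, ∃ j, n0 ≤ j ∧
      Module.length R (X (j+1)) = Module.length R (X j))
    (q : PrimeSpectrum B) (hq : ∃ i, q ∈ Module.support B (U i))
    (hq' : ∀ i, ∀ q' : PrimeSpectrum B, q' < q → q' ∉ Module.support B (U i)) :
    ∃ l : AddFn B, (∀ i, l.f (U i) ≠ ⊤) ∧ (∀ i, l.f (U i) = 0 → q ∉ Module.support B (U i)) ∧
        ∀ n0, ∃ j, n0 ≤ j ∧ l.f (U (j+1)) = l.f (U j) := by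
  have hker : ∀ q' : PrimeSpectrum B, ∀ i, q' ∈ Module.support B (U i) →
      RingHom.ker (algebraMap B S) ≤ q'.asIdeal := by
    intro q' i h z hz
    by_contra hc
    refine supp_of_smul z q' hc (fun x => ?_) h
    rw [← algebraMap_smul S z x, RingHom.mem_ker.1 hz, zero_smul]
  have hlift : ∀ q' : PrimeSpectrum B, ∀ i, q' ∈ Module.support B (U i) →
      ∃ Q : PrimeSpectrum S, q'.asIdeal = Q.asIdeal.comap (algebraMap B S) := by
    intro q' i h
    have := Ideal.map_isPrime_of_surjective hB (hker q' i h)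
    refine ⟨⟨q'.asIdeal.map (algebraMap B S), this⟩, ?_⟩
    rw [Ideal.comap_map_of_surjective' _ hB, sup_eq_left.2 (hker q' i h)]
  obtain ⟨i0, hi0⟩ := hq
  obtain ⟨Q, hQ⟩ := hlift q i0 hi0
  by_cases hpm : Q.asIdeal.comap (algebraMap R S) = IsLocalRing.maximalIdeal R
  · -- closed point
    have hQm : Q.asIdeal = IsLocalRing.maximalIdeal S := by
      refine le_antisymm (IsLocalRing.le_maximalIdeal Q.2.ne_top) ?_
      rw [← hm, Ideal.map_le_iff_le_comap, hpm]
    have hqmax : q.asIdeal.IsMaximal := by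
      rw [hQ, hQm]
      exact Ideal.comap_isMaximal_of_surjective _ hB
    have hfin : ∀ i, (lenFn B).f (U i) ≠ ⊤ := by
      intro i
      have := hU i
      refine addfn_ne_top (lenFn B) q ?_ (U i) ?_
      · change Module.length B (B ⧸ q.asIdeal) ≠ ⊤
        have h1 : IsSimpleModule B (B ⧸ q.asIdeal) := isSimpleModule_iff_isCoatom.2 hqmax.out
        rw [Module.length_eq_one]; simp
      · intro p hp
        left
        obtain ⟨P, hP⟩ := hlift p i hp
        have hle : p ≤ q := by
          change p.asIdeal ≤ q.asIdeal
          rw [hP, hQ, hQm]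
          exact Ideal.comap_mono (IsLocalRing.le_maximalIdeal P.2.ne_top)
        rcases hle.lt_or_eq with h | h
        · exact (hq' i p h hp).elim
        · exact h
    have hlen : ∀ i, (lenFn B).f (U i) = Module.length R (X i) *
        Module.length S (S ⧸ (IsLocalRing.maximalIdeal R).map (algebraMap R S)) := by
      intro i
      change Module.length B (U i) = _
      obtain ⟨e⟩ := e i
      have h5 := Module.length_eq_of_surjective (M := U i) hB
      rw [h5, e.length_eq,
        IsLocalRing.length_baseChange]
    refine ⟨lenFn B, hfin, ?_, ?_⟩
    · intro i hi
      have hi' : Module.length B (U i) = 0 := hi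
      rw [Module.length_eq_zero_iff] at hi'
      rw [Module.support_eq_empty]; simp
    · intro n0
      obtain ⟨j, hj, hj'⟩ := hl (fun i => by
        rw [← Module.length_ne_top_iff]
        intro htop
        have h1 := hfin i
        rw [hlen, htop, ENat.top_mul] at h1
        · exact h1 rfl
        · rw [hm]
          have : Nontrivial (S ⧸ IsLocalRing.maximalIdeal S) := inferInstance
          exact Module.length_pos.ne') n0
      exact ⟨j, hj, by rw [hlen, hlen, hj']⟩
  · obtain ⟨k, hk⟩ := hp _ inferInstance hpm
    have hz : ∀ i ≥ k, (lenAt B q).f (U i) = 0 := by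
      intro i hi
      obtain ⟨s, hs, hs'⟩ := hk i hi
      obtain ⟨b, hb⟩ := hB (algebraMap R S s)
      have hbq : b ∉ q.asIdeal := by
        rw [hQ, Ideal.mem_comap, hb]; exact hs
      obtain ⟨e⟩ := e i
      have hkill : ∀ x : U i, b • x = 0 := by
        intro x
        rw [← algebraMap_smul S b x, hb]
        apply e.injective
        rw [map_smul, map_zero]
        generalize e x = y
        induction y using TensorProduct.induction_on with
        | zero => simp
        | tmul a b => rw [algebraMap_smul, TensorProduct.smul_tmul', TensorProduct.smul_tmul, hs', TensorProduct.tmul_zero]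
        | add a b ha hb => rw [smul_add, ha, hb, add_zero]
      have := supp_of_smul b q hbq hkill
      change Module.length _ _ = 0
      rw [Module.length_eq_zero_iff]
      rwa [Module.mem_support_iff, not_nontrivial_iff_subsingleton] at this
    refine ⟨lenAt B q, ?_, ?_, ?_⟩
    · intro i
      have := hU i
      refine addfn_ne_top (lenAt B q) q (lenAt_self q) (U i) ?_
      intro p hp
      by_cases h : p ≤ q
      · rcases h.lt_or_eq with h | h
        · exact (hq' i p h hp).elim
        · exact Or.inl h
      · right
        obtain ⟨z, hz, hz'⟩ := SetLike.not_le_iff_exists.1 (show ¬ p.asIdeal ≤ q.asIdeal from h)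
        have := supp_of_smul (H := B ⧸ p.asIdeal) z q hz' (fun x => by
          obtain ⟨y, rfl⟩ := Submodule.Quotient.mk_surjective _ x
          rw [← Submodule.Quotient.mk_smul, Submodule.Quotient.mk_eq_zero]
          exact Ideal.mul_mem_right _ _ hz)
        change Module.length _ _ = 0
        rw [Module.length_eq_zero_iff]
        rwa [Module.mem_support_iff, not_nontrivial_iff_subsingleton] at this
    · intro i hi
      have hi' : Module.length (Localization q.asIdeal.primeCompl)
        (LocalizedModule q.asIdeal.primeCompl (U i)) = 0 := hi
      rw [Module.length_eq_zero_iff] at hi'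
      rw [Module.mem_support_iff, not_nontrivial_iff_subsingleton]
      exact hi'
    · intro n0
      refine ⟨max n0 k, le_max_left _ _, ?_⟩
      rw [hz _ (by omega), hz _ (by omega)]

end rig
end

section
set_option linter.unusedSectionVars false
set_option linter.style.haveILetI false
open TensorProduct

section rig2
variable {R Q S B : Type u} [CommRing R] [CommRing Q] [CommRing S] [CommRing B] [Algebra R S]
  [Algebra Q S] [IsNoetherianRing R] [IsNoetherianRing B] [IsLocalRing R] [IsLocalRing S]
  [Module.Flat R S] [IsLocalHom (algebraMap R S)] [IsNoetherianRing S]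

lemma rigid_core
    (hm : (IsLocalRing.maximalIdeal R).map (algebraMap R S) = IsLocalRing.maximalIdeal S)
    (f : Q) (hs : Function.Surjective (algebraMap Q S))
    (hk : RingHom.ker (algebraMap Q S) = Ideal.span {f}) (hf : f ∈ nonZeroDivisors Q)
    (φ : B →+* Q) (hφ : Function.Surjective φ)
    (E N : Type u) [AddCommGroup E] [Module S E] [Module Q E] [IsScalarTower Q S E]
    [AddCommGroup N] [Module S N] [Module Q N] [IsScalarTower Q S N]
    [Module.Finite S E] [Module.Finite S N] {m : ℕ}
    (hT : @KTower B _ m (fun i => tor Q Q E N i) _ (fun _ => Module.compHom _ φ))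
    {X : ℕ → Type u} [∀ i, AddCommGroup (X i)] [∀ i, Module R (X i)]
    (e : ∀ i, Nonempty (tor S S E N i ≃ₗ[S] S ⊗[R] X i))
    (hp : ∀ p : Ideal R, p.IsPrime → p ≠ IsLocalRing.maximalIdeal R → ∃ k, ∀ i ≥ k, ∃ s ∉ p,
      ∀ x : X i, s • x = 0)
    (hl : (∀ i, IsFiniteLength R (X i)) → ∀ n0, ∃ j, n0 ≤ j ∧
      Module.length R (X (j+1)) = Module.length R (X j))
    (h0 : Subsingleton (X 0)) : ∀ i, Subsingleton (tor S S E N i) := by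
  letI : Algebra B S := ((algebraMap Q S).comp φ).toAlgebra
  have hB : Function.Surjective (algebraMap B S) := hs.comp hφ
  letI mU : ∀ i, Module B (tor S S E N i) := fun i => Module.compHom _ (algebraMap B S)
  haveI tU : ∀ i, IsScalarTower B S (tor S S E N i) := fun i => ⟨fun x y z => by
      rw [Algebra.smul_def, mul_smul]; rfl⟩
  have hU : ∀ i, Module.Finite B (tor S S E N i) := fun i => by
    have h1 : Module.Finite B S := Module.Finite.of_surjective (Algebra.linearMap B S) hB
    have h2 : Module.Finite S (tor S S E N i) := tor_finite E N i
    exact Module.Finite.trans S _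
  obtain ⟨a, b, c, C, _, _, β, E1, E2, E3, E0, hSL⟩ := chg_seq f hs hk hf E N
  choose g hg using hSL
  letI mT : ∀ i, Module B (tor Q Q E N i) := fun i => Module.compHom _ φ
  letI mC : Module B C := Module.compHom _ (algebraMap B S)
  have hgs : ∀ i q y, (g i).symm (algebraMap Q S q • y) = q • (g i).symm y := by
    intro i q y
    rw [AddEquiv.symm_apply_eq, hg, AddEquiv.apply_symm_apply]
  have hbs : ∀ i (b : B) (x : tor S S E N i), b • x = algebraMap Q S (φ b) • x := fun _ _ _ => rfl
  have hbt : ∀ i (b : B) (x : tor Q Q E N i), b • x = φ b • x := fun _ _ _ => rfl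
  let a' : ∀ i, tor Q Q E N (i+1) →ₗ[B] tor S S E N (i+1) := fun i =>
    { toFun := fun x => a i (g i x)
      map_add' := fun x y => by rw [map_add, map_add]
      map_smul' := fun b x => by
        rw [hbt, hg, map_smul]; rfl }
  let b' : ∀ i, tor S S E N (i+2) →ₗ[B] tor S S E N i := fun i =>
    { toFun := fun x => b i x
      map_add' := fun x y => by rw [map_add]
      map_smul' := fun r x => by
        rw [hbs, map_smul]; rfl }
  let c' : ∀ i, tor S S E N i →ₗ[B] tor Q Q E N (i+1) := fun i =>
    { toFun := fun x => (g i).symm (c i x)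
      map_add' := fun x y => by rw [map_add, map_add]
      map_smul' := fun r x => by
        rw [hbs, map_smul, hgs]; rfl }
  let β' : tor S S E N 1 →ₗ[B] C :=
    { toFun := fun x => β x
      map_add' := fun x y => by rw [map_add]
      map_smul' := fun r x => by
        rw [hbs, map_smul]; rfl }
  have ra : ∀ i x, x ∈ Set.range (a i) ↔ x ∈ Set.range (a' i) := by
    intro i x
    constructor
    · rintro ⟨y, rfl⟩; exact ⟨(g i).symm y, by simp [a']⟩
    · rintro ⟨y, rfl⟩; exact ⟨g i y, rfl⟩
  refine dao_vanish (B := B) (T := fun i => tor Q Q E N i) (U := fun i => tor S S E N i) hT hU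
    a' b' c' ?_ ?_ ?_ β' ?_ ?_ ?_
  · intro i x
    exact (E1 i x).trans (ra (i+1) x)
  · intro i x
    have : c' i x = 0 ↔ c i x = 0 := by simp [c']
    rw [this]
    exact E2 i x
  · intro i x
    refine (E3 i (g i x)).trans ?_
    constructor
    · rintro ⟨y, hy⟩; exact ⟨y, by simp [c', hy]⟩
    · rintro ⟨y, hy⟩; exact ⟨y, by rw [← hy]; simp [c']⟩
  · intro x
    exact (E0 x).trans (ra 0 x)
  · obtain ⟨e0⟩ := e 0
    have : Subsingleton (S ⊗[R] X 0) := inferInstance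
    exact e0.toEquiv.subsingleton
  · intro q hq hq'
    exact hmin_R hm hB hU e hp hl q hq hq'
end rig2

section rig3
variable (R : Type u) [CommRing R] [IsNoetherianRing R] [IsLocalRing R]

/-- the standing assumption: completion is a quotient of a power series ring -/
def PSPres (V : Type u) [CommRing V] [IsNoetherianRing V] [IsLocalRing V] (r : ℕ) (LV : List V) (f : MvPowerSeries (Fin r) V)
      (π : MvPowerSeries (Fin r) V →+* AdicCompletion (IsLocalRing.maximalIdeal R) R) : Prop :=
      LV.length ≤ 1 ∧ RS V LV V (IsLocalRing.ResidueField V) ∧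
      f ∈ IsLocalRing.maximalIdeal (MvPowerSeries (Fin r) V) ∧
      f ∈ nonZeroDivisors (MvPowerSeries (Fin r) V) ∧ Function.Surjective π ∧
      RingHom.ker π = Ideal.span {f}

variable {R} {V : Type u} [CommRing V] [IsNoetherianRing V] [IsLocalRing V] {r : ℕ} {LV : List V}
  {f : MvPowerSeries (Fin r) V}
  {π : MvPowerSeries (Fin r) V →+* AdicCompletion (IsLocalRing.maximalIdeal R) R}


lemma rigid_aux (hP : PSPres R V r LV f π)
    (E N : Type u) [AddCommGroup E] [AddCommGroup N]
    [Module (AdicCompletion (IsLocalRing.maximalIdeal R) R) E]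
    [Module (AdicCompletion (IsLocalRing.maximalIdeal R) R) N]
    [Module.Finite (AdicCompletion (IsLocalRing.maximalIdeal R) R) E]
    [Module.Finite (AdicCompletion (IsLocalRing.maximalIdeal R) R) N]
    {X : ℕ → Type u} [∀ i, AddCommGroup (X i)] [∀ i, Module R (X i)]
    (e : ∀ i, Nonempty (tor (AdicCompletion (IsLocalRing.maximalIdeal R) R)
      (AdicCompletion (IsLocalRing.maximalIdeal R) R) E N i
      ≃ₗ[(AdicCompletion (IsLocalRing.maximalIdeal R) R)]
      (AdicCompletion (IsLocalRing.maximalIdeal R) R) ⊗[R] X i))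
    (hp : ∀ p : Ideal R, p.IsPrime → p ≠ IsLocalRing.maximalIdeal R → ∃ k, ∀ i ≥ k, ∃ s ∉ p,
      ∀ x : X i, s • x = 0)
    (hl : (∀ i, IsFiniteLength R (X i)) → ∀ n0, ∃ j, n0 ≤ j ∧
      Module.length R (X (j+1)) = Module.length R (X j))
    (h0 : Subsingleton (X 0)) : ∀ i, Subsingleton (tor (AdicCompletion (IsLocalRing.maximalIdeal R) R)
      (AdicCompletion (IsLocalRing.maximalIdeal R) R) E N i) := by
  obtain ⟨hlen, hLV, hfm, hf, hs, hk⟩ := hP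
  letI : Algebra (MvPowerSeries (Fin r) V) (AdicCompletion (IsLocalRing.maximalIdeal R) R) :=
    π.toAlgebra
  have hs' : Function.Surjective (algebraMap (MvPowerSeries (Fin r) V)
    (AdicCompletion (IsLocalRing.maximalIdeal R) R)) := hs
  haveI : IsNoetherianRing (AdicCompletion (IsLocalRing.maximalIdeal R) R) :=
    isNoetherianRing_of_surjective _ _ π hs
  haveI : Module.Flat R (AdicCompletion (IsLocalRing.maximalIdeal R) R) :=
    AdicCompletion.flat_of_isNoetherian _
  have hm := (AdicCompletion.maximalIdeal_eq_map (R := R)).symm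
  letI : Module (MvPowerSeries (Fin r) V) E := Module.compHom _ π
  letI : Module (MvPowerSeries (Fin r) V) N := Module.compHom _ π
  haveI : IsScalarTower (MvPowerSeries (Fin r) V) (AdicCompletion (IsLocalRing.maximalIdeal R) R) E :=
    ⟨fun x y z => by rw [Algebra.smul_def, mul_smul]; rfl⟩
  haveI : IsScalarTower (MvPowerSeries (Fin r) V) (AdicCompletion (IsLocalRing.maximalIdeal R) R) N :=
    ⟨fun x y z => by rw [Algebra.smul_def, mul_smul]; rfl⟩
  have hfS : Module.Finite (MvPowerSeries (Fin r) V) (AdicCompletion (IsLocalRing.maximalIdeal R) R) :=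
    Module.Finite.of_surjective (Algebra.linearMap _ _) hs
  haveI : Module.Finite (MvPowerSeries (Fin r) V) E :=
    Module.Finite.trans (AdicCompletion (IsLocalRing.maximalIdeal R) R) _
  haveI : Module.Finite (MvPowerSeries (Fin r) V) N :=
    Module.Finite.trans (AdicCompletion (IsLocalRing.maximalIdeal R) R) _
  obtain ⟨m, hT⟩ := kosz_tower V r LV hLV hlen E N
  exact rigid_core hm f hs' hk hf (kφ V r).toRingHom (fun x => ⟨ky V r x, kφ_ky V r x⟩) E N hT e hp
    hl h0

/-- rigidity: Tor₁ vanishing gives vanishing of all Tor. -/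
theorem rigid_R (hP : PSPres R V r LV f π) (M : Type u) [AddCommGroup M] [Module R M] [Module.Finite R M]
    (hpd : ∀ (p : Ideal R) (hp : p.IsPrime), p ≠ IsLocalRing.maximalIdeal R →
      ∃ k : ℕ, pdLE (Localization.AtPrime p) k (LocalizedModule p.primeCompl M))
    (N : Type u) [AddCommGroup N] [Module R N] [Module.Finite R N]
    (hθ : (∃ n0 : ℕ, ∀ i ≥ n0, IsFiniteLength R (TorM R i M N)) →
      ∃ n0 : ℕ, ∀ n ≥ n0, mlen R (TorM R (2 * n) M N) = mlen R (TorM R (2 * n - 1) M N))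
    (h0 : Subsingleton (tor R R M N 0)) (i : ℕ) : Subsingleton (tor R R M N i) := by
  haveI : Module.Flat R (AdicCompletion (IsLocalRing.maximalIdeal R) R) :=
    AdicCompletion.flat_of_isNoetherian _
  have hbc := bc_tor (A := R) (S := AdicCompletion (IsLocalRing.maximalIdeal R) R) M N
  have f1 : Module.Finite (AdicCompletion (IsLocalRing.maximalIdeal R) R)
    ((AdicCompletion (IsLocalRing.maximalIdeal R) R) ⊗[R] M) := inferInstance
  have f2 : Module.Finite (AdicCompletion (IsLocalRing.maximalIdeal R) R)
    ((AdicCompletion (IsLocalRing.maximalIdeal R) R) ⊗[R] N) := inferInstance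
  suffices h : Subsingleton (tor (AdicCompletion (IsLocalRing.maximalIdeal R) R)
      (AdicCompletion (IsLocalRing.maximalIdeal R) R)
      ((AdicCompletion (IsLocalRing.maximalIdeal R) R) ⊗[R] M)
      ((AdicCompletion (IsLocalRing.maximalIdeal R) R) ⊗[R] N) i) by
    obtain ⟨e⟩ := hbc i
    have : Subsingleton ((AdicCompletion (IsLocalRing.maximalIdeal R) R) ⊗[R] tor R R M N i) :=
      e.symm.toEquiv.subsingleton
    have hff : Module.FaithfullyFlat R (AdicCompletion (IsLocalRing.maximalIdeal R) R) :=
      Module.FaithfullyFlat.of_flat_of_isLocalHom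
    exact (Module.FaithfullyFlat.subsingleton_tensorProduct_iff_right R
      (AdicCompletion (IsLocalRing.maximalIdeal R) R)).1 this
  refine rigid_aux hP _ _ hbc ?_ ?_ h0 i
  · intro p hp hpm
    obtain ⟨k, hk⟩ := hpd p hp hpm
    exact ⟨k, fun i hi => tor_loc_ann p M N k hk i hi⟩
  · intro hfl n0
    obtain ⟨n1, h1⟩ := hθ ⟨1, fun i hi => by
      obtain ⟨j, rfl⟩ : ∃ j, i = j + 1 := ⟨i - 1, by omega⟩
      obtain ⟨e⟩ := TorM_tor (A := R) M N j
      have := hfl j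
      rw [← Module.length_ne_top_iff] at this ⊢
      rwa [e.length_eq]⟩
    have h2 := h1 (max n0 n1 + 1) (by omega)
    refine ⟨2 * max n0 n1, by omega, ?_⟩
    rw [show 2 * (max n0 n1 + 1) = (2 * max n0 n1 + 1) + 1 by ring,
      show 2 * max n0 n1 + 1 + 1 - 1 = 2 * max n0 n1 + 1 by omega] at h2
    obtain ⟨e1⟩ := TorM_tor (A := R) M N (2 * max n0 n1 + 1)
    obtain ⟨e2⟩ := TorM_tor (A := R) M N (2 * max n0 n1)
    rw [mlen, mlen, ← Module.coe_length, ← Module.coe_length, WithBot.coe_inj] at h2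
    rw [← e1.length_eq, ← e2.length_eq, h2]
end rig3
end

section
set_option linter.unusedSectionVars false
set_option linter.style.haveILetI false
open TensorProduct

/-! ## minimal covers and Betti numbers -/
section minc
variable (A : Type u) [CommRing A] [IsNoetherianRing A] [IsLocalRing A]

lemma min_inj (N : Type u) [AddCommGroup N] [Module A N] [Module.Finite A N] :
    Function.Injective (lT A A (IsLocalRing.ResidueField A) (covMap A N)) := by
  have hs : Function.Surjective (lT A (IsLocalRing.ResidueField A) (IsLocalRing.ResidueField A) (covMap A N)) :=
    lT_surj _ (covMap_surj A N)
  have := covI_finite A N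
  have := Fintype.ofFinite (covI A N)
  have hd : Module.finrank (IsLocalRing.ResidueField A) ((IsLocalRing.ResidueField A) ⊗[A] cov A N) =
    Module.finrank (IsLocalRing.ResidueField A) ((IsLocalRing.ResidueField A) ⊗[A] N) := by
    rw [Module.finrank_baseChange, Module.finrank_finsupp_self, ← Nat.card_eq_fintype_card, covI_card,
      ← TensorProduct.spanFinrank_top_eq_of_residueField _ (Module.Finite.fg_top),
      ← Module.finrank_eq_spanFinrank_of_free]
    exact (LinearEquiv.baseChange A (IsLocalRing.ResidueField A) _ _ (Submodule.topEquiv)).finrank_eq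
  exact (LinearMap.injective_iff_surjective_of_finrank_eq_finrank hd).2 hs

lemma minc_zero (N : Type u) [AddCommGroup N] [Module A N] [Module.Finite A N] (x) :
    lT A A (IsLocalRing.ResidueField A) (syzIn A N) x = 0 := by
  apply min_inj A N
  rw [(lT_exact _ (syz_exact A N) (covMap_surj A N)).apply_apply_eq_zero, map_zero]

lemma min_mem (N : Type u) [AddCommGroup N] [Module A N] [Module.Finite A N] (x : syz A N)
    (i : covI A N) : syzIn A N x i ∈ IsLocalRing.maximalIdeal A := by
  have h := minc_zero A N (1 ⊗ₜ x)
  have h2 := congrArg (TensorProduct.rid A (IsLocalRing.ResidueField A) ∘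
    (LinearMap.lTensor (IsLocalRing.ResidueField A) (Finsupp.lapply (M := A) (R := A) i))) h
  simp only [Function.comp, AlgebraTensorModule.lTensor_tmul, LinearMap.lTensor_tmul, map_zero,
    TensorProduct.rid_tmul, Finsupp.lapply_apply] at h2
  rw [← IsLocalRing.residue_eq_zero_iff]
  rw [Algebra.smul_def, mul_one] at h2
  exact h2

lemma T1k (N : Type u) [AddCommGroup N] [Module A N] [Module.Finite A N] :
    Nonempty (T1 A A N (IsLocalRing.ResidueField A) ≃ₗ[A] (IsLocalRing.ResidueField A) ⊗[A] syz A N) := by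
  obtain ⟨e⟩ := T1_balance (A := A) N (IsLocalRing.ResidueField A)
  have e2 : T1 A A (IsLocalRing.ResidueField A) N ≃ₗ[A] (IsLocalRing.ResidueField A) ⊗[A] syz A N :=
    LinearEquiv.ofBijective (T1in A A _ N) ⟨T1in_inj _ _ _ _, fun x =>
      (T1_exact A A (IsLocalRing.ResidueField A) N x).1 (minc_zero A N x)⟩
  exact ⟨e.trans e2⟩

/-- Betti numbers -/
def bet (j : ℕ) (N : Type u) [AddCommGroup N] [Module A N] : ℕ∞ :=
  Module.length A ((IsLocalRing.ResidueField A) ⊗[A] Om A j (ModuleCat.of A N))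

lemma tork (N : Type u) [AddCommGroup N] [Module A N] [Module.Finite A N] (j : ℕ) :
    Nonempty (tor A A N (IsLocalRing.ResidueField A) j ≃ₗ[A]
      (IsLocalRing.ResidueField A) ⊗[A] Om A (j+1) (ModuleCat.of A N)) := by
  obtain ⟨e⟩ := tor_balance (A := A) N (IsLocalRing.ResidueField A) j
  have : Module.Finite A (ModuleCat.of A N) := ‹Module.Finite A N›
  have := Om_finite A j (ModuleCat.of A N)
  obtain ⟨e2⟩ := T1_balance (A := A) (Om A j (ModuleCat.of A N)) (IsLocalRing.ResidueField A)
  obtain ⟨e3⟩ := T1k A (Om A j (ModuleCat.of A N))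
  rw [Om_succ]
  exact ⟨e.trans (e2.symm.trans e3)⟩

lemma bet_succ (N : Type u) [AddCommGroup N] [Module A N] [Module.Finite A N] (j : ℕ) :
    bet A (j+1) N = Module.length A (tor A A N (IsLocalRing.ResidueField A) j) := by
  obtain ⟨e⟩ := tork A N j
  exact e.length_eq.symm

lemma bet_zero (N : Type u) [AddCommGroup N] [Module A N] :
    bet A 0 N = Module.length A (N ⊗[A] (IsLocalRing.ResidueField A)) := 
  (TensorProduct.comm A _ _).length_eq

lemma k_len (N : Type u) [AddCommGroup N] [Module A N] [Module.Finite A N] :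
   Module.length A ((IsLocalRing.ResidueField A) ⊗[A] N) =
     Module.finrank (IsLocalRing.ResidueField A) ((IsLocalRing.ResidueField A) ⊗[A] N) := by
  rw [Module.length_eq_of_surjective (R := IsLocalRing.ResidueField A) (S := A)
    (M := (IsLocalRing.ResidueField A) ⊗[A] N) IsLocalRing.residue_surjective]
  exact Module.length_eq_finrank _ _

lemma bet_ne_top (N : Type u) [AddCommGroup N] [Module A N] [Module.Finite A N] (j : ℕ) :
    bet A j N ≠ ⊤ := by
  have : Module.Finite A (ModuleCat.of A N) := ‹Module.Finite A N›
  have := Om_finite A j (ModuleCat.of A N)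
  rw [bet, k_len]
  simp

lemma k_tens_zero (N : Type u) [AddCommGroup N] [Module A N] [Module.Finite A N]
    (h : Subsingleton ((IsLocalRing.ResidueField A) ⊗[A] N)) : Subsingleton N :=
  (IsLocalRing.subsingleton_tensorProduct ).1 h

lemma bet_eq_zero (N : Type u) [AddCommGroup N] [Module A N] [Module.Finite A N] (j : ℕ) :
    bet A j N = 0 ↔ Subsingleton (Om A j (ModuleCat.of A N)) := by
  have : Module.Finite A (ModuleCat.of A N) := ‹Module.Finite A N›
  have := Om_finite A j (ModuleCat.of A N)
  rw [bet, Module.length_eq_zero_iff]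
  exact ⟨fun h => k_tens_zero A _ h, fun h => inferInstance⟩

end minc
end

section
set_option linter.unusedSectionVars false
set_option linter.style.haveILetI false
open TensorProduct

/-! ## generic freeness -/
section gf
variable (A : Type u) [CommRing A] [IsNoetherianRing A] [IsLocalRing A]

lemma free_of_syz (X : Type u) [AddCommGroup X] [Module A X] (h : Subsingleton (syz A X)) :
    Module.Free A X := by
  have hi : Function.Injective (covMap A X) := by
    rw [injective_iff_map_eq_zero]
    intro x hx
    obtain ⟨y, rfl⟩ := (syz_exact A X x).1 hx
    rw [Subsingleton.elim y 0, map_zero]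
  exact Module.Free.of_equiv (LinearEquiv.ofBijective (covMap A X) ⟨hi, covMap_surj A X⟩)

lemma free_of_Om (w : A) (hw : w ≠ 0) (hm : ∀ a ∈ IsLocalRing.maximalIdeal A, a * w = 0) (j : ℕ)
    (X : Type u) [AddCommGroup X] [Module A X] [Module.Finite A X]
    (h : Subsingleton (Om A j (ModuleCat.of A X))) : Module.Free A X := by
  induction j generalizing X with
  | zero =>
    have : Subsingleton X := h
    infer_instance
  | succ j ih =>
    have hf := ih (syz A X) h
    apply free_of_syz
    have hz : ∀ x : syz A X, w • x = 0 := by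
      intro x
      apply syzIn_inj
      rw [map_smul, map_zero]
      ext i
      rw [Finsupp.smul_apply, smul_eq_mul, mul_comm, hm _ (min_mem A X x i), Finsupp.zero_apply]
    refine subsingleton_of_forall_eq 0 fun x => ?_
    let b := Module.Free.chooseBasis A (syz A X)
    by_contra hne
    obtain ⟨i⟩ : Nonempty (Module.Free.ChooseBasisIndex A (syz A X)) := by
      by_contra he
      rw [not_nonempty_iff] at he
      exact hne (b.repr.injective (Subsingleton.elim _ _))
    have := congrArg (fun z => b.repr z i) (hz (b i))
    simp at this
    exact hw this

lemma free_of_pd (w : A) (hw : w ≠ 0) (hm : ∀ a ∈ IsLocalRing.maximalIdeal A, a * w = 0) (k : ℕ)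
    (X : Type u) [AddCommGroup X] [Module A X] [Module.Finite A X]
    (h : pdLE A k X) : Module.Free A X := by
  apply free_of_Om A w hw hm (k+1)
  have h1 := pdLE_tor k X (IsLocalRing.ResidueField A) h k le_rfl
  obtain ⟨e⟩ := tork A X k
  have : Module.Finite A (ModuleCat.of A X) := ‹Module.Finite A X›
  have := Om_finite A (k+1) (ModuleCat.of A X)
  exact k_tens_zero A _ e.symm.toEquiv.subsingleton

end gf

section gf2
variable {R : Type u} [CommRing R] [IsNoetherianRing R]

lemma proj_at_ass (p : Ideal R) (hp : p.IsPrime) (hpa : p ∈ associatedPrimes R R) 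
    (M : Type u) [AddCommGroup M] [Module R M] [Module.Finite R M] (k : ℕ) 
    (h : pdLE (Localization.AtPrime p) k (LocalizedModule p.primeCompl M)) :
    Module.Projective (Localization.AtPrime p) (LocalizedModule p.primeCompl M) := by
  obtain ⟨x, hx⟩ := ass_elt (H := R) ⟨p, hp⟩ hpa
  simp only [smul_eq_mul] at hx
  have : IsNoetherianRing (Localization.AtPrime p) := IsLocalization.isNoetherianRing p.primeCompl _ ‹_›
  have := free_of_pd (Localization.AtPrime p) (algebraMap R _ x) (by
    rw [Ne, IsLocalization.map_eq_zero_iff p.primeCompl]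
    rintro ⟨⟨m, hm⟩, h⟩
    exact hm ((hx m).1 h)) (by
    intro a ha
    obtain ⟨b, s, rfl⟩ := IsLocalization.exists_mk'_eq p.primeCompl a
    rw [IsLocalization.AtPrime.mk'_mem_maximal_iff (Localization.AtPrime p) p] at ha
    rw [mul_comm, IsLocalization.mul_mk'_eq_mk'_of_mul, mul_comm, (hx b).2 ha, IsLocalization.mk'_zero]) k _ h
  infer_instance

lemma loc_split_aux (p : Ideal R) (hp : p.IsPrime) (M : Type u) [AddCommGroup M] [Module R M] [Module.Finite R M]
    (M' F' : Type u) [AddCommGroup M'] [AddCommGroup F'] [Module R M'] [Module R F']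
    [Module (Localization.AtPrime p) M'] [Module (Localization.AtPrime p) F']
    [IsScalarTower R (Localization.AtPrime p) M'] [IsScalarTower R (Localization.AtPrime p) F']
    (mM : M →ₗ[R] M') (mF : cov R M →ₗ[R] F') [IsLocalizedModule p.primeCompl mM]
    [IsLocalizedModule p.primeCompl mF]
    (h : Module.Projective (Localization.AtPrime p) M') :
    ∃ s : R, s ∉ p ∧ ∃ γ : M →ₗ[R] cov R M, covMap R M ∘ₗ γ = s • LinearMap.id := by
  let S := p.primeCompl
  let c := IsLocalizedModule.mapExtendScalars S mF mM (Localization.AtPrime p) (covMap R M)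
  have hc : Function.Surjective c := IsLocalizedModule.map_surjective S mF mM _ (covMap_surj R M)
  obtain ⟨σ, hσ⟩ := Module.projective_lifting_property c LinearMap.id hc
  have : Module.FinitePresentation R M := Module.finitePresentation_of_finite R M
  have hγ' : ∃ (γ : M →ₗ[R] cov R M) (s : S), mF ∘ₗ γ = s • ((σ.restrictScalars R) ∘ₗ mM) :=
    Module.FinitePresentation.exists_lift_of_isLocalizedModule S mF _
  obtain ⟨γ, s, hγ⟩ := hγ'
  have h2 : mM ∘ₗ (covMap R M ∘ₗ γ) = mM ∘ₗ (s • LinearMap.id) := by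
    ext x
    have h3 := congrArg c (LinearMap.congr_fun hγ x)
    have h4 : ∀ y, c (σ y) = y := fun y => LinearMap.congr_fun hσ y
    have h5 : ∀ y, c (mF y) = mM (covMap R M y) := fun y => IsLocalizedModule.map_apply S mF mM _ y
    simp only [LinearMap.comp_apply, LinearMap.smul_apply, LinearMap.restrictScalars_apply, h5] at h3
    have h6 : c (s • σ (mM x)) = s • c (σ (mM x)) := map_smul (c.restrictScalars R) (s:R) _
    rw [h6, h4] at h3
    simp only [LinearMap.comp_apply, LinearMap.smul_apply, h3, LinearMap.id_apply]
    exact (map_smul mM (s : R) x).symm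
  obtain ⟨t, ht⟩ := Module.Finite.exists_smul_of_comp_eq_of_isLocalizedModule S mM _ _ h2
  refine ⟨t * s, (t * s).2, t.1 • γ, ?_⟩
  ext x
  have := LinearMap.congr_fun ht x
  simp only [LinearMap.comp_apply, LinearMap.smul_apply, map_smul, mul_smul] at this ⊢
  exact this

lemma loc_split (p : Ideal R) (hp : p.IsPrime) (M : Type u) [AddCommGroup M] [Module R M] [Module.Finite R M]
    (h : Module.Projective (Localization.AtPrime p) (LocalizedModule p.primeCompl M)) :
    ∃ s : R, s ∉ p ∧ ∃ γ : M →ₗ[R] cov R M, covMap R M ∘ₗ γ = s • LinearMap.id :=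
  loc_split_aux p hp M (LocalizedModule p.primeCompl M) (LocalizedModule p.primeCompl (cov R M))
    (LocalizedModule.mkLinearMap p.primeCompl M) (LocalizedModule.mkLinearMap p.primeCompl (cov R M)) h

/-- generic splitting of a cover -/
def WF (R : Type u) [CommRing R] (N : Type u) [AddCommGroup N] [Module R N] : Prop := 
  ∃ s ∈ nonZeroDivisors R, ∃ (F : Type u) (_ : AddCommGroup F) (_ : Module R F), 
    Module.Free R F ∧ Module.Finite R F ∧ ∃ (α : N →ₗ[R] F) (β : F →ₗ[R] N), β ∘ₗ α = s • LinearMap.id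

lemma WF_of_ass (M : Type u) [AddCommGroup M] [Module R M] [Module.Finite R M]
    (h : ∀ (p : Ideal R) (hp : p.IsPrime), p ∈ associatedPrimes R R → ∃ k, 
      pdLE (Localization.AtPrime p) k (LocalizedModule p.primeCompl M)) : WF R M := by
  let I : Ideal R := (LinearMap.range (LinearMap.compRight R (M := M) (covMap R M))).comap 
    (LinearMap.toSpanSingleton R (M →ₗ[R] M) LinearMap.id)
  have hI : ∀ s, s ∈ I ↔ ∃ γ : M →ₗ[R] cov R M, covMap R M ∘ₗ γ = s • LinearMap.id := fun s => Iff.rfl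
  have h1 : ∃ s ∈ I, s ∈ nonZeroDivisors R := by
    by_contra! h2
    have h3 : (I : Set R) ⊆ ⋃ p ∈ associatedPrimes R R, p := by
      intro s hs
      rw [biUnion_associatedPrimes_eq_compl_nonZeroDivisors]
      exact h2 s hs
    replace h3 := (I.subset_union_prime_finite (associatedPrimes.finite R R) (f := id) 0 0 fun p hp _ _ => hp.isPrime).1 h3
    obtain ⟨p, hp, hIp⟩ := h3
    have hpp := IsAssociatedPrime.isPrime hp
    obtain ⟨k, hk⟩ := h p hpp hp
    obtain ⟨s, hs, hs2⟩ := loc_split p hpp M (proj_at_ass p hpp hp M k hk)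
    exact hs (hIp ((hI s).2 hs2))
  obtain ⟨s, hs, hs2⟩ := h1
  obtain ⟨γ, hγ⟩ := (hI s).1 hs
  exact ⟨s, hs2, cov R M, inferInstance, inferInstance, inferInstance, inferInstance, γ, covMap R M, hγ⟩

lemma WF_tens (M N : Type u) [AddCommGroup M] [Module R M] [AddCommGroup N] [Module R N]
    (h : WF R M) (h' : WF R N) : WF R (M ⊗[R] N) := by
  obtain ⟨s, hs, F, _, _, _, _, α, β, hb⟩ := h
  obtain ⟨s', hs', F', _, _, _, _, α', β', hb'⟩ := h'
  refine ⟨s * s', mul_mem hs hs', F ⊗[R] F', inferInstance, inferInstance, inferInstance, inferInstance, 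
    TensorProduct.map α α', TensorProduct.map β β', ?_⟩
  rw [← TensorProduct.map_comp, hb, hb', TensorProduct.map_smul_left, TensorProduct.map_smul_right, 
    TensorProduct.map_id, smul_smul]

lemma WF_congr (M N : Type u) [AddCommGroup M] [Module R M] [AddCommGroup N] [Module R N]
    (h : WF R M) (e : M ≃ₗ[R] N) : WF R N := by
  obtain ⟨s, hs, F, _, _, _, _, α, β, hb⟩ := h
  refine ⟨s, hs, F, inferInstance, inferInstance, inferInstance, inferInstance, 
    α ∘ₗ e.symm.toLinearMap, e.toLinearMap ∘ₗ β, ?_⟩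
  ext x
  have := LinearMap.congr_fun hb (e.symm x)
  simp only [LinearMap.comp_apply, LinearMap.smul_apply, LinearMap.id_apply] at this
  simp [this]

end gf2
end

section
set_option linter.unusedSectionVars false
set_option linter.style.haveILetI false
open TensorProduct

section tf
variable {R : Type u} [CommRing R]

lemma TF_iff (X : Type u) [AddCommGroup X] [Module R X] : Submodule.torsion R X = ⊥ ↔
    ∀ s ∈ nonZeroDivisors R, ∀ x : X, s • x = 0 → x = 0 := by
  rw [eq_bot_iff]
  constructor
  · intro h s hs x hx
    exact h ((Submodule.mem_torsion_iff x).2 ⟨⟨s, hs⟩, hx⟩)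
  · intro h x hx
    obtain ⟨⟨s, hs⟩, hx⟩ := (Submodule.mem_torsion_iff x).1 hx
    exact h s hs x hx

lemma TF_congr {X Y : Type u} [AddCommGroup X] [Module R X] [AddCommGroup Y] [Module R Y] (e : X ≃ₗ[R] Y)
    (h : Submodule.torsion R X = ⊥) : Submodule.torsion R Y = ⊥ := by
  rw [TF_iff] at h ⊢
  intro s hs y hy
  have := h s hs (e.symm y) (by rw [← map_smul, hy, map_zero])
  simpa using this

lemma TF_free (X : Type u) [AddCommGroup X] [Module R X] [Module.Free R X] : 
    Submodule.torsion R X = ⊥ := by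
  rw [TF_iff]
  intro s hs x hx
  let b := Module.Free.chooseBasis R X
  apply b.repr.injective
  ext i
  have := congrArg (fun z => b.repr z i) hx
  simp only [map_smul, Finsupp.smul_apply, smul_eq_mul, map_zero, Finsupp.zero_apply] at this ⊢
  exact (mem_nonZeroDivisors_iff.1 hs).1 _ this

lemma tens_zero [IsNoetherianRing R] [IsLocalRing R] (M N : Type u) [AddCommGroup M] [Module R M] 
    [AddCommGroup N] [Module R N] [Module.Finite R M] [Module.Finite R N] 
    (h : Subsingleton (N ⊗[R] M)) (hM : Nontrivial M) : Subsingleton N := by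
  apply k_tens_zero R
  have h1 : Nontrivial ((IsLocalRing.ResidueField R) ⊗[R] M) := by
    by_contra h
    rw [not_nontrivial_iff_subsingleton] at h
    have := k_tens_zero R _ h
    exact not_subsingleton M this
  have e := AlgebraTensorModule.distribBaseChange R (IsLocalRing.ResidueField R) N M
  have h2 : Subsingleton ((IsLocalRing.ResidueField R ⊗[R] N) ⊗[IsLocalRing.ResidueField R] 
    (IsLocalRing.ResidueField R ⊗[R] M)) := e.symm.toEquiv.subsingleton
  exact (Module.FaithfullyFlat.subsingleton_tensorProduct_iff_left _ _).1 h2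

end tf

section F
variable {R : Type u} [CommRing R] [IsNoetherianRing R] [IsLocalRing R]
variable {V : Type u} [CommRing V] [IsNoetherianRing V] [IsLocalRing V] {r : ℕ} {LV : List V}
  {f : MvPowerSeries (Fin r) V}
  {π : MvPowerSeries (Fin r) V →+* AdicCompletion (IsLocalRing.maximalIdeal R) R}

/-- key torsion argument -/
theorem tf_step (M : Type u) [AddCommGroup M] [Module R M] [Module.Finite R M] [Nontrivial M]
    (hrig : ∀ (C : Type u) [AddCommGroup C] [Module R C] [Module.Finite R C],
      Subsingleton (tor R R M C 0) → ∀ i, Subsingleton (tor R R M C i))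
    (N : Type u) [AddCommGroup N] [Module R N] [Module.Finite R N] (hW : WF R N)
    (htf : Submodule.torsion R (N ⊗[R] M) = ⊥) : 
    Submodule.torsion R N = ⊥ ∧ ∀ i, Subsingleton (tor R R M N i) := by
  obtain ⟨s, hs, F, _, _, hF1, hF2, α, β, hb⟩ := hW
  have hFt := (TF_iff (R := R) F).1 (TF_free F)
  let T := Submodule.torsion R N
  let N' := N ⧸ T
  have hN't : ∀ s ∈ nonZeroDivisors R, ∀ x : N', s • x = 0 → x = 0 := 
    (TF_iff (R := R) (N ⧸ T)).1 (Submodule.QuotientTorsion.torsion_eq_bot)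
  have htf' := (TF_iff (R := R) _).1 htf
  let α' : N' →ₗ[R] F := T.liftQ α (by
    intro x hx
    obtain ⟨⟨a, ha⟩, hx⟩ := (Submodule.mem_torsion_iff x).1 hx
    have hx : a • x = 0 := hx
    exact hFt a ha (α x) (by rw [← map_smul, hx, map_zero]))
  let β' : F →ₗ[R] N' := T.mkQ ∘ₗ β
  have hb' : β' ∘ₗ α' = s • LinearMap.id := by
    apply Submodule.linearMap_qext
    ext x
    have := LinearMap.congr_fun hb x
    simp only [LinearMap.comp_apply, LinearMap.smul_apply, LinearMap.id_apply] at this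
    simp only [α', β', LinearMap.comp_apply, LinearMap.smul_apply, LinearMap.id_apply,
      Submodule.mkQ_apply, Submodule.liftQ_apply, this]
    exact Submodule.Quotient.mk_smul T s x
  have hinj : Function.Injective α' := by
    rw [injective_iff_map_eq_zero]
    intro x hx
    refine hN't s hs x ?_
    have := LinearMap.congr_fun hb' x
    simp only [LinearMap.comp_apply, hx, map_zero] at this
    exact this.symm
  -- the map `T ⊗ M → N ⊗ M` is zero
  have hz : ∀ x, rT R M T.subtype x = 0 := by
    intro x
    induction x with
    | zero => simp
    | add x y hx hy => rw [map_add, hx, hy, add_zero]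
    | tmul t m =>
      obtain ⟨⟨a, ha⟩, hx⟩ := (Submodule.mem_torsion_iff t.1).1 t.2
      have hx : a • t.1 = 0 := hx
      refine htf' a ha _ ?_
      rw [← map_smul, TensorProduct.smul_tmul']
      have : a • t = 0 := Subtype.ext hx
      rw [this, zero_tmul, map_zero]
  have hTex : Function.Exact T.subtype T.mkQ := LinearMap.exact_iff.2 (by simp)
  have hex := rT_exact (A := R) hTex (Submodule.mkQ_surjective T) (N := M)
  have htf2 : ∀ s ∈ nonZeroDivisors R, ∀ x : N' ⊗[R] M, s • x = 0 → x = 0 := by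
    intro s hs x hx
    obtain ⟨y, rfl⟩ := rT_surj (A := R) (N := M) (Submodule.mkQ_surjective T) x
    rw [← map_smul] at hx
    obtain ⟨z, hz'⟩ := (hex _).1 hx
    rw [hz] at hz'
    rw [htf' s hs y hz'.symm, map_zero]
  have hinj2 : Function.Injective (rT R M α') := by
    rw [injective_iff_map_eq_zero]
    intro x hx
    refine htf2 s hs x ?_
    have h1 : (rT R M β') ((rT R M α') x) = s • x := by
      have : (rT R M β') ∘ₗ (rT R M α') = s • LinearMap.id := by
        ext y m
        have h2 := LinearMap.congr_fun hb' y
        simp only [LinearMap.comp_apply, LinearMap.smul_apply, LinearMap.id_apply] at h2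
        simp [h2, TensorProduct.smul_tmul']
      exact LinearMap.congr_fun this x
    rw [← h1, hx, map_zero]
  let C := F ⧸ LinearMap.range α'
  have hCex : Function.Exact α' (LinearMap.range α').mkQ := α'.exact_map_mkQ_range
  have hC0 : Subsingleton (T1 R R C M) := by
    obtain ⟨δ, h1, h2⟩ := T1_les0 (A := R) M hinj hCex (Submodule.mkQ_surjective _)
    have hδ : ∀ x, δ x = 0 := fun x => hinj2 (by rw [h2.apply_apply_eq_zero, map_zero])
    refine subsingleton_of_forall_eq 0 fun x => ?_
    obtain ⟨y, rfl⟩ := (h1 x).1 (hδ x)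
    have := T1_flat (A := R) (B := R) F M
    rw [Subsingleton.elim y 0, map_zero]
  have hMC : ∀ i, Subsingleton (tor R R C M i) := by
    intro i
    obtain ⟨e0⟩ := tor_balance (A := R) M C 0
    obtain ⟨e⟩ := tor_balance (A := R) M C i
    have := hrig C (@Equiv.subsingleton _ _ e0.toEquiv hC0) i
    exact e.symm.toEquiv.subsingleton
  have hMN' : ∀ i, Subsingleton (tor R R N' M i) := by
    intro i
    obtain ⟨δ, h1, h2⟩ := tor_les (A := R) M hinj hCex (Submodule.mkQ_surjective _) i
    exact sub_of_exact h2 (hMC _) (T1_flat _ _)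
  have hT0 : Subsingleton T := by
    refine tens_zero (R := R) M T ?_ inferInstance
    obtain ⟨δ, h1, h2⟩ := T1_les0 (A := R) M (Submodule.injective_subtype T) hTex (Submodule.mkQ_surjective _)
    refine subsingleton_of_forall_eq 0 fun x => ?_
    obtain ⟨y, rfl⟩ := (h2 x).1 (hz x)
    have : Subsingleton (T1 R R N' M) := hMN' 0
    rw [Subsingleton.elim y 0, map_zero]
  refine ⟨Submodule.subsingleton_iff_eq_bot.1 hT0, fun i => ?_⟩
  obtain ⟨e⟩ := tor_balance (A := R) M N i
  have h3 := tor_mid (A := R) M (Submodule.injective_subtype T) hTex (Submodule.mkQ_surjective _) i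
  have : Subsingleton (tor R R N M i) := sub_of_exact h3 (T1_flat _ _) (hMN' i)
  exact e.toEquiv.subsingleton

/-- tensor powers, step -/
def TPsucc (M : Type u) [AddCommGroup M] [Module R M] (n : ℕ) :
    TensorPower R (n+1) M ≃ₗ[R] TensorPower R n M ⊗[R] M :=
  (TensorPower.mulEquiv (n := n) (m := 1)).symm.trans 
    (TensorProduct.congr (LinearEquiv.refl R _) (PiTensorProduct.subsingletonEquiv (0 : Fin 1)))

def TPzero (M : Type u) [AddCommGroup M] [Module R M] : TensorPower R 0 M ≃ₗ[R] R :=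
  PiTensorProduct.isEmptyEquiv (Fin 0)

def TPone (M : Type u) [AddCommGroup M] [Module R M] : TensorPower R 1 M ≃ₗ[R] M :=
  PiTensorProduct.subsingletonEquiv (0 : Fin 1)

lemma TP_fin (M : Type u) [AddCommGroup M] [Module R M] [Module.Finite R M] (n : ℕ) :
    Module.Finite R (TensorPower R n M) := by
  induction n with
  | zero => exact Module.Finite.equiv (TPzero (R := R) M).symm
  | succ n ih => exact Module.Finite.equiv (TPsucc (R := R) M n).symm

lemma TP_WF (M : Type u) [AddCommGroup M] [Module R M] (h : WF R M) (n : ℕ) :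
    WF R (TensorPower R n M) := by
  induction n with
  | zero => 
    refine WF_congr _ _ ?_ (TPzero (R := R) M).symm
    exact ⟨1, one_mem _, R, inferInstance, inferInstance, inferInstance, inferInstance, LinearMap.id, 
      LinearMap.id, by rw [one_smul]; rfl⟩
  | succ n ih => exact WF_congr _ _ (WF_tens _ _ ih h) (TPsucc (R := R) M n).symm

theorem tf_iter (M : Type u) [AddCommGroup M] [Module R M] [Module.Finite R M] [Nontrivial M]
    (hrig : ∀ (C : Type u) [AddCommGroup C] [Module R C] [Module.Finite R C],
      Subsingleton (tor R R M C 0) → ∀ i, Subsingleton (tor R R M C i))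
    (hW : WF R M) (n : ℕ) (htf : Submodule.torsion R (TensorPower R n M) = ⊥) (j : ℕ) (hj : j < n) :
    ∀ i, Subsingleton (tor R R M (TensorPower R j M) i) := by
  induction n with
  | zero => omega
  | succ n ih =>
    have := TP_fin (R := R) M n
    obtain ⟨h1, h2⟩ := tf_step M hrig (TensorPower R n M) (TP_WF M hW n) (TF_congr (TPsucc M n) htf)
    rcases Nat.lt_succ_iff_lt_or_eq.1 hj with h | rfl
    · exact ih h1 h
    · exact h2

end F
end

section
set_option linter.unusedSectionVars false
set_option linter.style.haveILetI false
open TensorProduct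

/-! ## Betti numbers over the hypersurface -/
section chgR
variable {S Q : Type u} [CommRing S] [CommRing Q] [Algebra Q S]
  [IsLocalRing S] [IsLocalRing Q]

lemma kS_equiv (hs : Function.Surjective (algebraMap Q S)) 
    (N : Type u) [AddCommGroup N] [Module S N] [Module Q N] [IsScalarTower Q S N]
    (x0 : N) (hgen : ∀ y : N, ∃ s : S, s • x0 = y)
    (hkill : ∀ s ∈ IsLocalRing.maximalIdeal S, s • x0 = 0) (hnt : Nontrivial N) :
    Nonempty (IsLocalRing.ResidueField Q ≃ₗ[Q] N) := by
  have hloc : IsLocalHom (algebraMap Q S) := hs.isLocalHom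
  let φ : Q →ₗ[Q] N := LinearMap.toSpanSingleton Q _ x0
  have hφ : Function.Surjective φ := by
    intro x
    obtain ⟨s, rfl⟩ := hgen x
    obtain ⟨q, rfl⟩ := hs s
    exact ⟨q, by simp [φ]⟩
  have hker : IsLocalRing.maximalIdeal Q ≤ LinearMap.ker φ := by
    intro q hq
    rw [LinearMap.mem_ker]
    simp only [φ, LinearMap.toSpanSingleton_apply]
    rw [← algebraMap_smul S]
    apply hkill
    exact (IsLocalRing.mem_maximalIdeal _).2 (map_mem_nonunits_iff _ _ |>.2 hq)
  have hker2 : LinearMap.ker φ = IsLocalRing.maximalIdeal Q := by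
    refine le_antisymm ?_ hker
    apply IsLocalRing.le_maximalIdeal
    intro h
    have : φ 1 = 0 := by
      rw [← LinearMap.mem_ker, h]; trivial
    obtain ⟨x, hx⟩ := exists_ne (0 : N)
    obtain ⟨q, rfl⟩ := hφ x
    apply hx
    rw [← mul_one q, ← smul_eq_mul, map_smul, this, smul_zero]
  have e := LinearMap.quotKerEquivOfSurjective φ hφ
  rw [hker2] at e
  exact ⟨e⟩

lemma chgA (f : Q) (hs : Function.Surjective (algebraMap Q S))
    (hk : RingHom.ker (algebraMap Q S) = Ideal.span {f}) (hf : f ∈ nonZeroDivisors Q)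
    (LA : List Q) (hLA : RS Q LA Q (IsLocalRing.ResidueField Q))
    (E : Type u) [AddCommGroup E] [Module S E]
    (N : Type u) [AddCommGroup N] [Module S N] 
    (x0 : N) (hgen : ∀ y : N, ∃ s : S, s • x0 = y)
    (hkill : ∀ s ∈ IsLocalRing.maximalIdeal S, s • x0 = 0) (hnt : Nontrivial N) (i : ℕ) :
    (LA.length ≤ i + 2 → Module.length S (tor S S E N (i+2)) ≤ Module.length S (tor S S E N i)) ∧
    (LA.length ≤ i + 1 → Subsingleton (tor S S E N (i+2)) → Subsingleton (tor S S E N i)) := by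
  letI : Module Q N := Module.compHom _ (algebraMap Q S)
  haveI : IsScalarTower Q S N :=
    ⟨fun x y z => by rw [Algebra.smul_def, mul_smul]; rfl⟩
  letI : Module Q E := Module.compHom _ (algebraMap Q S)
  haveI : IsScalarTower Q S E :=
    ⟨fun x y z => by rw [Algebra.smul_def, mul_smul]; rfl⟩
  obtain ⟨ek⟩ := kS_equiv hs N x0 hgen hkill hnt
  have hv : ∀ j, LA.length ≤ j → Subsingleton (tor Q Q E N j) := by
    intro j hj
    have h1 := RS_up LA E Q (IsLocalRing.ResidueField Q) hLA 0 (fun _ _ => T1_flat _ _) j (by omega)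
    have h2 := (torCongr (A := Q) E ek j).symm.toEquiv.subsingleton
    obtain ⟨e3⟩ := tor_balance (A := Q) E N j
    exact e3.toEquiv.subsingleton
  obtain ⟨a, b, c, C, _, _, β, h1, h2, h3, h4, h5⟩ := chg_seq f hs hk hf E N
  constructor
  · intro hi
    apply Module.length_le_of_injective (b i)
    rw [injective_iff_map_eq_zero]
    intro x hx
    obtain ⟨y, rfl⟩ := (h1 i x).1 hx
    obtain ⟨e, -⟩ := h5 (i+1)
    have := hv (i+2) hi
    have := e.symm.toEquiv.subsingleton
    rw [Subsingleton.elim y 0, map_zero]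
  · intro hi h
    refine sub_of_exact (h2 i) h ?_
    obtain ⟨e, -⟩ := h5 i
    have := hv (i+1) hi
    exact e.symm.toEquiv.subsingleton

variable {R : Type u} [CommRing R] [Algebra R S]
  [IsNoetherianRing R] [IsLocalRing R] [Module.Flat R S]
  [IsLocalHom (algebraMap R S)]

lemma chgR (hm : (IsLocalRing.maximalIdeal R).map (algebraMap R S) = IsLocalRing.maximalIdeal S)
    (f : Q) (hs : Function.Surjective (algebraMap Q S))
    (hk : RingHom.ker (algebraMap Q S) = Ideal.span {f}) (hf : f ∈ nonZeroDivisors Q)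
    (LA : List Q) (hLA : RS Q LA Q (IsLocalRing.ResidueField Q))
    (Y : Type u) [AddCommGroup Y] [Module R Y] (i : ℕ) : 
    (LA.length ≤ i + 2 → Module.length R (tor R R Y (IsLocalRing.ResidueField R) (i+2)) ≤ 
      Module.length R (tor R R Y (IsLocalRing.ResidueField R) i)) ∧
    (LA.length ≤ i + 1 → Subsingleton (tor R R Y (IsLocalRing.ResidueField R) (i+2)) → 
      Subsingleton (tor R R Y (IsLocalRing.ResidueField R) i)) := by
  have hff : Module.FaithfullyFlat R S := Module.FaithfullyFlat.of_flat_of_isLocalHom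
  have hlen : ∀ j, Module.length S (tor S S (S ⊗[R] Y) (S ⊗[R] IsLocalRing.ResidueField R) j) = 
      Module.length R (tor R R Y (IsLocalRing.ResidueField R) j) := by
    intro j
    obtain ⟨e⟩ := bc_tor (A := R) (S := S) Y (IsLocalRing.ResidueField R) j
    have h1 : IsSimpleModule S (S ⧸ IsLocalRing.maximalIdeal S) :=
      isSimpleModule_iff_isCoatom.2 (IsLocalRing.maximalIdeal.isMaximal _).out
    rw [e.length_eq, IsLocalRing.length_baseChange, hm, Module.length_eq_one S, mul_one]
  have key := chgA f hs hk hf LA hLA (S ⊗[R] Y) (S ⊗[R] IsLocalRing.ResidueField R) (1 ⊗ₜ 1) ?_ ?_ ?_ i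
  · rw [← hlen, ← hlen]
    refine ⟨key.1, ?_⟩
    rw [← Module.length_eq_zero_iff (R := R), ← Module.length_eq_zero_iff (R := R), ← hlen, ← hlen,
      Module.length_eq_zero_iff, Module.length_eq_zero_iff]
    exact key.2
  · intro x
    induction x with
    | zero => exact ⟨0, zero_smul _ _⟩
    | add x y hx hy =>
      obtain ⟨a, rfl⟩ := hx
      obtain ⟨b, rfl⟩ := hy
      exact ⟨a + b, add_smul _ _ _⟩
    | tmul s x =>
      obtain ⟨t, rfl⟩ := IsLocalRing.residue_surjective x
      refine ⟨t • s, ?_⟩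
      rw [TensorProduct.smul_tmul', smul_eq_mul, mul_one, TensorProduct.smul_tmul]
      congr 1
      rw [Algebra.smul_def, mul_one]; rfl
  · intro s hs
    rw [← hm] at hs
    refine Submodule.span_induction ?_ ?_ ?_ ?_ hs
    · rintro _ ⟨r, hr, rfl⟩
      rw [algebraMap_smul, ← TensorProduct.tmul_smul]
      have : r • (1 : IsLocalRing.ResidueField R) = 0 := by
        rw [Algebra.smul_def, mul_one]
        exact (IsLocalRing.residue_eq_zero_iff r).2 hr
      rw [this, tmul_zero]
    · rw [zero_smul]
    · intro x y _ _ hx hy; rw [add_smul, hx, hy, add_zero]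
    · intro a x _ hx; rw [smul_assoc, hx, smul_zero]
  · exact Module.FaithfullyFlat.lTensor_nontrivial _ _ _

end chgR

section chgR2
variable {R : Type u} [CommRing R] [IsNoetherianRing R] [IsLocalRing R]
variable {V : Type u} [CommRing V] [IsNoetherianRing V] [IsLocalRing V] {r : ℕ} {LV : List V}
  {f : MvPowerSeries (Fin r) V}
  {π : MvPowerSeries (Fin r) V →+* AdicCompletion (IsLocalRing.maximalIdeal R) R}

lemma chgP (hP : PSPres R V r LV f π)
    (Y : Type u) [AddCommGroup Y] [Module R Y] (i : ℕ) : 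
    (LV.length + r ≤ i + 2 → Module.length R (tor R R Y (IsLocalRing.ResidueField R) (i+2)) ≤ 
      Module.length R (tor R R Y (IsLocalRing.ResidueField R) i)) ∧
    (LV.length + r ≤ i + 1 → Subsingleton (tor R R Y (IsLocalRing.ResidueField R) (i+2)) → 
      Subsingleton (tor R R Y (IsLocalRing.ResidueField R) i)) := by
  obtain ⟨hlen, hLV, hfm, hf, hs, hk⟩ := hP
  letI : Algebra (MvPowerSeries (Fin r) V) (AdicCompletion (IsLocalRing.maximalIdeal R) R) :=
    π.toAlgebra
  haveI : Module.Flat R (AdicCompletion (IsLocalRing.maximalIdeal R) R) :=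
    AdicCompletion.flat_of_isNoetherian _
  have hm := (AdicCompletion.maximalIdeal_eq_map (R := R)).symm
  obtain ⟨LA, h1, h2⟩ := kosz_RSQ V r LV hLV
  rw [← h1]
  exact chgR hm f hs hk hf LA h2 Y i

end chgR2
end

section
set_option linter.unusedSectionVars false
set_option linter.style.haveILetI false
open TensorProduct

/-! ## Vanishing of maps on Tor -/
section zm
variable {A : Type u} [CommRing A]
variable {E1 E2 E3 E1' E2' E3' : Type u} [AddCommGroup E1] [Module A E1] [AddCommGroup E2] [Module A E2]
  [AddCommGroup E3] [Module A E3] [AddCommGroup E1'] [Module A E1'] [AddCommGroup E2'] [Module A E2']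
  [AddCommGroup E3'] [Module A E3']

lemma T1_zero (Z : Type u) [AddCommGroup Z] [Module A Z] {a : E1 →ₗ[A] E2} {b : E2 →ₗ[A] E3}
    {a' : E1' →ₗ[A] E2'} {b' : E2' →ₗ[A] E3'} {g1 : E1 →ₗ[A] E1'} {g2 : E2 →ₗ[A] E2'}
    {g3 : E3 →ₗ[A] E3'} (hab : Function.Exact a b) (hb : Function.Surjective b)
    (hab' : Function.Exact a' b') (hb' : Function.Surjective b') (c1 : g2 ∘ₗ a = a' ∘ₗ g1)
    (c2 : g3 ∘ₗ b = b' ∘ₗ g2) (hT : Subsingleton (T1 A A E2' Z))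
    (hu : ∀ u, rT A Z a u = 0 → rT A Z g1 u = 0) (x : T1 A A E3 Z) : T1map A Z g3 x = 0 := by
  have rc : ∀ {X1 X2 X3 : Type u} [AddCommGroup X1] [Module A X1] [AddCommGroup X2] [Module A X2]
    [AddCommGroup X3] [Module A X3] (p : X1 →ₗ[A] X2) (q : X2 →ₗ[A] X3) (Y : Type u) [AddCommGroup Y]
    [Module A Y] (y), rT A Y (q ∘ₗ p) y = rT A Y q (rT A Y p y) := by
    intro X1 X2 X3 _ _ _ _ _ _ p q Y _ _ y
    induction y with
    | zero => simp
    | add y z hy hz => rw [map_add, map_add, map_add, hy, hz]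
    | tmul y z => simp
  apply T1in_inj
  rw [T1map_in, map_zero]
  obtain ⟨y, hy⟩ := rT_surj (A := A) (N := syz A Z) hb (T1in A A E3 Z x)
  have h1 : rT A (cov A Z) b (lT A A E2 (syzIn A Z) y) = 0 := by
    rw [lr_comm', hy, (T1_exact A A E3 Z).apply_apply_eq_zero]
  obtain ⟨z, hz⟩ := (rT_exact (A := A) hab hb _).1 h1
  have h2 : rT A Z a (lT A A E1 (covMap A Z) z) = 0 := by
    rw [lr_comm', hz, (lT_exact E2 (syz_exact A Z) (covMap_surj A Z)).apply_apply_eq_zero]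
  have h3 := hu _ h2
  rw [lr_comm'] at h3
  obtain ⟨v, hv⟩ := (lT_exact E1' (syz_exact A Z) (covMap_surj A Z) _).1 h3
  have h4 : lT A A E2' (syzIn A Z) (rT A _ g2 y - rT A _ a' v) = 0 := by
    rw [map_sub, ← lr_comm', ← lr_comm', ← hz, hv, ← rc, ← rc, c1, sub_self]
  obtain ⟨w, hw⟩ := (T1_exact A A E2' Z _).1 h4
  rw [Subsingleton.elim w 0, map_zero] at hw
  have h5 : rT A (syz A Z) g2 y = rT A _ a' v := (sub_eq_zero.1 hw.symm)
  rw [← hy, ← rc, c2, rc, h5, (rT_exact (A := A) hab' hb').apply_apply_eq_zero]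

lemma rT_mem_zero (Z : Type u) [AddCommGroup Z] [Module A Z] (I : Ideal A) (hZ : ∀ a ∈ I, ∀ z : Z, a • z = 0)
    {X F : Type u} [AddCommGroup X] [Module A X] [AddCommGroup F] [Module A F] (g : X →ₗ[A] F)
    (hg : ∀ x, g x ∈ I • (⊤ : Submodule A F)) (N : Type u) [AddCommGroup N] [Module A N] (u) :
    rT A Z (rT A N g) u = 0 := by
  have key : ∀ y ∈ I • (⊤ : Submodule A F), ∀ (n : N) (z : Z), ((y ⊗ₜ[A] n) ⊗ₜ[A] z) = 0 := by
    intro y hy n z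
    refine Submodule.smul_induction_on hy ?_ ?_
    · intro r hr f _
      rw [← TensorProduct.smul_tmul', ← TensorProduct.smul_tmul', ← TensorProduct.tmul_smul, hZ r hr, tmul_zero]
    · intro x y hx hy
      rw [add_tmul, add_tmul, hx, hy, add_zero]
  induction u with
  | zero => simp
  | add x y hx hy => rw [map_add, hx, hy, add_zero]
  | tmul x z =>
    induction x with
    | zero => simp
    | add x y hx hy => rw [add_tmul, map_add, hx, hy, add_zero]
    | tmul x n => exact key _ (hg x) n z

lemma torMap_zero (Z : Type u) [AddCommGroup Z] [Module A Z] (I : Ideal A) (hZ : ∀ a ∈ I, ∀ z : Z, a • z = 0)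
    {X F : Type u} [AddCommGroup X] [Module A X] [AddCommGroup F] [Module A F] [Module.Flat A F] (g : X →ₗ[A] F)
    (hg : ∀ x, g x ∈ I • (⊤ : Submodule A F)) (j : ℕ) (N : Type u) [AddCommGroup N] [Module A N]
    (hi : ∀ i, Subsingleton (tor A A X N i)) (x) :
    torMap A Z (rT A N g) j x = 0 := by
  have hinj : ∀ (N : Type u) [AddCommGroup N] [Module A N], Subsingleton (T1 A A X N) → 
      Function.Injective (lT A A X (syzIn A N)) := by
    intro N _ _ h
    rw [injective_iff_map_eq_zero]
    intro u hu
    obtain ⟨w, rfl⟩ := (T1_exact A A X N _).1 hu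
    rw [Subsingleton.elim w 0, map_zero]
  induction j generalizing N with
  | zero =>
    exact T1_zero Z (lT_exact X (syz_exact A N) (covMap_surj A N)) (lT_surj X (covMap_surj A N))
      (lT_exact F (syz_exact A N) (covMap_surj A N)) (lT_surj F (covMap_surj A N)) (lr_comm _ _)
      (lr_comm _ _) (T1_flat _ _) (fun u _ => rT_mem_zero Z I hZ g hg _ u) x
  | succ j ih =>
    have key : ∀ x : T1 A A (X ⊗[A] N) (syz A (Om A j (ModuleCat.of A Z))),
      T1map A (syz A (Om A j (ModuleCat.of A Z))) (rT A N g) x = 0 := by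
      refine T1_zero _ (lT_exact X (syz_exact A N) (covMap_surj A N)) (lT_surj X (covMap_surj A N))
        (lT_exact F (syz_exact A N) (covMap_surj A N)) (lT_surj F (covMap_surj A N)) (lr_comm _ _)
        (lr_comm _ _) (T1_flat _ _) (fun u hu => ?_)
      have h1 : lT A A _ (syzIn A (Om A j (ModuleCat.of A Z))) u = 0 := by
        apply rT_inj (hinj N (hi 0))
        rw [lr_comm', hu, map_zero, map_zero]
      obtain ⟨w, rfl⟩ := (T1_exact A A _ _ _).1 h1
      have h2 := ih (syz A N) (fun i => hi (i+1)) w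
      have h3 := congrArg (T1in _ _ _ _) h2
      rw [map_zero] at h3
      exact h3
    have e := Om_succ j (ModuleCat.of A Z)
    have gen : ∀ O : ModuleCat.{u} A, O = ModuleCat.of A (syz A (Om A j (ModuleCat.of A Z))) →
      ∀ x : T1 A A (X ⊗[A] N) O, T1map A O (rT A N g) x = 0 := by
      rintro _ rfl
      exact key
    exact gen _ e x
end zm
end

section
set_option linter.unusedSectionVars false
set_option linter.style.haveILetI false
open TensorProduct

/-! ## Betti numbers of tensor products of Tor independent modules -/
section kun
variable {A : Type u} [CommRing A] [IsNoetherianRing A] [IsLocalRing A]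

/-- shorthand -/
abbrev kk (A : Type u) [CommRing A] [IsLocalRing A] : Type u := IsLocalRing.ResidueField A

lemma kk_kill (a : A) (ha : a ∈ IsLocalRing.maximalIdeal A) (z : kk A) : a • z = 0 := by
  rw [Algebra.smul_def]
  have : algebraMap A (kk A) a = 0 := (IsLocalRing.residue_eq_zero_iff a).2 ha
  rw [this, zero_mul]

lemma syz_mem (M : Type u) [AddCommGroup M] [Module A M] [Module.Finite A M] (x : syz A M) :
    syzIn A M x ∈ IsLocalRing.maximalIdeal A • (⊤ : Submodule A (cov A M)) := by
  classical
  rw [← Finsupp.sum_single (syzIn A M x)]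
  refine Submodule.sum_mem _ fun i _ => ?_
  rw [show Finsupp.single i (syzIn A M x i) = (syzIn A M x i) • Finsupp.single i (1 : A) by simp]
  exact Submodule.smul_mem_smul (min_mem A M x i) trivial

variable (M N : Type u) [AddCommGroup M] [Module A M] [AddCommGroup N] [Module A N]

lemma indep_syz (h : ∀ i, Subsingleton (tor A A M N i)) (i : ℕ) : Subsingleton (tor A A (syz A M) N i) := by
  obtain ⟨e⟩ := tor_shift (A := A) (B := A) N (syzIn_inj A M) (syz_exact A M) (covMap_surj A M) i
    (T1_flat _ _) (T1_flat _ _)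
  have := h (i+1)
  exact e.symm.toEquiv.subsingleton

lemma ses_inj (h : ∀ i, Subsingleton (tor A A M N i)) : Function.Injective (rT A N (syzIn A M)) := by
  obtain ⟨e⟩ := T1_shift (A := A) (B := A) N (syzIn_inj A M) (syz_exact A M) (covMap_surj A M) (T1_flat _ _)
  have h0 : Subsingleton (T1 A A M N) := h 0
  have h2 : Subsingleton (LinearMap.ker (rT A N (syzIn A M))) := e.symm.toEquiv.subsingleton
  rw [injective_iff_map_eq_zero]
  intro x hx
  have h3 := Subsingleton.elim (⟨x, hx⟩ : LinearMap.ker (rT A N (syzIn A M))) 0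
  exact congrArg Subtype.val h3

lemma cov_ne [Nontrivial M] : Nonempty (covI A M) := by
  by_contra h
  rw [not_nonempty_iff] at h
  have := (covMap_surj A M).subsingleton
  exact not_subsingleton M this

omit [IsNoetherianRing A] [IsLocalRing A] in
lemma retr_aux {X Y : Type u} [AddCommGroup X] [Module A X] [AddCommGroup Y] [Module A Y]
    (q : X →ₗ[A] Y) (p : Y →ₗ[A] X) (h : p ∘ₗ q = LinearMap.id) (Z : Type u) [AddCommGroup Z] [Module A Z] :
    Function.Injective (T1map A Z q) := by
  have h2 : (T1map A Z p) ∘ₗ (T1map A Z q) = LinearMap.id := by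
    rw [← T1map_comp, h, T1map_id]
  exact Function.LeftInverse.injective (g := T1map A Z p) (fun x => by
    rw [← LinearMap.comp_apply, h2]; rfl)

variable {N} in
lemma retr_inj (I : Type u) [Nonempty I] (Z : Type u) [AddCommGroup Z] [Module A Z] :
    ∃ g : T1 A A N Z →ₗ[A] T1 A A ((I →₀ A) ⊗[A] N) Z, Function.Injective g := by
  classical
  obtain ⟨i⟩ := ‹Nonempty I›
  let p : (I →₀ A) ⊗[A] N →ₗ[A] N := (TensorProduct.lid A N).toLinearMap ∘ₗ (Finsupp.lapply i).rTensor N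
  let q : N →ₗ[A] (I →₀ A) ⊗[A] N := TensorProduct.mk A (I →₀ A) N (Finsupp.single i 1)
  have h : p ∘ₗ q = LinearMap.id := by
    ext x; simp [p, q]
  exact ⟨_, retr_aux q p h Z⟩

variable {N} in
lemma free_tens_T1 (F : Type u) [AddCommGroup F] [Module A F] [Module.Flat A F] (Z : Type u)
    [AddCommGroup Z] [Module A Z] (h : Subsingleton (T1 A A N Z)) : Subsingleton (T1 A A (F ⊗[A] N) Z) := by
  have h1 : Function.Injective ((syzIn A Z).lTensor N) := by
    rw [injective_iff_map_eq_zero]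
    intro u hu
    obtain ⟨w, rfl⟩ := (T1_exact A A N Z _).1 hu
    rw [Subsingleton.elim w 0, map_zero]
  have h2 : Function.Injective ((syzIn A Z).lTensor (F ⊗[A] N)) := by
    rw [LinearMap.lTensor_tensor]
    simp only [LinearMap.coe_comp, LinearEquiv.coe_coe]
    exact (LinearEquiv.injective _).comp ((Module.Flat.lTensor_preserves_injective_linearMap _ h1).comp
      (LinearEquiv.injective _))
  refine subsingleton_of_forall_eq 0 fun x => T1in_inj _ _ _ _ (h2 ?_)
  rw [map_zero, map_zero]
  exact (T1_exact A A (F ⊗[A] N) Z).apply_apply_eq_zero x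

variable [Module.Finite A M] [Module.Finite A N]

variable {M N} in
lemma kun_les (h : ∀ i, Subsingleton (tor A A M N i)) (j : ℕ) :
    ∃ (α : tor A A (cov A M ⊗[A] N) (kk A) (j+1) →ₗ[A] tor A A (M ⊗[A] N) (kk A) (j+1))
      (β : tor A A (M ⊗[A] N) (kk A) (j+1) →ₗ[A] tor A A (syz A M ⊗[A] N) (kk A) j),
      Function.Injective α ∧ Function.Exact α β ∧ Function.Surjective β := by
  have e1 := ses_inj M N h
  have e2 := rT_exact (A := A) (N := N) (syz_exact A M) (covMap_surj A M)
  have e3 := rT_surj (A := A) (N := N) (covMap_surj A M)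
  have hz := torMap_zero (kk A) (IsLocalRing.maximalIdeal A) kk_kill (syzIn A M) (syz_mem M)
  obtain ⟨δ, h1, h2⟩ := tor_les (A := A) (B := A) (E1 := syz A M ⊗[A] N) (E2 := cov A M ⊗[A] N) (E3 := M ⊗[A] N) (kk A) e1 e2 e3 j
  refine ⟨_, δ, ?_, h1, ?_⟩
  · rw [injective_iff_map_eq_zero]
    intro x hx
    obtain ⟨y, rfl⟩ := (tor_mid (A := A) (B := A) (E1 := syz A M ⊗[A] N) (E2 := cov A M ⊗[A] N) (E3 := M ⊗[A] N) (kk A) e1 e2 e3 (j+1) x).1 hx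
    exact hz _ N (indep_syz M N h) _
  · intro y
    exact (h2 y).1 (hz _ N (indep_syz M N h) _)

variable {M N} in
lemma kun_les0 (h : ∀ i, Subsingleton (tor A A M N i)) :
    ∃ (α : T1 A A (cov A M ⊗[A] N) (kk A) →ₗ[A] T1 A A (M ⊗[A] N) (kk A))
      (β : T1 A A (M ⊗[A] N) (kk A) →ₗ[A] (syz A M ⊗[A] N) ⊗[A] (kk A)),
      Function.Injective α ∧ Function.Exact α β ∧ Function.Surjective β := by
  have e1 := ses_inj M N h
  have e2 := rT_exact (A := A) (N := N) (syz_exact A M) (covMap_surj A M)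
  have e3 := rT_surj (A := A) (N := N) (covMap_surj A M)
  have hz := torMap_zero (kk A) (IsLocalRing.maximalIdeal A) kk_kill (syzIn A M) (syz_mem M)
  obtain ⟨δ, h1, h2⟩ := T1_les0 (A := A) (B := A) (E1 := syz A M ⊗[A] N) (E2 := cov A M ⊗[A] N) (E3 := M ⊗[A] N) (kk A) e1 e2 e3
  refine ⟨_, δ, ?_, h1, ?_⟩
  · rw [injective_iff_map_eq_zero]
    intro x hx
    obtain ⟨y, rfl⟩ := (T1_mid (A := A) (B := A) (E1 := syz A M ⊗[A] N) (E2 := cov A M ⊗[A] N) (E3 := M ⊗[A] N) (kk A) e1 e2 e3 x).1 hx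
    exact hz 0 N (indep_syz M N h) _
  · intro y
    exact (h2 y).1 (rT_mem_zero (kk A) (IsLocalRing.maximalIdeal A) kk_kill (syzIn A M) (syz_mem M) N _)

/-- nonvanishing of Betti numbers -/
def nz (j : ℕ) : Prop := Nontrivial (Om A j (ModuleCat.of A N))

lemma nz_succ (j : ℕ) : nz (A := A) N (j+1) ↔ Nontrivial (tor A A N (kk A) j) := by
  obtain ⟨e⟩ := tork A N j
  have : Module.Finite A (ModuleCat.of A N) := ‹Module.Finite A N›
  have := Om_finite A (j+1) (ModuleCat.of A N)
  rw [e.toEquiv.nontrivial_congr]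
  rw [nz, ← not_subsingleton_iff_nontrivial, ← not_subsingleton_iff_nontrivial, not_iff_not]
  exact ⟨fun h => inferInstance, fun h => k_tens_zero A _ h⟩

lemma nz_syz (j : ℕ) : nz (A := A) (syz A N) j ↔ nz (A := A) N (j+1) := Iff.rfl

lemma nz_zero : nz (A := A) N 0 ↔ Nontrivial N := Iff.rfl

lemma nz_tens_zero : nz (A := A) (M ⊗[A] N) 0 ↔ nz (A := A) M 0 ∧ nz (A := A) N 0 := by
  rw [nz_zero, nz_zero, nz_zero]
  constructor
  · intro h
    rw [← not_subsingleton_iff_nontrivial, ← not_subsingleton_iff_nontrivial]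
    constructor
    · intro h'
      exact not_subsingleton _ (inferInstance : Subsingleton (M ⊗[A] N))
    · intro h'
      exact not_subsingleton _ (inferInstance : Subsingleton (M ⊗[A] N))
  · rintro ⟨h1, h2⟩
    by_contra h
    rw [not_nontrivial_iff_subsingleton] at h
    have := tens_zero (R := A) N M h h2
    exact not_subsingleton M this

lemma nontriv_exact {X1 X2 X3 : Type u} [AddCommGroup X1] [Module A X1] [AddCommGroup X2] [Module A X2]
    [AddCommGroup X3] [Module A X3] {α : X1 →ₗ[A] X2} {β : X2 →ₗ[A] X3} (h1 : Function.Injective α)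
    (h2 : Function.Exact α β) (h3 : Function.Surjective β) : Nontrivial X2 ↔ Nontrivial X1 ∨ Nontrivial X3 := by
  constructor
  · intro h
    by_contra hc
    simp only [not_or, not_nontrivial_iff_subsingleton] at hc
    exact not_subsingleton X2 (sub_of_exact h2 hc.1 hc.2)
  · rintro (h | h)
    · exact h1.nontrivial
    · exact h3.nontrivial

lemma cov_tens_tor [Nontrivial M] (j : ℕ) : Nontrivial (tor A A (cov A M ⊗[A] N) (kk A) j) ↔
    Nontrivial (tor A A N (kk A) j) := by
  constructor
  · intro h
    by_contra hc
    rw [not_nontrivial_iff_subsingleton] at hc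
    exact not_subsingleton _ (free_tens_T1 (cov A M) _ hc)
  · intro h
    have := cov_ne (A := A) M
    obtain ⟨g, hg⟩ := retr_inj (A := A) (N := N) (covI A M) (Om A j (ModuleCat.of A (kk A)))
    exact hg.nontrivial

lemma nz_kun_succ [Nontrivial M] (h : ∀ i, Subsingleton (tor A A M N i)) (j : ℕ) :
    nz (A := A) (M ⊗[A] N) (j+1) ↔ nz (A := A) N (j+1) ∨ nz (A := A) (syz A M ⊗[A] N) j := by
  rw [nz_succ, nz_succ]
  cases j with
  | zero =>
    obtain ⟨α, β, h1, h2, h3⟩ := kun_les0 h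
    have h4 := nontriv_exact h1 h2 h3
    have h5 := cov_tens_tor (A := A) M N 0
    refine h4.trans ?_
    rw [nz_zero]
    refine Iff.trans (or_congr h5 Iff.rfl) ?_
    apply or_congr Iff.rfl
    rw [← not_subsingleton_iff_nontrivial, ← not_subsingleton_iff_nontrivial, not_iff_not]
    refine ⟨fun h => k_tens_zero A _ ((TensorProduct.comm A _ _).toEquiv.symm.subsingleton), 
      fun h => inferInstance⟩
  | succ j =>
    obtain ⟨α, β, h1, h2, h3⟩ := kun_les h j
    rw [nontriv_exact h1 h2 h3, cov_tens_tor, nz_succ]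

lemma nz_kun (h : ∀ i, Subsingleton (tor A A M N i)) (j : ℕ) :
    nz (A := A) (M ⊗[A] N) j ↔ ∃ a b, a + b = j ∧ nz (A := A) M a ∧ nz (A := A) N b := by
  induction j generalizing M with
  | zero =>
    rw [nz_tens_zero]
    constructor
    · intro h
      exact ⟨0, 0, rfl, h⟩
    · rintro ⟨a, b, hab, h⟩
      obtain ⟨rfl, rfl⟩ : a = 0 ∧ b = 0 := by omega
      exact h
  | succ j ih =>
    by_cases hM : Nontrivial M
    · rw [nz_kun_succ M N h, ih (syz A M) (indep_syz M N h)]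
      constructor
      · rintro (h | ⟨a, b, h1, h2, h3⟩)
        · exact ⟨0, j+1, by omega, hM, h⟩
        · exact ⟨a+1, b, by omega, h2, h3⟩
      · rintro ⟨a, b, h1, h2, h3⟩
        cases a with
        | zero => left; rw [← h1, zero_add]; exact h3
        | succ a => right; exact ⟨a, b, by omega, h2, h3⟩
    · rw [not_nontrivial_iff_subsingleton] at hM
      have z : ∀ (j : ℕ) (X : Type u) [AddCommGroup X] [Module A X] [Subsingleton X], 
          ¬ nz (A := A) X j := by
        intro j
        induction j with
        | zero => intro X _ _ h1 h2; rw [nz_zero] at h2; exact not_subsingleton X h1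
        | succ j ih =>
          intro X _ _ hX
          rw [← nz_syz]
          have hf : Module.Finite A X := inferInstance
          have : Subsingleton (syz A X) := by
            have hc : IsEmpty (covI A X) := by
              have := covI_finite A X
              have h2 := covI_card A X
              rw [Submodule.eq_bot_of_subsingleton (p := (⊤ : Submodule A X)), Submodule.spanFinrank_bot, Nat.card_eq_zero] at h2
              exact h2.resolve_right (fun h => h.not_finite this)
            exact (syzIn_inj A X).subsingleton
          exact ih _
      constructor
      · intro h; exact absurd h (z _ _)
      · rintro ⟨a, b, h1, h2, h3⟩
        exact absurd h2 (z _ _)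

end kun
end

section
set_option linter.unusedSectionVars false
set_option linter.style.haveILetI false
open TensorProduct

/-! ## Projective dimension of tensor powers -/
section top
variable {A : Type u} [CommRing A] [IsNoetherianRing A] [IsLocalRing A]

lemma nz_congr {X Y : Type u} [AddCommGroup X] [Module A X] [AddCommGroup Y] [Module A Y]
    [Module.Finite A X] [Module.Finite A Y] (e : X ≃ₗ[A] Y) (j : ℕ) : nz (A := A) X j ↔ nz (A := A) Y j := by
  cases j with
  | zero => rw [nz_zero, nz_zero]; exact e.toEquiv.nontrivial_congr
  | succ j =>
    rw [nz_succ, nz_succ]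
    exact (torCongr (A := A) (kk A) e j).toEquiv.nontrivial_congr

lemma nz_sub (j : ℕ) (X : Type u) [AddCommGroup X] [Module A X] (hX : Subsingleton X) : 
    ¬ nz (A := A) X j := by
  induction j generalizing X with
  | zero => intro h2; rw [nz_zero] at h2; exact not_subsingleton X hX
  | succ j ih =>
    rw [← nz_syz]
    have hf : Module.Finite A X := inferInstance
    have : Subsingleton (syz A X) := by
      have hc : IsEmpty (covI A X) := by
        have := covI_finite A X
        have h2 := covI_card A X
        rw [Submodule.eq_bot_of_subsingleton (p := (⊤ : Submodule A X)), Submodule.spanFinrank_bot, Nat.card_eq_zero] at h2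
        exact h2.resolve_right (fun h => h.not_finite this)
      exact (syzIn_inj A X).subsingleton
    exact ih _ this

lemma nz_down (i j : ℕ) (X : Type u) [AddCommGroup X] [Module A X] [Module.Finite A X]
    (h : nz (A := A) X (i + j)) : nz (A := A) X i := by
  induction i generalizing X with
  | zero =>
    by_contra hc
    rw [nz_zero, not_nontrivial_iff_subsingleton] at hc
    exact nz_sub _ X hc h
  | succ i ih =>
    rw [← nz_syz]
    apply ih
    rw [nz_syz]
    rwa [show i + 1 + j = i + j + 1 by ring] at h

lemma pdLE_of_nz (s : ℕ) (M : Type u) [AddCommGroup M] [Module A M] [Module.Finite A M]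
    (h : ¬ nz (A := A) M (s+1)) : pdLE A s M := by
  induction s generalizing M with
  | zero =>
    rw [← nz_syz, nz_zero, not_nontrivial_iff_subsingleton] at h
    have : Function.Injective (covMap A M) := by
      rw [injective_iff_map_eq_zero]
      intro x hx
      obtain ⟨y, rfl⟩ := (syz_exact A M x).1 hx
      rw [Subsingleton.elim y 0, map_zero]
    have e := LinearEquiv.ofBijective (covMap A M) ⟨this, covMap_surj A M⟩
    exact Module.Projective.of_equiv e
  | succ s ih =>
    exact ⟨cov A M, inferInstance, inferInstance, inferInstance, covMap A M, covMap_surj A M, 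
      ih (syz A M) h⟩

lemma growth (N : Type u) [AddCommGroup N] [Module A N] [Module.Finite A N]
    (hN : ∀ j, nz (A := A) N j) (j : ℕ) (M : Type u) [AddCommGroup M] [Module A M] [Module.Finite A M]
    (hM : ∀ j, nz (A := A) M j) (h : ∀ i, Subsingleton (tor A A M N i)) : 
    (j : ℕ∞) ≤ Module.length A (tor A A (M ⊗[A] N) (kk A) j) := by
  induction j generalizing M with
  | zero => simp
  | succ j ih =>
    obtain ⟨α, β, h1, h2, h3⟩ := kun_les h j
    have i1 := ih (syz A M) (fun j => hM (j+1)) (indep_syz M N h)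
    rw [Module.length_eq_add_of_exact α β h1 h3 h2]
    have hM0 : Nontrivial M := hM 0
    have h4 : Nontrivial (tor A A (cov A M ⊗[A] N) (kk A) (j+1)) := by
      rw [cov_tens_tor, ← nz_succ]
      exact hN _
    have h5 : (1 : ℕ∞) ≤ Module.length A (tor A A (cov A M ⊗[A] N) (kk A) (j+1)) := by
      rw [Order.one_le_iff_ne_zero]
      intro h0
      rw [Module.length_eq_zero_iff] at h0
      exact not_subsingleton _ h0
    have h6 := add_le_add h5 i1
    rwa [show (1 : ℕ∞) + (j : ℕ∞) = ((j + 1 : ℕ) : ℕ∞) by push_cast; ring] at h6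

variable (D : ℕ) (hchg : ∀ (Y : Type u) [AddCommGroup Y] [Module A Y] (i : ℕ),
    (D ≤ i + 2 → Module.length A (tor A A Y (kk A) (i+2)) ≤ Module.length A (tor A A Y (kk A) i)) ∧
    (D ≤ i + 1 → Subsingleton (tor A A Y (kk A) (i+2)) → Subsingleton (tor A A Y (kk A) i)))

include hchg in
lemma pd_fin (M N : Type u) [AddCommGroup M] [Module A M] [Module.Finite A M]
    [AddCommGroup N] [Module A N] [Module.Finite A N]
    (hMN : ∀ j, nz (A := A) M j ↔ nz (A := A) N j) (h : ∀ i, Subsingleton (tor A A M N i)) :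
    ∃ j, ¬ nz (A := A) M j := by
  by_contra hc
  push Not at hc
  have g := fun j => growth (A := A) N (fun j => (hMN j).1 (hc j)) j M hc h
  have hb : ∀ m, Module.length A (tor A A (M ⊗[A] N) (kk A) (D + 2 * m)) ≤ 
      Module.length A (tor A A (M ⊗[A] N) (kk A) D) := by
    intro m
    induction m with
    | zero => exact le_rfl
    | succ m ih => exact ((hchg (M ⊗[A] N) (D + 2 * m)).1 (by omega)).trans ih
  have hfin := bet_ne_top A (M ⊗[A] N) (D+1)
  rw [bet_succ] at hfin
  obtain ⟨c, hcc⟩ := ENat.ne_top_iff_exists.1 hfin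
  have h1 := (g (D + 2 * (c+1))).trans (hb (c+1))
  rw [← hcc, Nat.cast_le] at h1
  omega

/-- index of the last nonzero Betti number -/
def BTop (X : Type u) [AddCommGroup X] [Module A X] (s : ℕ) : Prop :=
  nz (A := A) X s ∧ ¬ nz (A := A) X (s+1)

lemma BTop.le {X : Type u} [AddCommGroup X] [Module A X] [Module.Finite A X] {s j : ℕ} (h : BTop (A := A) X s)
    (hj : nz (A := A) X j) : j ≤ s := by
  by_contra hc
  apply h.2
  apply nz_down (s+1) (j - (s+1))
  rwa [show s + 1 + (j - (s+1)) = j by omega]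

lemma exists_btop (M : Type u) [AddCommGroup M] [Module A M] [Module.Finite A M] [hM : Nontrivial M]
    (h : ∃ j, ¬ nz (A := A) M j) : ∃ s, BTop (A := A) M s := by
  classical
  have h1 := Nat.find_spec h
  have h2 := fun m => Nat.find_min h (m := m)
  cases hs : Nat.find h with
  | zero => rw [hs] at h1; exact absurd hM h1
  | succ s => 
    rw [hs] at h1 h2
    exact ⟨s, not_not.1 (h2 s (by omega)), h1⟩

lemma BTop.tens {M N : Type u} [AddCommGroup M] [Module A M] [Module.Finite A M]
    [AddCommGroup N] [Module A N] [Module.Finite A N] (h : ∀ i, Subsingleton (tor A A M N i)) {s t : ℕ}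
    (hs : BTop (A := A) M s) (ht : BTop (A := A) N t) : BTop (A := A) (M ⊗[A] N) (s + t) := by
  constructor
  · rw [nz_kun M N h]
    exact ⟨s, t, rfl, hs.1, ht.1⟩
  · rw [nz_kun M N h]
    rintro ⟨a, b, h1, h2, h3⟩
    have := hs.le h2
    have := ht.le h3
    omega

lemma BTop.congr {X Y : Type u} [AddCommGroup X] [Module A X] [AddCommGroup Y] [Module A Y]
    [Module.Finite A X] [Module.Finite A Y] (e : X ≃ₗ[A] Y) {s : ℕ} (h : BTop (A := A) X s) : 
    BTop (A := A) Y s :=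
  ⟨(nz_congr e s).1 h.1, fun h' => h.2 ((nz_congr e (s+1)).2 h')⟩

lemma BTop.TP {M : Type u} [AddCommGroup M] [Module A M] [Module.Finite A M] {s : ℕ} 
    (hs : BTop (A := A) M s) (n : ℕ)
    (h : ∀ j < n + 1, ∀ i, Subsingleton (tor A A M (TensorPower A j M) i)) : 
    BTop (A := A) (TensorPower A (n+1) M) ((n+1)*s) := by
  induction n with
  | zero =>
    have := TP_fin (R := A) M 1
    rw [zero_add, one_mul]
    exact hs.congr (TPone (R := A) M).symm
  | succ n ih =>
    have h1 := ih (fun j hj => h j (by omega))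
    have := TP_fin (R := A) M (n+1)
    have := TP_fin (R := A) M (n+1+1)
    have h2 := hs.tens (h (n+1) (by omega)) h1
    rw [show (n+1+1)*s = s + (n+1)*s by ring]
    exact (h2.congr (TensorProduct.comm A _ _)).congr (TPsucc (R := A) M (n+1)).symm

include hchg in
lemma bound_aux (Y Y' : Type u) [AddCommGroup Y] [Module A Y] [Module.Finite A Y]
    [AddCommGroup Y'] [Module A Y'] [Module.Finite A Y'] (b : ℕ) (hb : BTop (A := A) Y b) (y : A) 
    (hy : y ∈ IsLocalRing.maximalIdeal A) (hreg : Function.Injective (LinearMap.lsmul A Y y))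
    (p : Y →ₗ[A] Y') (hp : Function.Exact (LinearMap.lsmul A Y y) p) (hps : Function.Surjective p) :
    b + 2 ≤ D := by
  by_contra hc
  have z : ∀ i, ∀ t : tor A A Y (kk A) i, torMap A (kk A) (LinearMap.lsmul A Y y) i t = 0 := by
    intro i t
    rw [torMap, T1map_lsmul]
    exact tor_killed (A := A) (B := A) Y (kk A) y (kk_kill y hy) i t
  have h1 : Subsingleton (tor A A Y' (kk A) (b+2)) := by
    obtain ⟨δ, e1, e2⟩ := tor_les (A := A) (kk A) hreg hp hps (b+1)
    refine sub_of_exact e1 ?_ ?_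
    · rw [← not_nontrivial_iff_subsingleton, ← nz_succ]
      intro h; have := hb.le h; omega
    · rw [← not_nontrivial_iff_subsingleton, ← nz_succ]
      intro h; have := hb.le h; omega
  have h2 : Nontrivial (tor A A Y' (kk A) b) := by
    cases b with
    | zero =>
      obtain ⟨δ, e1, e2⟩ := T1_les0 (A := A) (kk A) hreg hp hps
      have hs : Function.Surjective δ := by
        intro u
        apply (e2 u).1
        rw [rT_lsmul]
        rw [LinearMap.lsmul_apply]
        induction u with
        | zero => simp
        | add u v hu hv => rw [smul_add, hu, hv, add_zero]
        | tmul u v => rw [← tmul_smul, kk_kill y hy, tmul_zero]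
      have : Nontrivial (Y ⊗[A] kk A) := by
        have h0 : Nontrivial Y := hb.1
        by_contra h
        rw [not_nontrivial_iff_subsingleton] at h
        exact not_subsingleton Y (k_tens_zero A _ ((TensorProduct.comm A _ _).toEquiv.symm.subsingleton))
      exact hs.nontrivial
    | succ b =>
      obtain ⟨δ, e1, e2⟩ := tor_les (A := A) (kk A) hreg hp hps b
      have hs : Function.Surjective δ := fun u => (e2 u).1 (z b u)
      have : Nontrivial (tor A A Y (kk A) b) := (nz_succ Y b).1 hb.1
      exact hs.nontrivial
  exact not_subsingleton _ ((hchg Y' b).2 (by omega) h1)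

include hchg in
lemma bound (Y : Type u) [AddCommGroup Y] [Module A Y] [Module.Finite A Y] (b : ℕ) (hb : BTop (A := A) Y b) 
    (y : A) (hy : y ∈ IsLocalRing.maximalIdeal A) (hreg : Function.Injective (LinearMap.lsmul A Y y)) :
    b + 2 ≤ D :=
  bound_aux D hchg Y (Y ⧸ LinearMap.range (LinearMap.lsmul A Y y)) b hb y hy hreg
    (Submodule.mkQ _) (LinearMap.exact_map_mkQ_range _) (Submodule.mkQ_surjective _)

include hchg in
theorem main_aux (d : ℕ) (hD : D ≤ d + 1) (hy : ∃ y ∈ nonZeroDivisors A, y ∈ IsLocalRing.maximalIdeal A)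
    (M : Type u) [AddCommGroup M] [Module A M] [Module.Finite A M]
    (hrig : ∀ (C : Type u) [AddCommGroup C] [Module A C] [Module.Finite A C],
      Subsingleton (tor A A M C 0) → ∀ i, Subsingleton (tor A A M C i))
    (hW : WF A M) (n : ℕ) (hn : 2 ≤ n) (htf : Submodule.torsion A (TensorPower A n M) = ⊥) :
    ∃ k : ℕ, pdLE A k M ∧ n * k ≤ d - 1 := by
  by_cases hM : Nontrivial M
  · have hit := tf_iter M hrig hW n htf
    have f1 := TP_fin (R := A) M 1
    have fn := TP_fin (R := A) M n
    obtain ⟨s, hs⟩ := exists_btop M (pd_fin D hchg M (TensorPower A 1 M) 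
      (fun j => nz_congr (TPone (R := A) M).symm j) (hit 1 (by omega)))
    refine ⟨s, pdLE_of_nz s M hs.2, ?_⟩
    obtain ⟨n, rfl⟩ : ∃ m, n = m + 1 := ⟨n - 1, by omega⟩
    have h1 := hs.TP n hit
    obtain ⟨y, hy1, hy2⟩ := hy
    have h2 := bound D hchg (TensorPower A (n+1) M) _ h1 y hy2 (by
      rw [injective_iff_map_eq_zero]
      exact (TF_iff (R := A) _).1 htf y hy1)
    omega
  · rw [not_nontrivial_iff_subsingleton] at hM
    refine ⟨0, ?_, by simp⟩
    change Module.Projective A M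
    infer_instance
end top
end

section
set_option linter.unusedSectionVars false
set_option linter.style.haveILetI false
open TensorProduct

/-! ## Dimension and depth facts -/
section dims
variable {Q : Type u} [CommRing Q] [IsNoetherianRing Q] [IsLocalRing Q]

lemma RS_nontriv {L : List Q} {G G' : Type u} [AddCommGroup G] [Module Q G] [AddCommGroup G'] [Module Q G']
    [Nontrivial G'] (h : RS Q L G G') : Nontrivial G := by
  induction L generalizing G with
  | nil => obtain ⟨e⟩ := h; exact e.toEquiv.nontrivial
  | cons z L ih =>
    obtain ⟨G1, _, _, b, h1, h2, h3, h4⟩ := h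
    haveI := ih h4
    exact h3.nontrivial

lemma RS_mem {z : Q} {L : List Q} {G G' : Type u} [AddCommGroup G] [Module Q G] [AddCommGroup G'] [Module Q G']
    [Nontrivial G'] (h : RS Q (z :: L) G G') : z ∈ IsLocalRing.maximalIdeal Q := by
  obtain ⟨G1, _, _, b, h1, h2, h3, h4⟩ := h
  haveI := RS_nontriv h4
  rw [IsLocalRing.mem_maximalIdeal, mem_nonunits_iff]
  intro hz
  obtain ⟨g, hg⟩ := exists_ne (0 : G1)
  obtain ⟨x, rfl⟩ := h3 g
  apply hg
  obtain ⟨u, rfl⟩ := hz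
  refine (h2 x).2 ⟨(↑u⁻¹ : Q) • x, ?_⟩
  simp [smul_smul]

lemma RS_dim {L : List Q} {G G' : Type u} [AddCommGroup G] [Module Q G] [Module.Finite Q G]
    [AddCommGroup G'] [Module Q G']
    [Nontrivial G'] (h : RS Q L G G') : (L.length : WithBot ℕ∞) ≤ Module.supportDim Q G := by
  induction L generalizing G with
  | nil =>
    haveI := RS_nontriv h
    have := Module.supportDim_ne_bot_of_nontrivial Q G
    obtain ⟨a, ha⟩ := WithBot.ne_bot_iff_exists.1 this
    rw [← ha]
    simp
  | cons z L ih =>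
    have hz := RS_mem h
    obtain ⟨G1, _, _, b, h1, h2, h3, h4⟩ := h
    haveI : Module.Finite Q G1 := Module.Finite.of_surjective b h3
    have e : QuotSMulTop z G ≃ₗ[Q] G1 := by
      refine (Submodule.quotEquivOfEq _ _ ?_).trans (b.quotKerEquivOfSurjective h3)
      rw [LinearMap.exact_iff.1 h2]
      ext x
      simp [Submodule.mem_smul_pointwise_iff_exists]
    have := ih h4
    rw [← Module.supportDim_quotSMulTop_succ_eq_supportDim (M := G) (x := z) h1 hz,
      Module.supportDim_eq_of_equiv e]
    simp only [List.length_cons, Nat.cast_add, Nat.cast_one]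
    gcongr

/-- length at least two or the maximal ideal is nilpotent modulo `f` -/
lemma RS_two {L : List Q} (h : RS Q L Q (IsLocalRing.ResidueField Q)) (f : Q)
    (hf : f ∈ nonZeroDivisors Q) (hfm : f ∈ IsLocalRing.maximalIdeal Q) :
    2 ≤ L.length ∨ ∃ a, IsLocalRing.maximalIdeal Q ^ a ≤ Ideal.span {f} := by
  have hf0 : f ≠ 0 := nonZeroDivisors.ne_zero hf
  have key : ∀ x ∈ IsLocalRing.maximalIdeal Q, ∀ y : IsLocalRing.ResidueField Q, x • y = 0 := by
    intro x hx y
    rw [Algebra.smul_def, IsLocalRing.ResidueField.algebraMap_eq, (IsLocalRing.residue_eq_zero_iff x).2 hx, zero_mul]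
  match L, h with
  | [], h =>
    obtain ⟨e⟩ := h
    exfalso
    apply hf0
    apply e.injective
    have := key f hfm (e 1)
    rw [← map_smul, smul_eq_mul, mul_one] at this
    rw [this, map_zero]
  | [z], h =>
    right
    have hz := RS_mem h
    obtain ⟨G1, _, _, b, h1, h2, h3, ⟨e⟩⟩ := h
    have hm : IsLocalRing.maximalIdeal Q = Ideal.span {z} := by
      apply le_antisymm
      · intro x hx
        have h5 : b x = 0 := by
          apply e.injective
          have := key x hx (e (b 1))
          rw [← map_smul, ← map_smul, smul_eq_mul, mul_one] at this
          rw [this, map_zero]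
        obtain ⟨y, hy⟩ := (h2 x).1 h5
        exact Ideal.mem_span_singleton'.2 ⟨y, by rw [mul_comm]; exact hy⟩
      · rw [Ideal.span_singleton_le_iff_mem]; exact hz
    have h6 : ∃ a, f ∉ IsLocalRing.maximalIdeal Q ^ a := by
      by_contra! h7
      have h8 := Ideal.iInf_pow_eq_bot_of_isLocalRing (IsLocalRing.maximalIdeal Q) Ideal.IsPrime.ne_top'
      have h9 : f ∈ (⨅ i, IsLocalRing.maximalIdeal Q ^ i) := by simpa [Submodule.mem_iInf] using h7
      rw [h8] at h9
      exact hf0 (by simpa using h9)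
    classical
    have h10 := Nat.find_spec h6
    obtain ⟨a, ha⟩ : ∃ a, Nat.find h6 = a + 1 := by
      refine ⟨Nat.find h6 - 1, ?_⟩
      have : Nat.find h6 ≠ 0 := by
        intro h0; rw [h0] at h10; simp at h10
      omega
    have h11 : f ∈ IsLocalRing.maximalIdeal Q ^ a := not_not.1 (Nat.find_min h6 (m := a) (by omega))
    rw [ha] at h10
    refine ⟨a, ?_⟩
    rw [hm, Ideal.span_singleton_pow] at h10 h11 ⊢
    obtain ⟨u, hu⟩ := Ideal.mem_span_singleton'.1 h11
    have hunit : IsUnit u := by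
      by_contra hu'
      have : u ∈ IsLocalRing.maximalIdeal Q := hu'
      rw [hm] at this
      obtain ⟨v, rfl⟩ := Ideal.mem_span_singleton'.1 this
      exact h10 (Ideal.mem_span_singleton'.2 ⟨v, by rw [← hu]; ring⟩)
    obtain ⟨u, rfl⟩ := hunit
    rw [Ideal.span_singleton_le_span_singleton]
    exact ⟨↑u⁻¹, by rw [← hu]; rw [mul_comm (u : Q), mul_assoc]; simp⟩
  | z :: w :: L, _ => left; simp

/-- the depth of `Q/f` is positive if the length is at least two -/
lemma RS_depth {L : List Q} (h : RS Q L Q (IsLocalRing.ResidueField Q)) (hL : 2 ≤ L.length) (f : Q)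
    (hf : f ∈ nonZeroDivisors Q) (q : Q) (hq : ∀ z ∈ IsLocalRing.maximalIdeal Q, z * q ∈ Ideal.span {f}) :
    q ∈ Ideal.span {f} := by
  match L, h, hL with
  | z :: w :: L, h, _ =>
    have hz := RS_mem h
    obtain ⟨G1, _, _, b, h1, h2, h3, h4⟩ := h
    have hw := RS_mem h4
    obtain ⟨G2, _, _, c, h5, h6, h7, h8⟩ := h4
    obtain ⟨g, hg⟩ := Ideal.mem_span_singleton'.1 (hq z hz)
    obtain ⟨k, hk⟩ := Ideal.mem_span_singleton'.1 (hq w hw)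
    have e1 : w * g = z * k := by
      apply mem_nonZeroDivisors_iff_right.1 hf |> fun H => sub_eq_zero.1 (H _ ?_)
      rw [sub_mul, mul_assoc, hg, mul_assoc, hk]; ring
    have e2 : b g = 0 := by
      apply h5
      simp only [LinearMap.lsmul_apply, smul_zero]
      rw [← map_smul, smul_eq_mul, e1]
      exact (h2 _).2 ⟨k, rfl⟩
    obtain ⟨t, ht⟩ := (h2 g).1 e2
    simp only [LinearMap.lsmul_apply, smul_eq_mul] at ht
    refine Ideal.mem_span_singleton'.2 ⟨t, ?_⟩
    apply h1
    simp only [LinearMap.lsmul_apply, smul_eq_mul]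
    rw [← hg, ← ht]; ring

end dims

section compl
variable {R S : Type u} [CommRing R] [IsNoetherianRing R] [IsLocalRing R] [CommRing S] [Algebra R S]
  {Q : Type u} [CommRing Q] [IsNoetherianRing Q] [IsLocalRing Q] [IsLocalRing S]
  [IsLocalHom (algebraMap R S)] [Module.Flat R S] (π : Q →+* S) (f : Q) (L : List Q)

/-- dimension bound -/
lemma dim_bound (hm : IsLocalRing.maximalIdeal S = (IsLocalRing.maximalIdeal R).map (algebraMap R S))
    (hπ : Function.Surjective π) (hk : RingHom.ker π = Ideal.span {f})
    (hfm : f ∈ IsLocalRing.maximalIdeal Q) (h : RS Q L Q (IsLocalRing.ResidueField Q))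
    (d : ℕ) (hd : ringKrullDim R = (d : ℕ)) : L.length ≤ d + 1 := by
  classical
  have h1 := RS_dim h
  rw [Module.supportDim_self_eq_ringKrullDim, ← IsLocalRing.maximalIdeal_height_eq_ringKrullDim] at h1
  obtain ⟨s, hs1, hs2⟩ := Ideal.exists_finset_card_eq_height_of_isNoetherianRing (IsLocalRing.maximalIdeal R)
  rw [← IsLocalRing.maximalIdeal_height_eq_ringKrullDim] at hd
  have hsd : s.card = d := by
    rw [← hs2] at hd
    exact_mod_cast hd
  let g : R → Q := fun x => Function.surjInv hπ (algebraMap R S x)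
  have hg : ∀ x, π (g x) = algebraMap R S x := fun x => Function.surjInv_eq hπ _
  haveI : IsLocalHom π := IsLocalHom.of_surjective π hπ
  let I : Ideal Q := Ideal.span ((insert f (s.image g) : Finset Q) : Set Q)
  have hsm : ∀ x ∈ s, x ∈ IsLocalRing.maximalIdeal R := fun x hx => hs1.1.2 (Ideal.subset_span hx)
  have hIm : I ≤ IsLocalRing.maximalIdeal Q := by
    rw [Ideal.span_le]
    intro x hx
    simp only [Finset.coe_insert, Finset.coe_image, Set.mem_insert_iff, Set.mem_image] at hx
    obtain rfl | ⟨y, hy, rfl⟩ := hx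
    · exact hfm
    · have : π (g y) ∈ IsLocalRing.maximalIdeal S := by
        rw [hg, hm]; exact Ideal.mem_map_of_mem _ (hsm y hy)
      exact fun hu => this (hu.map π)
  have hpow : ∃ N, IsLocalRing.maximalIdeal R ^ N ≤ Ideal.span (s : Set R) := by
    apply Ideal.exists_pow_le_of_le_radical_of_fg _ (IsNoetherian.noetherian _)
    rw [Ideal.radical_eq_sInf]
    refine le_sInf ?_
    rintro p ⟨hp1, hp2⟩
    exact hs1.2 ⟨hp2, hp1⟩ (IsLocalRing.le_maximalIdeal hp2.ne_top)
  obtain ⟨N, hN⟩ := hpow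
  have hmap : (Ideal.span (s : Set R)).map (algebraMap R S) ≤ I.map π := by
    rw [Ideal.map_span, Ideal.span_le]
    rintro _ ⟨x, hx, rfl⟩
    rw [SetLike.mem_coe, ← hg]
    exact Ideal.mem_map_of_mem _ (Ideal.subset_span (by simp; right; exact ⟨x, hx, rfl⟩))
  have hQ : IsLocalRing.maximalIdeal Q ^ N ≤ I := by
    have h2 : (IsLocalRing.maximalIdeal Q).map π ≤ IsLocalRing.maximalIdeal S := by
      rw [Ideal.map_le_iff_le_comap]
      intro x hx hu
      exact hx ((isUnit_map_iff π x).1 hu)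
    have h3 : (IsLocalRing.maximalIdeal Q ^ N).map π ≤ I.map π := by
      rw [Ideal.map_pow]
      refine (Ideal.pow_right_mono h2 N).trans ?_
      rw [hm, ← Ideal.map_pow]
      exact (Ideal.map_mono hN).trans hmap
    rw [Ideal.map_le_iff_le_comap, Ideal.comap_map_of_surjective' π hπ, hk] at h3
    refine h3.trans (sup_le le_rfl ?_)
    rw [Ideal.span_singleton_le_iff_mem]
    exact Ideal.subset_span (by simp)
  have hmin : IsLocalRing.maximalIdeal Q ∈ I.minimalPrimes := by
    refine ⟨⟨inferInstance, hIm⟩, ?_⟩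
    rintro p ⟨hp1, hp2⟩ _
    exact hp1.le_of_pow_le (hQ.trans hp2)
  have h4 := Ideal.height_le_card_of_mem_minimalPrimes_span_finset hmin
  have h5 : (insert f (s.image g)).card ≤ d + 1 := by
    refine (Finset.card_insert_le _ _).trans ?_
    have := Finset.card_image_le (s := s) (f := g)
    omega
  have h6 : (L.length : ℕ∞) ≤ (IsLocalRing.maximalIdeal Q).height := by exact_mod_cast h1
  have h7 := h6.trans h4
  have h8 : L.length ≤ (insert f (s.image g)).card := by exact_mod_cast h7
  omega

/-- positive depth -/
lemma depth_pos (hm : IsLocalRing.maximalIdeal S = (IsLocalRing.maximalIdeal R).map (algebraMap R S))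
    (hπ : Function.Surjective π) (hk : RingHom.ker π = Ideal.span {f})
    (hfm : f ∈ IsLocalRing.maximalIdeal Q) (hf : f ∈ nonZeroDivisors Q)
    (h : RS Q L Q (IsLocalRing.ResidueField Q))
    (d : ℕ) (hd : ringKrullDim R = (d : ℕ)) (hd1 : 1 ≤ d) (x : R)
    (hx : ∀ z ∈ IsLocalRing.maximalIdeal R, z * x = 0) : x = 0 := by
  haveI : Module.FaithfullyFlat R S := Module.FaithfullyFlat.of_flat_of_isLocalHom
  have hinj : Function.Injective (algebraMap R S) := FaithfulSMul.algebraMap_injective R S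
  haveI : IsLocalHom π := IsLocalHom.of_surjective π hπ
  have h2 : (IsLocalRing.maximalIdeal Q).map π = IsLocalRing.maximalIdeal S := by
    apply le_antisymm
    · rw [Ideal.map_le_iff_le_comap]
      intro x hx hu
      exact hx ((isUnit_map_iff π x).1 hu)
    · intro y hy
      obtain ⟨z, rfl⟩ := hπ y
      exact Ideal.mem_map_of_mem _ (fun hu => hy (hu.map π))
  have hL : 2 ≤ L.length := by
    rcases RS_two h f hf hfm with h3 | ⟨a, ha⟩
    · exact h3
    exfalso
    have h3 : IsLocalRing.maximalIdeal R ^ a = ⊥ := by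
      have h4 : (IsLocalRing.maximalIdeal Q ^ a).map π ≤ ⊥ := by
        rw [Ideal.map_le_iff_le_comap]
        rw [← hk] at ha
        exact ha
      rw [Ideal.map_pow, h2, hm, ← Ideal.map_pow] at h4
      rw [eq_bot_iff]
      intro y hy
      have := h4 (Ideal.mem_map_of_mem (algebraMap R S) hy)
      exact hinj (by simpa using this)
    have h5 : IsArtinianRing R := (isArtinianRing_iff_isNilpotent_maximalIdeal R).2 ⟨a, h3⟩
    rw [isArtinianRing_iff_krullDimLE_zero, Ring.krullDimLE_iff, hd] at h5
    have : d ≤ 0 := by exact_mod_cast h5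
    omega
  obtain ⟨q, hq⟩ := hπ (algebraMap R S x)
  have hx2 : ∀ y ∈ IsLocalRing.maximalIdeal S, y * algebraMap R S x = 0 := by
    intro y hy
    rw [hm] at hy
    have : (IsLocalRing.maximalIdeal R).map (algebraMap R S) ≤ LinearMap.ker (LinearMap.toSpanSingleton S S (algebraMap R S x)) := by
      rw [Ideal.map_le_iff_le_comap]
      intro z hz
      rw [Ideal.mem_comap, LinearMap.mem_ker, LinearMap.toSpanSingleton_apply, smul_eq_mul, ← map_mul, hx z hz, map_zero]
    simpa using this hy
  have h3 := RS_depth h hL f hf q (fun z hz => by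
    rw [← hk, RingHom.mem_ker, map_mul, hq]
    apply hx2
    rw [← h2]
    exact Ideal.mem_map_of_mem _ hz)
  rw [← hk, RingHom.mem_ker, hq] at h3
  exact hinj (by rw [h3, map_zero])

end compl
end

set_option linter.unusedSectionVars false
set_option linter.style.haveILetI false
open TensorProduct

/-- torsion in tensor powers over a hypersurface whose completion is a
hypersurface in an unramified regular local ring, given vanishing of the theta pairing. -/
theorem stmt16 (R : Type u) [CommRing R] [IsNoetherianRing R] [IsLocalRing R]
    (d : ℕ) (hd : ringKrullDim R = (d : ℕ)) (hd1 : 1 ≤ d)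
    (hhyp : ∃ (Q : Type u) (_ : CommRing Q), IsUnramifiedRegLocal Q ∧
      ∃ f : Q, f ∈ nonunits Q ∧ f ∈ nonZeroDivisors Q ∧
        Nonempty ((Q ⧸ Ideal.span {f}) ≃+* AdicCompletion (Ideal.span (nonunits R)) R))
    (M : Type u) [AddCommGroup M] [Module R M] [Module.Finite R M]
    (hpd : ∀ (p : Ideal R) (hp : p.IsPrime), p ≠ IsLocalRing.maximalIdeal R →
      ∃ k : ℕ, pdLE (Localization.AtPrime p) k (LocalizedModule p.primeCompl M))
    (hθ : ∀ (N : Type u) [AddCommGroup N] [Module R N] [Module.Finite R N],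
      (∃ n0 : ℕ, ∀ i ≥ n0, IsFiniteLength R (TorM R i M N)) →
      ∃ n0 : ℕ, ∀ n ≥ n0, mlen R (TorM R (2 * n) M N) = mlen R (TorM R (2 * n - 1) M N)) :
    (∀ n : ℕ, 2 ≤ n → Submodule.torsion R (TensorPower R n M) = ⊥ →
      ∃ k : ℕ, pdLE R k M ∧ n * k ≤ d - 1) ∧
    (¬ Module.Free R M → ∀ n : ℕ, max 2 d ≤ n → Submodule.torsion R (TensorPower R n M) ≠ ⊥) := by
  obtain ⟨V, _, _, _, r, LV, f, π, hP⟩ := struct_thm R hhyp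
  have hP' : PSPres R V r LV f π := hP
  obtain ⟨hlen, hLV, hfm, hf, hs, hk⟩ := hP
  haveI : Module.Flat R (AdicCompletion (IsLocalRing.maximalIdeal R) R) :=
    AdicCompletion.flat_of_isNoetherian _
  have hm := (AdicCompletion.maximalIdeal_eq_map (R := R))
  obtain ⟨LA, hl, hLA⟩ := kosz_RSQ V r LV hLV
  have hloc : IsLocalHom (algebraMap R (AdicCompletion (IsLocalRing.maximalIdeal R) R)) := by
    refine ((IsLocalRing.local_hom_TFAE _).out 2 0).1 ?_
    rw [hm]
  have hD := dim_bound π f LA hm hs hk hfm hLA d hd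
  rw [hl] at hD
  have hsoc := depth_pos π f LA hm hs hk hfm hf hLA d hd hd1
  have hy : ∃ y ∈ nonZeroDivisors R, y ∈ IsLocalRing.maximalIdeal R := by
    by_contra! h1
    have h2 := Ideal.bot_lt_annihilator_of_disjoint_nonZeroDivisors (I := IsLocalRing.maximalIdeal R)
      (Set.disjoint_left.2 fun y hy1 hy2 => h1 y hy2 hy1)
    apply h2.ne
    symm
    rw [eq_bot_iff]
    intro x hx
    refine hsoc x fun z hz => ?_
    have := Module.mem_annihilator.1 hx (⟨z, hz⟩ : IsLocalRing.maximalIdeal R)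
    have := congrArg Subtype.val this
    rw [mul_comm]
    simpa using this
  have hW : WF R M := by
    refine WF_of_ass M fun p hp hpa => hpd p hp ?_
    rintro rfl
    rw [AssociatedPrimes.mem_iff, isAssociatedPrime_iff] at hpa
    obtain ⟨_, x, hx⟩ := hpa
    have hx0 : x = 0 := hsoc x fun z hz => by
      rw [hx, Submodule.mem_colon_singleton] at hz
      simpa using hz
    rw [hx0] at hx
    apply hp.ne_top
    rw [hx, Ideal.eq_top_iff_one, Submodule.mem_colon_singleton]
    simp
  have hmain : ∀ n : ℕ, 2 ≤ n → Submodule.torsion R (TensorPower R n M) = ⊥ →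
      ∃ k : ℕ, pdLE R k M ∧ n * k ≤ d - 1 := fun n hn htf =>
    main_aux (LV.length + r) (fun Y _ _ i => chgP hP' Y i) d hD hy M
      (fun C _ _ _ h0 i => rigid_R hP' M hpd C (hθ C) h0 i) hW n hn htf
  refine ⟨hmain, fun hfree n hn htf => hfree ?_⟩
  obtain ⟨k, hk1, hk2⟩ := hmain n (le_trans (le_max_left _ _) hn) htf
  have hnd : d ≤ n := le_trans (le_max_right _ _) hn
  have hk0 : k = 0 := by
    by_contra h
    have : n * 1 ≤ n * k := Nat.mul_le_mul_left n (Nat.one_le_iff_ne_zero.2 h)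
    omega
  subst hk0
  haveI : Module.Projective R M := hk1
  exact Module.free_of_flat_of_isLocalRing

end
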